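/- Let p be a prime, k a finite field extension of ℚ_p, and X an integral scheme that is proper, normal and of finite type over k, with k relatively algebraically closed in the function field K = k(X) (this expresses geometric irreducibility in characteristic zero). Then for every birational Galois section s : Gal_k → Gal_K there exists a UNIQUE valuation subring Ō of K̄ with k ⊆ Ō such that s(Gal_k) is contained in the decomposition subgroup D_Ō and the valuation subring Ō ∩ K of K has residue field k. In particular, conjugacy classes of birational Galois sections come in disjoint packets associated to k-valuations of K with residue field k. -/

import Mathlib

/-!
Main theorem (birational p-adic Galois sections in higher dimensions):
for a geometrically irreducible, normal, proper variety `X` over a finite extension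
`k/ℚ_p` with function field `K = k(X)`, every birational Galois section has image in
the decomposition subgroup `D_Ō ⊆ Gal_K` of a unique `k`-valuation `Ō` of `K̄` whose
restriction to `K` has residue field `k`.

Setup: `Kbar` is an algebraic closure of `K = X.functionField`,
`kbar := algebraicClosure k Kbar` is the algebraic closure of `k` inside `Kbar`,
`Gal_K := Kbar ≃ₐ[K] Kbar`, `Gal_k := kbar ≃ₐ[k] kbar` (Krull topologies), and
`resHom : Gal_K →* Gal_k` is the restriction homomorphism.
-/

open AlgebraicGeometry CategoryTheory

/-- The restriction homomorphism `Gal(Kbar/F) →* Gal(kbar/k)`, where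
`kbar = algebraicClosure k Kbar` is the relative algebraic closure of `k` in `Kbar`. -/
noncomputable def resHom (k F Kbar : Type*) [Field k] [Field F] [Field Kbar]
    [Algebra k F] [Algebra F Kbar] [Algebra k Kbar] [IsScalarTower k F Kbar]
    [IsAlgClosed Kbar] :
    (Kbar ≃ₐ[F] Kbar) →* ((algebraicClosure k Kbar) ≃ₐ[k] (algebraicClosure k Kbar)) :=
  (AlgEquiv.restrictNormalHom (F := k) (K₁ := Kbar) (algebraicClosure k Kbar)).comp
    { toFun := fun σ => σ.restrictScalars k
      map_one' := rfl
      map_mul' := fun _ _ => rfl }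

/-- The composite `k → O → O/m_O` from `k` to the residue field of a valuation subring `O`
of a field extension `K` of `k` containing (the image of) `k`. -/
noncomputable def residueEmbed {k K : Type*} [Field k] [Field K] [Algebra k K]
    (O : ValuationSubring K) (h : ∀ a : k, algebraMap k K a ∈ O) :
    k → IsLocalRing.ResidueField O :=
  fun a => IsLocalRing.residue O ⟨algebraMap k K a, h a⟩

open scoped NNReal

namespace PadicSection

/-! ### A rigidity criterion producing valuation rings -/

/-- A set of nonzero elements of a field which is a subgroup of the multiplicative group. -/
structure IsMulSubgroup {L : Type*} [Field L] (T : Set L) : Prop where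
  one_mem : (1 : L) ∈ T
  mul_mem : ∀ {x y : L}, x ∈ T → y ∈ T → x * y ∈ T
  inv_mem : ∀ {x : L}, x ∈ T → x⁻¹ ∈ T
  ne_zero : ∀ {x : L}, x ∈ T → x ≠ 0

namespace IsMulSubgroup

variable {L : Type*} [Field L] {T : Set L} (hT : IsMulSubgroup T)
include hT

theorem div_mem {x y : L} (hx : x ∈ T) (hy : y ∈ T) : x / y ∈ T := by
  rw [div_eq_mul_inv]; exact hT.mul_mem hx (hT.inv_mem hy)

theorem mul_mem_iff_left {x y : L} (hx : x ∈ T) : x * y ∈ T ↔ y ∈ T := by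
  refine ⟨fun h => ?_, hT.mul_mem hx⟩
  have := hT.mul_mem (hT.inv_mem hx) h
  rwa [inv_mul_cancel_left₀ (hT.ne_zero hx)] at this

theorem mul_mem_iff_right {x y : L} (hy : y ∈ T) : x * y ∈ T ↔ x ∈ T := by
  rw [mul_comm, hT.mul_mem_iff_left hy]

theorem div_mem_iff_right {x y : L} (hy : y ∈ T) : x / y ∈ T ↔ x ∈ T := by
  rw [div_eq_mul_inv, hT.mul_mem_iff_right (hT.inv_mem hy)]

theorem inv_mem_iff {x : L} : x⁻¹ ∈ T ↔ x ∈ T :=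
  ⟨fun h => by simpa using hT.inv_mem h, hT.inv_mem⟩

theorem pow_mem {x : L} (hx : x ∈ T) (n : ℕ) : x ^ n ∈ T := by
  induction n with
  | zero => simpa using hT.one_mem
  | succ n ih => rw [pow_succ]; exact hT.mul_mem ih hx

end IsMulSubgroup

/-- The candidate for the part of the maximal ideal outside `H`. -/
def rigidPart {L : Type*} [Field L] (T H : Set L) : Set L :=
  {x | x ≠ 0 ∧ x ∉ H ∧ 1 + x ∈ T}

/-- The candidate for the part of the valuation ring inside `H`. -/
def rigidMultipliers {L : Type*} [Field L] (T H : Set L) : Set L :=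
  {x | x ∈ H ∧ ∀ y ∈ rigidPart T H, x * y ∈ rigidPart T H}

/-- The hypotheses on a pair of multiplicative subgroups `T ⊆ H` which guarantee the existence of
a valuation ring. -/
structure IsRigidPair {L : Type*} [Field L] (T H : Set L) : Prop where
  left : IsMulSubgroup T
  right : IsMulSubgroup H
  le : T ⊆ H
  neg_one_mem : (-1 : L) ∈ T
  rigid : ∀ x : L, x ≠ 0 → x ∉ H → 1 + x ∈ T ∨ (1 + x) / x ∈ T
  neg_mem : ∀ x ∈ rigidPart T H, -x ∈ rigidPart T H
  exists_scale : ∀ x ∈ rigidPart T H, ∀ y ∈ rigidPart T H, ∃ g ∈ H,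
    (∀ z ∈ rigidPart T H, g * z ∈ rigidPart T H) ∧
    (∀ z ∈ rigidPart T H, g⁻¹ * z ∈ rigidPart T H) ∧ g * y / x ∉ T ∧ g * y * x ∉ T

namespace IsRigidPair

variable {L : Type*} [Field L] {T H : Set L} (h : IsRigidPair T H)
include h

local notation "P" => rigidPart T H
local notation "Opl" => rigidMultipliers T H

theorem neg_mem_right_iff {x : L} : -x ∈ H ↔ x ∈ H := by
  rw [neg_eq_neg_one_mul, h.right.mul_mem_iff_left (h.le h.neg_one_mem)]

theorem neg_mem_left_iff {x : L} : -x ∈ T ↔ x ∈ T := by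
  rw [neg_eq_neg_one_mul, h.left.mul_mem_iff_left h.neg_one_mem]

theorem mem_or_inv_mem {x : L} (hx0 : x ≠ 0) (hx : x ∉ H) : x ∈ P ∨ x⁻¹ ∈ P := by
  rcases h.rigid x hx0 hx with h1 | h1
  · exact Or.inl ⟨hx0, hx, h1⟩
  · refine Or.inr ⟨inv_ne_zero hx0, fun h2 => hx (h.right.inv_mem_iff.1 h2), ?_⟩
    have : 1 + x⁻¹ = (1 + x) / x := by field_simp; ring
    rwa [this]

theorem inv_notMem {x : L} (hx : x ∈ P) : x⁻¹ ∉ P := by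
  rintro ⟨-, -, h2⟩
  obtain ⟨hx0, hxH, h1⟩ := hx
  apply hxH
  have : x = (1 + x) / (1 + x⁻¹) := by
    have := h.left.ne_zero h2
    rw [eq_div_iff this]; field_simp; ring
  rw [this]
  exact h.le (h.left.div_mem h1 h2)

/-- If `x ∉ H` and `w = t * x` with `t ∈ T`, then `1 + w ∈ T` or `(1 + w) / x ∈ T`. -/
theorem rigid_mul {x t : L} (hx0 : x ≠ 0) (hx : x ∉ H) (ht : t ∈ T) :
    1 + t * x ∈ T ∨ (1 + t * x) / x ∈ T := by
  have h0 := h.left.ne_zero ht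
  rcases h.rigid (t * x) (mul_ne_zero h0 hx0)
    (by rwa [h.right.mul_mem_iff_left (h.le ht)]) with h1 | h1
  · exact Or.inl h1
  · right
    have : (1 + t * x) / x = t * ((1 + t * x) / (t * x)) := by field_simp
    rw [this]; exact h.left.mul_mem ht h1

theorem div_mem_of_div_mem {a x y : L} (ha : a ≠ 0) (hx : a / x ∈ T) (hy : a / y ∈ T) :
    y / x ∈ T := by
  have := h.left.div_mem hx hy
  have e : a / x / (a / y) = y / x := by
    rcases eq_or_ne y 0 with rfl | hy0
    · simp
    rcases eq_or_ne x 0 with rfl | hx0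
    · simp
    field_simp
  rwa [e] at this

theorem one_sub_mul_mem {x y : L} (hx : x ∈ P) (hy : y ∈ P) (hxy : y / x ∉ T) :
    1 - x * y ∈ T := by
  obtain ⟨hx0, hxH, hx1⟩ := hx
  obtain ⟨hy0, hyH, hy1⟩ := hy
  have key : ∀ {x y : L}, x ≠ 0 → x ∉ H → 1 + x ∈ T → 1 + y ∈ T →
      1 - x * y ∈ T ∨ (1 - x * y) / x ∈ T := by
    intro x y hx0 hxH hx1 hy1
    have ht : -((1 + y) / (1 + x)) ∈ T := h.neg_mem_left_iff.2 (h.left.div_mem hy1 hx1)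
    have hne := h.left.ne_zero hx1
    have e : 1 - x * y = (1 + x) * (1 + -((1 + y) / (1 + x)) * x) := by field_simp; ring
    rcases h.rigid_mul hx0 hxH ht with h1 | h1
    · left; rw [e]; exact h.left.mul_mem hx1 h1
    · right; rw [e, mul_div_assoc]; exact h.left.mul_mem hx1 h1
  rcases key hx0 hxH hx1 hy1 with h1 | h1
  · exact h1
  rcases key hy0 hyH hy1 hx1 with h2 | h2
  · rwa [mul_comm]
  rw [mul_comm y x] at h2
  have hne : 1 - x * y ≠ 0 := fun h0 => h.left.ne_zero h1 (by rw [h0, zero_div])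
  exact absurd (h.div_mem_of_div_mem hne h1 h2) hxy

theorem mul_mem_of_notMem {x y : L} (hx : x ∈ P) (hy : y ∈ P) (hxy : x * y ∉ H) :
    x * y ∈ P := by
  obtain ⟨g, hg, hg1, hg2, h1, -⟩ := h.exists_scale x hx y hy
  have h2 := h.one_sub_mul_mem hx (hg1 y hy) h1
  have hg0 := h.right.ne_zero hg
  have h3 : -(g * (x * y)) ∈ P := by
    refine ⟨neg_ne_zero.2 (mul_ne_zero hg0 (mul_ne_zero hx.1 hy.1)), ?_, ?_⟩
    · rwa [h.neg_mem_right_iff, h.right.mul_mem_iff_left hg]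
    · convert h2 using 1; ring
  have h4 := hg2 _ (h.neg_mem _ h3)
  rwa [neg_neg, inv_mul_cancel_left₀ hg0] at h4

theorem mul_mul_mem_of_notMem {x y z : L} (hx : x ∈ P) (hy : y ∈ P) (hz : z ∈ P)
    (hxyz : x * y * z ∉ H) : x * y * z ∈ P := by
  obtain ⟨g, hg, hg1, hg2, h1, h1'⟩ := h.exists_scale x hx y hy
  have hg0 := h.right.ne_zero hg
  have hgy := hg1 y hy
  set w := g * y with hw
  have h2 := h.one_sub_mul_mem hx hgy h1
  have e0 : x * w * z = g * (x * y * z) := by rw [hw]; ring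
  have hnH : x * w * z ∉ H := by rwa [e0, h.right.mul_mem_iff_left hg]
  have hn0 : x * w * z ≠ 0 := mul_ne_zero (mul_ne_zero hx.1 hgy.1) hz.1
  have hz1 : 1 - z ∈ T := by have := (h.neg_mem z hz).2.2; rwa [← sub_eq_add_neg] at this
  have hz10 := h.left.ne_zero hz1
  have e : 1 - x * w * z = (1 - z) * (1 + (1 - x * w) / (1 - z) * z) := by field_simp; ring
  have h3 : 1 - x * w * z ∈ T ∨ (1 - x * w * z) / z ∈ T := by
    rcases h.rigid_mul hz.1 hz.2.1 (h.left.div_mem h2 hz1) with h3 | h3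
    · left; rw [e]; exact h.left.mul_mem hz1 h3
    · right; rw [e, mul_div_assoc]; exact h.left.mul_mem hz1 h3
  have h4 : 1 - x * w * z ∈ T ∨ (1 - x * w * z) / (x * w * z) ∈ T := by
    have := h.rigid_mul hn0 hnH h.neg_one_mem
    simpa [sub_eq_add_neg] using this
  have h5 : 1 - x * w * z ∈ T := by
    rcases h3 with h3 | h3
    · exact h3
    rcases h4 with h4 | h4
    · exact h4
    have hne : 1 - x * w * z ≠ 0 := fun h0 => h.left.ne_zero h3 (by rw [h0, zero_div])
    have := h.div_mem_of_div_mem hne h3 h4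
    rw [mul_div_assoc, div_self hz.1, mul_one, mul_comm] at this
    exact absurd this h1'
  have h6 : -(x * w * z) ∈ P := by
    refine ⟨neg_ne_zero.2 hn0, by rwa [h.neg_mem_right_iff], ?_⟩
    rwa [← sub_eq_add_neg]
  have h7 := hg2 _ (h.neg_mem _ h6)
  rwa [neg_neg, e0, inv_mul_cancel_left₀ hg0] at h7

theorem mul_mem_multipliers {x y : L} (hx : x ∈ P) (hy : y ∈ P) (hxy : x * y ∈ H) :
    x * y ∈ Opl :=
  ⟨hxy, fun z hz => h.mul_mul_mem_of_notMem hx hy hz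
    (by rw [h.right.mul_mem_iff_left hxy]; exact hz.2.1)⟩

theorem one_add_mem_multipliers {x : L} (hx : x ∈ P) : 1 + x ∈ Opl := by
  refine ⟨h.le hx.2.2, fun y₀ hy₀ => ?_⟩
  obtain ⟨g, hg, hg1, hg2, h1, -⟩ := h.exists_scale x hx y₀ hy₀
  have hg0 := h.right.ne_zero hg
  have hy := hg1 y₀ hy₀
  suffices h7 : (1 + x) * (g * y₀) ∈ P by
    have h8 := hg2 _ h7
    convert h8 using 1
    field_simp
  set y := g * y₀
  have hx1 := hx.2.2
  have hy1 := hy.2.2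
  have hx10 := h.left.ne_zero hx1
  have hy10 := h.left.ne_zero hy1
  refine ⟨mul_ne_zero hx10 hy.1,
    by rw [h.right.mul_mem_iff_left (h.le hx1)]; exact hy.2.1, ?_⟩
  have hmul := h.left.mul_mem hx1 hy1
  have e : 1 + (1 + x) * y = (1 + x) * (1 + y) * (1 + -(((1 + x) * (1 + y))⁻¹) * x) := by
    field_simp; ring
  have h3 : 1 + (1 + x) * y ∈ T ∨ (1 + (1 + x) * y) / x ∈ T := by
    rcases h.rigid_mul hx.1 hx.2.1 (h.neg_mem_left_iff.2 (h.left.inv_mem hmul)) with h3 | h3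
    · left; rw [e]; exact h.left.mul_mem hmul h3
    · right; rw [e, mul_div_assoc]; exact h.left.mul_mem hmul h3
  rcases h3 with h3 | h3
  · exact h3
  rcases h.rigid_mul hy.1 hy.2.1 hx1 with h4 | h4
  · exact h4
  have hne : 1 + (1 + x) * y ≠ 0 := fun h0 => h.left.ne_zero h3 (by rw [h0, zero_div])
  exact absurd (h.div_mem_of_div_mem hne h3 h4) h1

theorem inv_one_add_mem_multipliers {y : L} (hy : y ∈ P) : (1 + y)⁻¹ ∈ Opl := by
  have hy1 := hy.2.2
  have hy10 := h.left.ne_zero hy1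
  have hw : -((1 + y)⁻¹ * y) ∈ P := by
    refine ⟨neg_ne_zero.2 (mul_ne_zero (inv_ne_zero hy10) hy.1), ?_, ?_⟩
    · rw [h.neg_mem_right_iff, h.right.mul_mem_iff_left (h.le (h.left.inv_mem hy1))]
      exact hy.2.1
    · have : 1 + -((1 + y)⁻¹ * y) = (1 + y)⁻¹ := by field_simp; ring
      rw [this]; exact h.left.inv_mem hy1
  have := h.one_add_mem_multipliers hw
  have e : 1 + -((1 + y)⁻¹ * y) = (1 + y)⁻¹ := by field_simp; ring
  rwa [e] at this

theorem one_add_mem {x : L} (hx : x ∈ Opl) (hx1 : 1 + x ≠ 0) : 1 + x ∈ P ∨ 1 + x ∈ Opl := by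
  by_cases hH : 1 + x ∈ H
  · right
    refine ⟨hH, fun y hy => ?_⟩
    by_contra hcon
    have hnH : (1 + x) * y ∉ H := by rw [h.right.mul_mem_iff_left hH]; exact hy.2.1
    have hz := (h.mem_or_inv_mem (mul_ne_zero hx1 hy.1) hnH).resolve_left hcon
    have hxy := hx.2 y hy
    have h5 := ((h.inv_one_add_mem_multipliers hy).2 _ hxy).2.2
    have hy10 := h.left.ne_zero hy.2.2
    refine hcon ⟨mul_ne_zero hx1 hy.1, hnH, ?_⟩
    have e : 1 + (1 + x) * y = (1 + y) * (1 + (1 + y)⁻¹ * (x * y)) := by field_simp; ring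
    rw [e]; exact h.left.mul_mem hy.2.2 h5
  · left
    by_contra hcon
    have hy := (h.mem_or_inv_mem hx1 hH).resolve_left hcon
    have h1 := h.one_add_mem_multipliers (h.neg_mem _ hy)
    have h2 := hx.2 _ hy
    have e : 1 + -(1 + x)⁻¹ = x * (1 + x)⁻¹ := by field_simp; ring
    rw [e] at h1
    exact h2.2.1 h1.1

theorem inv_mem_multipliers {x : L} (hx : x ∈ H) (hx' : x ∉ Opl) : x⁻¹ ∈ Opl := by
  have : ∃ a ∈ P, x * a ∉ P := by
    by_contra hcon
    push Not at hcon
    exact hx' ⟨hx, hcon⟩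
  obtain ⟨a, ha, hxa⟩ := this
  have hx0 := h.right.ne_zero hx
  have hnH : x * a ∉ H := by rw [h.right.mul_mem_iff_left hx]; exact ha.2.1
  have hz := (h.mem_or_inv_mem (mul_ne_zero hx0 ha.1) hnH).resolve_left hxa
  have e : (x * a)⁻¹ * a = x⁻¹ := by have := ha.1; field_simp
  have := h.mul_mem_multipliers hz ha (by rw [e]; exact h.right.inv_mem hx)
  rwa [e] at this

theorem one_mem_multipliers : (1 : L) ∈ Opl :=
  ⟨h.right.one_mem, fun y hy => by rwa [one_mul]⟩

theorem mul_mem_aux {x y : L} (hx : x ∈ P ∨ x ∈ Opl) (hy : y ∈ P ∨ y ∈ Opl) :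
    x * y ∈ P ∨ x * y ∈ Opl := by
  rcases hx with hx | hx <;> rcases hy with hy | hy
  · by_cases hxy : x * y ∈ H
    · exact Or.inr (h.mul_mem_multipliers hx hy hxy)
    · exact Or.inl (h.mul_mem_of_notMem hx hy hxy)
  · rw [mul_comm]; exact Or.inl (hy.2 _ hx)
  · exact Or.inl (hx.2 _ hy)
  · exact Or.inr ⟨h.right.mul_mem hx.1 hy.1, fun z hz => by
      rw [mul_assoc]; exact hx.2 _ (hy.2 _ hz)⟩

theorem neg_mem_aux {x : L} (hx : x ∈ P ∨ x ∈ Opl) : -x ∈ P ∨ -x ∈ Opl := by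
  rcases hx with hx | hx
  · exact Or.inl (h.neg_mem _ hx)
  · exact Or.inr ⟨h.neg_mem_right_iff.2 hx.1, fun z hz => by
      rw [neg_mul, ← mul_neg]; exact hx.2 _ (h.neg_mem _ hz)⟩

theorem total_aux {x : L} (hx : x ≠ 0) :
    (x ∈ P ∨ x ∈ Opl) ∨ (x⁻¹ ∈ P ∨ x⁻¹ ∈ Opl) := by
  by_cases hH : x ∈ H
  · by_cases h1 : x ∈ Opl
    · exact Or.inl (Or.inr h1)
    · exact Or.inr (Or.inr (h.inv_mem_multipliers hH h1))
  · rcases h.mem_or_inv_mem hx hH with h1 | h1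
    · exact Or.inl (Or.inl h1)
    · exact Or.inr (Or.inl h1)

theorem ne_zero_aux {x : L} (hx : x ∈ P ∨ x ∈ Opl) : x ≠ 0 := by
  rcases hx with hx | hx
  · exact hx.1
  · exact h.right.ne_zero hx.1

theorem add_mem_aux {x y : L} (hx : x ∈ P ∨ x ∈ Opl) (hy : y ∈ P ∨ y ∈ Opl)
    (hxy : x + y ≠ 0) : x + y ∈ P ∨ x + y ∈ Opl := by
  have key : ∀ {x y : L}, (x ∈ P ∨ x ∈ Opl) → y ≠ 0 → (y / x ∈ P ∨ y / x ∈ Opl) → x + y ≠ 0 →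
      (x + y ∈ P ∨ x + y ∈ Opl) := by
    intro x y hx hy0 hyx hxy
    have hx0 := h.ne_zero_aux hx
    have e : x + y = x * (1 + y / x) := by field_simp
    rw [e] at hxy ⊢
    refine h.mul_mem_aux hx ?_
    rcases hyx with h1 | h1
    · exact Or.inr (h.one_add_mem_multipliers h1)
    · exact h.one_add_mem h1 (right_ne_zero_of_mul hxy)
  have hx0 := h.ne_zero_aux hx
  have hy0 := h.ne_zero_aux hy
  rcases h.total_aux (div_ne_zero hy0 hx0) with h1 | h1
  · exact key hx hy0 h1 hxy
  · rw [inv_div] at h1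
    rw [add_comm] at hxy ⊢
    exact key hy hx0 h1 hxy

/-- The valuation ring attached to a rigid pair. -/
def valuationSubring : ValuationSubring L where
  carrier := {x | x = 0 ∨ x ∈ P ∨ x ∈ Opl}
  mul_mem' := by
    rintro a b (rfl | ha) (rfl | hb)
    · simp
    · simp
    · simp
    · exact Or.inr (h.mul_mem_aux ha hb)
  one_mem' := Or.inr (Or.inr h.one_mem_multipliers)
  add_mem' := by
    rintro a b (rfl | ha) (rfl | hb)
    · simp
    · exact Or.inr (by rwa [zero_add])
    · exact Or.inr (by rwa [add_zero])
    · by_cases h0 : a + b = 0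
      · exact Or.inl h0
      · exact Or.inr (h.add_mem_aux ha hb h0)
  zero_mem' := Or.inl rfl
  neg_mem' := by
    rintro a (rfl | ha)
    · simp
    · exact Or.inr (h.neg_mem_aux ha)
  mem_or_inv_mem' := by
    intro x
    rcases eq_or_ne x 0 with rfl | hx
    · exact Or.inl (Or.inl rfl)
    · rcases h.total_aux hx with h1 | h1
      · exact Or.inl (Or.inr h1)
      · exact Or.inr (Or.inr h1)

theorem mem_valuationSubring_iff {x : L} :
    x ∈ h.valuationSubring ↔ x = 0 ∨ x ∈ P ∨ x ∈ Opl := Iff.rfl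

theorem inv_notMem_valuationSubring {x : L} (hx : x ∈ P) : x⁻¹ ∉ h.valuationSubring := by
  rintro (h1 | h1 | h1)
  · exact hx.1 (inv_eq_zero.1 h1)
  · exact h.inv_notMem hx h1
  · exact hx.2.1 (h.right.inv_mem_iff.1 h1.1)

end IsRigidPair

/-! ### The spectral valuation -/

/-- The properties of the unique extension to `A` of the `p`-adic norm used below. -/
structure IsLocalNorm (p : ℕ) (k A : Type*) [Field k] [Field A] [Algebra k A]
    (v : Valuation A ℝ≥0) : Prop where
  map_equiv : ∀ (g : A ≃ₐ[k] A) (x : A), v (g x) = v x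
  map_prime_lt_one : v (p : A) < 1
  map_prime_pos : 0 < v (p : A)
  exists_finite_net : ∀ E : IntermediateField k A, FiniteDimensional k E →
    ∃ S : Set A, S.Finite ∧ S ⊆ E ∧ ∀ x ∈ E, v x ≤ 1 → ∃ s ∈ S, v (x - s) < v (p : A)
  exists_limit : ∀ (c : ℝ≥0) (a : ℕ → k), c < 1 →
    (∀ n, v (algebraMap k A (a (n + 1) - a n)) ≤ c ^ n) →
    ∃ b : k, ∀ n, v (algebraMap k A (b - a n)) ≤ c ^ n

section spectral

variable (p : ℕ) [Fact p.Prime] (A : Type*) [Field A] [Algebra ℚ_[p] A]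
  [Algebra.IsAlgebraic ℚ_[p] A]

/-- The spectral norm of an algebraic extension of `ℚ_p`, as a valuation. -/
noncomputable def spectralValuation : Valuation A ℝ≥0 where
  toFun x := ⟨spectralNorm ℚ_[p] A x, spectralNorm_nonneg x⟩
  map_zero' := NNReal.eq (spectralNorm_zero (K := ℚ_[p]) (L := A))
  map_one' := NNReal.eq (spectralNorm_one (K := ℚ_[p]) (L := A))
  map_mul' x y := NNReal.eq (spectralAlgNorm_mul (K := ℚ_[p]) x y)
  map_add_le_max' x y := by
    have := @isNonarchimedean_spectralNorm ℚ_[p] _ A _ _ _ _ x y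
    exact_mod_cast this

theorem coe_spectralValuation (x : A) :
    (spectralValuation p A x : ℝ) = spectralNorm ℚ_[p] A x := rfl

variable {A} in
theorem spectralValuation_algebraMap {E : Type*} [Field E] [Algebra ℚ_[p] E] [Algebra E A]
    [IsScalarTower ℚ_[p] E A] [Algebra.IsAlgebraic ℚ_[p] E] (x : E) :
    spectralValuation p A (algebraMap E A x) = spectralValuation p E x := by
  apply NNReal.eq
  rw [coe_spectralValuation, coe_spectralValuation, spectralNorm, spectralNorm,
    minpoly.algebraMap_eq (algebraMap E A).injective]

theorem exists_finite_net_of_finiteDimensional [FiniteDimensional ℚ_[p] A] (c : ℝ≥0)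
    (hc : 0 < c) :
    ∃ S : Set A, S.Finite ∧ ∀ x, spectralValuation p A x ≤ 1 →
      ∃ s ∈ S, spectralValuation p A (x - s) < c := by
  let _ := spectralNorm.normedField ℚ_[p] A
  let _ := spectralNorm.normedSpace ℚ_[p] A
  have : ProperSpace A := FiniteDimensional.proper ℚ_[p] A
  obtain ⟨S, -, hS, hcov⟩ := (isCompact_closedBall (0 : A) 1).finite_cover_balls
    (show (0 : ℝ) < c by exact_mod_cast hc)
  refine ⟨S, hS, fun x hx => ?_⟩
  have : x ∈ Metric.closedBall (0 : A) 1 := by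
    rw [mem_closedBall_zero_iff]; exact_mod_cast hx
  obtain ⟨s, hs, hxs⟩ := Set.mem_iUnion₂.1 (hcov this)
  refine ⟨s, hs, ?_⟩
  rw [Metric.mem_ball, dist_eq_norm] at hxs
  exact_mod_cast hxs

theorem exists_limit_of_finiteDimensional [FiniteDimensional ℚ_[p] A] (c : ℝ≥0) (hc : c < 1)
    (a : ℕ → A) (ha : ∀ n, spectralValuation p A (a (n + 1) - a n) ≤ c ^ n) :
    ∃ b : A, ∀ n, spectralValuation p A (b - a n) ≤ c ^ n := by
  let _ := spectralNorm.normedField ℚ_[p] A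
  let _ := spectralNorm.normedSpace ℚ_[p] A
  have : CompleteSpace A := FiniteDimensional.complete ℚ_[p] A
  have hnorm : ∀ x : A, ‖x‖ = spectralValuation p A x := fun x => rfl
  have hcau : CauchySeq a := by
    refine cauchySeq_of_le_geometric (c : ℝ) 1 (by exact_mod_cast hc) fun n => ?_
    rw [dist_comm, dist_eq_norm, hnorm, one_mul]
    exact_mod_cast ha n
  obtain ⟨b, hb⟩ := cauchySeq_tendsto_of_complete hcau
  have hmono : ∀ n m, n ≤ m → spectralValuation p A (a m - a n) ≤ c ^ n := by
    intro n m hnm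
    induction m, hnm using Nat.le_induction with
    | base => simp
    | succ m hm ih =>
      have e : a (m + 1) - a n = (a (m + 1) - a m) + (a m - a n) := by ring
      rw [e]
      refine (Valuation.map_add _ _ _).trans (max_le ((ha m).trans ?_) ih)
      exact pow_le_pow_of_le_one (by positivity) hc.le hm
  refine ⟨b, fun n => ?_⟩
  have h1 : Filter.Tendsto (fun m => ‖a m - a n‖) Filter.atTop (nhds ‖b - a n‖) :=
    (hb.sub_const _).norm
  have h2 : ‖b - a n‖ ≤ ((c ^ n : ℝ≥0) : ℝ) := by
    refine le_of_tendsto h1 (Filter.eventually_atTop.2 ⟨n, fun m hm => ?_⟩)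
    rw [hnorm]; exact_mod_cast hmono n m hm
  rw [hnorm] at h2
  exact_mod_cast h2

end spectral

theorem isLocalNorm_spectralValuation (p : ℕ) [Fact p.Prime] (k A : Type*) [Field k]
    [Algebra ℚ_[p] k] [FiniteDimensional ℚ_[p] k] [Field A] [Algebra k A] [Algebra ℚ_[p] A]
    [IsScalarTower ℚ_[p] k A] [Algebra.IsAlgebraic k A] [Algebra.IsAlgebraic ℚ_[p] A] :
    IsLocalNorm p k A (spectralValuation p A) where
  map_equiv g x := by
    apply NNReal.eq
    rw [coe_spectralValuation, coe_spectralValuation]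
    exact (spectralNorm_eq_of_equiv (g.restrictScalars ℚ_[p]) x).symm
  map_prime_lt_one := by
    have h := spectralNorm_extends (K := ℚ_[p]) (L := A) p
    rw [map_natCast] at h
    rw [← NNReal.coe_lt_coe, coe_spectralValuation, h]
    exact Padic.norm_p_lt_one
  map_prime_pos := by
    have h := spectralNorm_extends (K := ℚ_[p]) (L := A) p
    rw [map_natCast] at h
    rw [← NNReal.coe_lt_coe, coe_spectralValuation, h, Padic.norm_p]
    have := (Fact.out : p.Prime).pos
    simp only [NNReal.coe_zero]
    positivity
  exists_finite_net E hE := by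
    have : FiniteDimensional ℚ_[p] E := FiniteDimensional.trans ℚ_[p] k E
    have hp : 0 < spectralValuation p A (p : A) := by
      rw [Valuation.pos_iff]
      have : CharZero A := charZero_of_injective_algebraMap (algebraMap ℚ_[p] A).injective
      exact_mod_cast (Fact.out : p.Prime).ne_zero
    obtain ⟨S, hS, h⟩ := exists_finite_net_of_finiteDimensional p E _ hp
    refine ⟨(fun x : E => (x : A)) '' S, hS.image _, ?_, fun x hx hx1 => ?_⟩
    · rintro _ ⟨x, -, rfl⟩; exact x.2
    have : IsScalarTower ℚ_[p] E A := IsScalarTower.of_algebraMap_eq fun _ => rfl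
    have key : ∀ y : E, spectralValuation p A (y : A) = spectralValuation p E y :=
      fun y => spectralValuation_algebraMap p y
    obtain ⟨s, hs, h2⟩ := h ⟨x, hx⟩ (by rw [← key]; exact hx1)
    refine ⟨s, ⟨s, hs, rfl⟩, ?_⟩
    rw [← key] at h2
    exact h2
  exists_limit c a hc h := by
    have key : ∀ y : k, spectralValuation p A (algebraMap k A y) = spectralValuation p k y :=
      fun y => spectralValuation_algebraMap p y
    simp only [key] at h ⊢
    exact exists_limit_of_finiteDimensional p k c hc a h

/-! ### Fixed fields, Hensel's lemma for powers and Kummer theory -/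

/-- The subfield of elements fixed by a subgroup `W`. -/
def fixedSubfield {G : Type*} [Group G] (M : Type*) [Field M] [MulSemiringAction G M]
    (W : Subgroup G) : Subfield M where
  carrier := {x | ∀ g ∈ W, g • x = x}
  mul_mem' ha hb g hg := by rw [smul_mul', ha g hg, hb g hg]
  one_mem' g _ := smul_one g
  add_mem' ha hb g hg := by rw [smul_add, ha g hg, hb g hg]
  zero_mem' g _ := smul_zero g
  neg_mem' ha g hg := by rw [smul_neg, ha g hg]
  inv_mem' x hx g hg := by rw [smul_inv'', hx g hg]

theorem mem_fixedSubfield_iff {G : Type*} [Group G] {M : Type*} [Field M]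
    [MulSemiringAction G M] {W : Subgroup G} {x : M} :
    x ∈ fixedSubfield M W ↔ ∀ g ∈ W, g • x = x := Iff.rfl

section hensel

variable {M : Type*} [Field M] {Γ : Type*} [LinearOrderedCommGroupWithZero Γ]
  (V : Valuation M Γ)

theorem map_eq_one_of_sub_one_lt {x : M} (h : V (x - 1) < 1) : V x = 1 := by
  have := V.map_add_eq_of_lt_right (x := x - 1) (y := 1) (by rwa [V.map_one])
  rwa [sub_add_cancel, V.map_one] at this

theorem exists_mem_map_lt_one_of_prod {s : Multiset M} (h : V s.prod < 1) :
    ∃ x ∈ s, V x < 1 := by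
  by_contra! hcon
  have : 1 ≤ V s.prod := by
    rw [map_multiset_prod]
    induction s using Multiset.induction with
    | empty => simp
    | cons a s ih =>
      rw [Multiset.map_cons, Multiset.prod_cons]
      refine one_le_mul (hcon a (Multiset.mem_cons_self a s)) ?_
      by_cases hs : V s.prod < 1
      · exact ih hs fun x hx => hcon x (Multiset.mem_cons_of_mem hx)
      · rw [map_multiset_prod] at hs; exact not_lt.1 hs
  exact absurd h (not_lt.2 this)

/-- A polynomial over an algebraically closed field whose value at `x` is smaller than its leading
coefficient has a root congruent to `x`. -/
theorem exists_root_sub_lt [IsAlgClosed M] {f : Polynomial M} (hf : f.Monic) {x : M}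
    (h : V (f.eval x) < 1) : ∃ r, f.eval r = 0 ∧ V (x - r) < 1 := by
  have hs := IsAlgClosed.splits f
  have e : f.eval x = (f.roots.map fun a => x - a).prod := by
    conv_lhs => rw [hs.eq_prod_roots_of_monic hf]
    simp [Polynomial.eval_multiset_prod, Multiset.map_map]
  rw [e] at h
  obtain ⟨y, hy, hy1⟩ := exists_mem_map_lt_one_of_prod V h
  obtain ⟨r, hr, rfl⟩ := Multiset.mem_map.1 hy
  exact ⟨r, (Polynomial.mem_roots'.1 hr).2, hy1⟩

theorem eq_one_of_pow_eq_one {ℓ : ℕ} (hℓ : V (ℓ : M) = 1) {z : M} (hz : z ^ ℓ = 1)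
    (h : V (z - 1) < 1) : z = 1 := by
  by_contra hne
  have h0 : ∑ i ∈ Finset.range ℓ, z ^ i = 0 := by
    have := geom_sum_mul z ℓ
    rw [hz, sub_self] at this
    exact (mul_eq_zero.1 this).resolve_right (sub_ne_zero.2 hne)
  have hz1 := map_eq_one_of_sub_one_lt V h
  have h1 : V (∑ i ∈ Finset.range ℓ, (z ^ i - 1)) < 1 := by
    refine V.map_sum_lt one_ne_zero fun i _ => ?_
    have := (mul_geom_sum z i)
    rw [← this, map_mul]
    refine mul_lt_one_of_lt_of_le h (V.map_sum_le fun j _ => ?_)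
    rw [map_pow, hz1, one_pow]
  rw [Finset.sum_sub_distrib, h0, zero_sub, Valuation.map_neg, Finset.sum_const, Finset.card_range,
    nsmul_eq_mul, mul_one, hℓ] at h1
  exact lt_irrefl _ h1

theorem exists_fixed_pow_eq [IsAlgClosed M] {G : Type*} [Group G] [MulSemiringAction G M]
    (W : Subgroup G) (hW : ∀ g ∈ W, ∀ x : M, V x < 1 → V (g • x) < 1) {ℓ : ℕ}
    (hℓ : V (ℓ : M) = 1) {x : M} (hx : x ∈ fixedSubfield M W) (h1 : V (x - 1) < 1) :
    ∃ y ∈ fixedSubfield M W, y ^ ℓ = x ∧ V (y - 1) < 1 := by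
  have hℓ0 : ℓ ≠ 0 := by rintro rfl; simp at hℓ
  have hmonic : (Polynomial.X ^ ℓ - Polynomial.C x).Monic := Polynomial.monic_X_pow_sub_C x hℓ0
  obtain ⟨y, hy, hy1⟩ := exists_root_sub_lt V hmonic (x := 1)
    (by simpa [V.map_sub_swap 1 x] using h1)
  have hyx : y ^ ℓ = x := by simpa [sub_eq_zero] using hy
  rw [V.map_sub_swap] at hy1
  have hVy := map_eq_one_of_sub_one_lt V hy1
  have hy0 : y ≠ 0 := by rintro rfl; simp at hVy
  refine ⟨y, fun g hg => ?_, hyx, hy1⟩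
  have h2 : V (g • y - 1) < 1 := by
    have := hW g hg _ hy1
    rwa [smul_sub, smul_one] at this
  have h3 : (g • y / y) ^ ℓ = 1 := by
    rw [div_pow, ← smul_pow', hyx, hx g hg, div_self]
    rw [← hyx]; exact pow_ne_zero _ hy0
  have h4 : V (g • y / y - 1) < 1 := by
    have e : g • y / y - 1 = ((g • y - 1) - (y - 1)) / y := by field_simp; ring
    rw [e, map_div₀, hVy, div_one]
    exact V.map_sub_lt h2 hy1
  have := eq_one_of_pow_eq_one V hℓ h3 h4
  rwa [div_eq_one_iff_eq hy0] at this

end hensel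

/-- A semilinear action of `Gal(A/k)` on an extension `M` of `A` with open stabilizers. -/
structure IsSmoothAction (k A M : Type*) [Field k] [Field A] [Field M] [Algebra k A]
    [Algebra A M] [MulSemiringAction (A ≃ₐ[k] A) M] : Prop where
  smul_algebraMap : ∀ (g : A ≃ₐ[k] A) (a : A), g • algebraMap A M a = algebraMap A M (g a)
  exists_fixing : ∀ x : M, ∃ E : IntermediateField k A, FiniteDimensional k E ∧
    ∀ g ∈ E.fixingSubgroup, g • x = x

namespace IsSmoothAction

variable {k A M : Type*} [Field k] [Field A] [Field M] [Algebra k A]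
    [Algebra A M] [MulSemiringAction (A ≃ₐ[k] A) M] (hM : IsSmoothAction k A M)
include hM

theorem algebraMap_mem_iff {W : Subgroup (A ≃ₐ[k] A)} {a : A} :
    algebraMap A M a ∈ fixedSubfield M W ↔ a ∈ fixedSubfield A W := by
  simp only [mem_fixedSubfield_iff, hM.smul_algebraMap, (algebraMap A M).injective.eq_iff]
  rfl

/-- Hilbert 90: a line stable under `W` contains a nonzero fixed vector. -/
theorem exists_mul_mem_fixedSubfield (W : Subgroup (A ≃ₐ[k] A)) {y : M} (hy : y ≠ 0)
    (h : ∀ g ∈ W, ∃ c : A, g • y = algebraMap A M c * y) :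
    ∃ d : A, d ≠ 0 ∧ algebraMap A M d * y ∈ fixedSubfield M W := by
  obtain ⟨F, hF, hFy⟩ := hM.exists_fixing y
  let Q := W ⧸ (F.fixingSubgroup.subgroupOf W)
  let r : Q → (F →ₐ[k] A) := fun q => ((q.out : A ≃ₐ[k] A) : A →ₐ[k] A).comp F.val
  have hr : Function.Injective r := by
    intro q q' hqq
    rw [← Quotient.out_eq' q, ← Quotient.out_eq' q', QuotientGroup.eq, Subgroup.mem_subgroupOf,
      IntermediateField.mem_fixingSubgroup_iff]
    intro x hx
    have h1 : (q.out : A ≃ₐ[k] A) x = (q'.out : A ≃ₐ[k] A) x := DFunLike.congr_fun hqq ⟨x, hx⟩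
    simp only [Subgroup.coe_mul, Subgroup.coe_inv, AlgEquiv.mul_apply]
    rw [← h1]
    exact AlgEquiv.symm_apply_apply _ _
  have : Finite Q := Finite.of_injective r hr
  have := Fintype.ofFinite Q
  let f : Q → (F →* M) := fun q => ((algebraMap A M).comp (r q : F →+* A) : F →* M)
  have hf : Function.Injective f := by
    intro q q' hqq
    apply hr
    ext x
    exact (algebraMap A M).injective (DFunLike.congr_fun hqq x)
  have hli := (linearIndependent_monoidHom F M).comp f hf
  have hne : ∃ a : F, ∑ q : Q, (q.out : A ≃ₐ[k] A) • y * f q a ≠ 0 := by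
    by_contra! hcon
    rw [Fintype.linearIndependent_iff] at hli
    have := hli (fun q => (q.out : A ≃ₐ[k] A) • y) (by
      ext a
      simpa [Finset.sum_apply] using hcon a) (QuotientGroup.mk 1)
    rw [smul_eq_zero_iff_eq] at this
    exact hy this
  obtain ⟨a, ha⟩ := hne
  set z : M := algebraMap A M a * y with hz
  have hzF : ∀ g ∈ F.fixingSubgroup, g • z = z := by
    intro g hg
    rw [hz, smul_mul', hM.smul_algebraMap, hFy g hg,
      (IntermediateField.mem_fixingSubgroup_iff F g).1 hg a a.2]
  have hz1 : ∀ q : Q, (q.out : A ≃ₐ[k] A) • y * f q a = (q.out : A ≃ₐ[k] A) • z := by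
    intro q
    rw [hz, smul_mul', hM.smul_algebraMap, mul_comm]
    rfl
  simp only [hz1] at ha
  have hout : ∀ w : W, ((QuotientGroup.mk w : Q).out : A ≃ₐ[k] A) • z = (w : A ≃ₐ[k] A) • z := by
    intro w
    obtain ⟨n, hn⟩ := QuotientGroup.mk_out_eq_mul (F.fixingSubgroup.subgroupOf W) w
    rw [hn, Subgroup.coe_mul, mul_smul, hzF _ (Subgroup.mem_subgroupOf.1 n.2)]
  choose! c hc using h
  refine ⟨∑ q : Q, (q.out : A ≃ₐ[k] A) a * c q.out, ?_, ?_⟩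
  · rintro h0
    apply ha
    have e : ∑ q : Q, (q.out : A ≃ₐ[k] A) • z =
        algebraMap A M (∑ q : Q, (q.out : A ≃ₐ[k] A) a * c q.out) * y := by
      rw [map_sum, Finset.sum_mul]
      refine Finset.sum_congr rfl fun q _ => ?_
      rw [hz, smul_mul', hM.smul_algebraMap, hc _ q.out.2, map_mul, mul_assoc]
    rw [e, h0, map_zero, zero_mul]
  · have e : algebraMap A M (∑ q : Q, (q.out : A ≃ₐ[k] A) a * c q.out) * y =
        ∑ q : Q, (q.out : A ≃ₐ[k] A) • z := by
      rw [map_sum, Finset.sum_mul]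
      refine Finset.sum_congr rfl fun q _ => ?_
      rw [hz, smul_mul', hM.smul_algebraMap, hc _ q.out.2, map_mul, mul_assoc]
    rw [e]
    intro g hg
    rw [Finset.smul_sum]
    refine Fintype.sum_equiv (MulAction.toPerm (⟨g, hg⟩ : W)) _ _ fun q => ?_
    have := hout (⟨g, hg⟩ * q.out)
    have e2 : (MulAction.toPerm (⟨g, hg⟩ : W) q : Q) =
        QuotientGroup.mk ((⟨g, hg⟩ : W) * q.out) := by
      conv_lhs => rw [← Quotient.out_eq' q]
      rfl
    rw [← mul_smul, e2, this]
    rfl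

theorem exists_eq_mul_pow [IsAlgClosed A] [IsAlgClosed M] (W : Subgroup (A ≃ₐ[k] A)) {n : ℕ}
    (hn : n ≠ 0) {x : M} (hx : x ∈ fixedSubfield M W) (hx0 : x ≠ 0) :
    ∃ b ∈ fixedSubfield A W, b ≠ 0 ∧ ∃ t ∈ fixedSubfield M W, t ≠ 0 ∧
      x = algebraMap A M b * t ^ n := by
  obtain ⟨y, hy⟩ := IsAlgClosed.exists_pow_nat_eq x (Nat.pos_of_ne_zero hn)
  have hy0 : y ≠ 0 := by rintro rfl; exact hx0 (by rw [← hy, zero_pow hn])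
  have hroot : ∀ g ∈ W, ∃ c : A, g • y = algebraMap A M c * y := by
    intro g hg
    have h1 : (g • y / y) ^ n = 1 := by
      rw [div_pow, ← smul_pow', hy, hx g hg, div_self hx0]
    have hsp : (Polynomial.X ^ n - Polynomial.C (1 : A)).Splits := IsAlgClosed.splits _
    obtain ⟨c, hc⟩ := hsp.mem_range_of_isRoot (i := algebraMap A M)
      (Polynomial.X_pow_sub_C_ne_zero (Nat.pos_of_ne_zero hn) 1) (x := g • y / y)
      (by simp [h1])
    exact ⟨c, by rw [hc, div_mul_cancel₀ _ hy0]⟩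
  obtain ⟨d, hd0, hd⟩ := hM.exists_mul_mem_fixedSubfield W hy0 hroot
  have hd0' : algebraMap A M d ≠ 0 := by simpa using hd0
  have e : x = algebraMap A M ((d ^ n)⁻¹) * (algebraMap A M d * y) ^ n := by
    rw [map_inv₀, map_pow, mul_pow, hy, inv_mul_cancel_left₀ (pow_ne_zero _ hd0')]
  have ht0 : algebraMap A M d * y ≠ 0 := mul_ne_zero hd0' hy0
  refine ⟨(d ^ n)⁻¹, ?_, inv_ne_zero (pow_ne_zero _ hd0), _, hd, ht0, e⟩
  rw [← hM.algebraMap_mem_iff]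
  have : algebraMap A M ((d ^ n)⁻¹) = x / (algebraMap A M d * y) ^ n := by
    rw [eq_div_iff (pow_ne_zero _ ht0), ← e]
  rw [this]
  exact div_mem hx (pow_mem hd n)

end IsSmoothAction

/-- `W'` is normal in `W` with finite cyclic quotient generated by `g`, of order dividing `n`. -/
structure IsCyclicStep {G : Type*} [Group G] (W W' : Subgroup G) (g : G) (n : ℕ) : Prop where
  le : W' ≤ W
  mem : g ∈ W
  pow_mem : g ^ n ∈ W'
  conj_mem : ∀ h ∈ W', g⁻¹ * h * g ∈ W'
  exists_pow : ∀ h ∈ W, ∃ j : ℕ, (g ^ j)⁻¹ * h ∈ W'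

namespace IsCyclicStep

variable {G : Type*} [Group G] {W W' : Subgroup G} {g : G} {n : ℕ}
  (h : IsCyclicStep W W' g n) {M : Type*} [Field M] [MulSemiringAction G M]
include h

theorem smul_mem {y : M} (hy : y ∈ fixedSubfield M W') : g • y ∈ fixedSubfield M W' := by
  intro w hw
  have := hy _ (h.conj_mem w hw)
  rw [mul_smul, mul_smul, inv_smul_eq_iff] at this
  exact this

theorem pow_smul_mem {y : M} (hy : y ∈ fixedSubfield M W') (j : ℕ) :
    g ^ j • y ∈ fixedSubfield M W' := by
  induction j with
  | zero => simpa using hy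
  | succ j ih => rw [pow_succ', mul_smul]; exact h.smul_mem ih

theorem mem_of_smul_eq {y : M} (hy : y ∈ fixedSubfield M W') (hg : g • y = y) :
    y ∈ fixedSubfield M W := by
  have hj : ∀ j : ℕ, g ^ j • y = y := by
    intro j
    induction j with
    | zero => simp
    | succ j ih => rw [pow_succ', mul_smul, ih, hg]
  intro w hw
  obtain ⟨j, hj'⟩ := h.exists_pow w hw
  have := hy _ hj'
  rwa [mul_smul, inv_smul_eq_iff, hj] at this

theorem prod_mem {y : M} (hy : y ∈ fixedSubfield M W') :
    ∏ j ∈ Finset.range n, g ^ j • y ∈ fixedSubfield M W := by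
  refine h.mem_of_smul_eq (_root_.prod_mem fun j _ => h.pow_smul_mem hy j) ?_
  rw [Finset.smul_prod']
  have h1 := Finset.prod_range_succ (fun j => g ^ j • y) n
  rw [Finset.prod_range_succ', pow_zero, one_smul, hy _ h.pow_mem] at h1
  rcases eq_or_ne y 0 with rfl | h0
  · rcases n with _ | n <;> simp
  · simp only [← mul_smul, ← pow_succ']
    exact mul_right_cancel₀ h0 h1

theorem sum_mem {y : M} (hy : y ∈ fixedSubfield M W') :
    ∑ j ∈ Finset.range n, g ^ j • y ∈ fixedSubfield M W := by
  refine h.mem_of_smul_eq (_root_.sum_mem fun j _ => h.pow_smul_mem hy j) ?_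
  rw [Finset.smul_sum]
  have h1 := Finset.sum_range_succ (fun j => g ^ j • y) n
  rw [Finset.sum_range_succ', pow_zero, one_smul, hy _ h.pow_mem] at h1
  simp only [← mul_smul, ← pow_succ']
  exact add_right_cancel h1

end IsCyclicStep

/-! ### Discreteness and finite residue fields -/

section finiteField

variable {F : Type*} [Field F] [Finite F]

theorem exists_generator_mod_powers {ℓ : ℕ} (hℓ : 0 < ℓ) {ζ : F} (hζ : ζ ^ ℓ = 1)
    (hζ1 : ζ ≠ 1) : ∃ u : F, u ≠ 0 ∧ (∀ y, y ^ ℓ ≠ u) ∧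
      ∀ x : F, x ≠ 0 → ∃ n < ℓ, ∃ y : F, x = u ^ n * y ^ ℓ := by
  obtain ⟨g, hg⟩ := IsCyclic.exists_generator (α := Fˣ)
  have hgen : ∀ x : Fˣ, ∃ n < ℓ, ∃ y : Fˣ, x = g ^ n * y ^ ℓ := by
    intro x
    obtain ⟨m, rfl⟩ := Subgroup.mem_zpowers_iff.1 (hg x)
    have h0 : (0 : ℤ) ≤ m % ℓ := Int.emod_nonneg _ (by exact_mod_cast hℓ.ne')
    have h1 : m % ℓ < ℓ := Int.emod_lt_of_pos _ (by exact_mod_cast hℓ)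
    obtain ⟨n, hn⟩ := Int.eq_ofNat_of_zero_le h0
    refine ⟨n, by rw [hn] at h1; exact_mod_cast h1, g ^ (m / ℓ), ?_⟩
    rw [← zpow_natCast g n, ← zpow_natCast (g ^ (m / (ℓ : ℤ))) ℓ, ← zpow_mul, ← zpow_add, ← hn,
      mul_comm, Int.emod_add_mul_ediv]
  refine ⟨g, g.ne_zero, fun y hy => hζ1 ?_, fun x hx => ?_⟩
  · have hsurj : Function.Surjective (fun x : Fˣ => x ^ ℓ) := by
      have hy0 : y ≠ 0 := by
        rintro rfl
        rw [zero_pow hℓ.ne'] at hy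
        exact g.ne_zero hy.symm
      intro x
      obtain ⟨n, -, z, hz⟩ := hgen x
      refine ⟨(Units.mk0 y hy0) ^ n * z, ?_⟩
      have : (Units.mk0 y hy0) ^ ℓ = g := Units.ext (by simpa using hy)
      simp only
      rw [mul_pow, ← pow_mul, mul_comm n, pow_mul, this, hz]
    have hinj := Finite.injective_iff_surjective.2 hsurj
    have hζ0 : ζ ≠ 0 := by rintro rfl; simp [zero_pow hℓ.ne'] at hζ
    have := @hinj (Units.mk0 ζ hζ0) 1 (Units.ext (by simpa using hζ))
    simpa using congrArg Units.val this
  · obtain ⟨n, hn, y, hy⟩ := hgen (Units.mk0 x hx)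
    exact ⟨n, hn, y, by simpa using congrArg Units.val hy⟩

theorem exists_mul_one_sub_cube {ζ : F} (hζ : ζ ^ 3 = 1) (hζ1 : ζ ≠ 1) :
    ∃ c d : F, c ≠ 0 ∧ (∀ y, y ^ 3 ≠ c) ∧ d ^ 3 = c * (1 - c) := by
  obtain ⟨u, hu0, hu, hgen⟩ := exists_generator_mod_powers (by norm_num) hζ hζ1
  by_contra! hcon
  let C : Set F := {x | x ≠ 0 ∧ ∃ y, y ^ 3 = x}
  have hnc : ∀ c : C, ∀ y, y ^ 3 ≠ u * c := by
    rintro ⟨c, hc0, z, rfl⟩ y hy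
    have hz : z ≠ 0 := by rintro rfl; exact hc0 (by simp)
    refine hu (y / z) ?_
    rw [div_pow, hy]; field_simp
  have hne1 : ∀ c : C, 1 - u * c ≠ 0 := fun c h0 => hnc c 1 (by linear_combination h0)
  have hne0 : ∀ c : C, u * c ≠ 0 := fun c => mul_ne_zero hu0 c.2.1
  have hcase : ∀ c : C, (∃ y, y ^ 3 = 1 - u * c) ∨ ∃ y, y ^ 3 = 1 - (u * c)⁻¹ := by
    intro c
    obtain ⟨z, hz⟩ := c.2.2
    have hz0 : z ≠ 0 := by rintro rfl; exact c.2.1 (by rw [← hz]; simp)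
    obtain ⟨n, hn, y, hy⟩ := hgen _ (hne1 c)
    interval_cases n
    · exact Or.inl ⟨y, by rw [hy]; ring⟩
    · refine Or.inr ⟨-y / z, ?_⟩
      have : 1 - (u * (c : F))⁻¹ = -(1 - u * c) / (u * c) := by
        have := hne0 c
        have := c.2.1
        field_simp; ring
      rw [this, hy, ← hz]
      field_simp
    · refine absurd ?_ (hcon (u * c) (u * z * y) (hne0 c) (hnc c))
      rw [hy, ← hz]; ring
  classical
  let φ : C → C := fun c => if h : ∃ y, y ^ 3 = 1 - u * c then ⟨1 - u * c, hne1 c, h⟩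
    else ⟨1 - (u * c)⁻¹, by
      intro h0
      apply hne1 c
      have := hne0 c
      have h2 : (u * (c : F))⁻¹ = 1 := by linear_combination -h0
      rw [inv_eq_one.1 h2, sub_self], (hcase c).resolve_left h⟩
  have hcross : ∀ c c' : C, 1 - u * (c : F) ≠ 1 - (u * c')⁻¹ := by
    intro c c' h
    obtain ⟨z, hz⟩ := c.2.2
    obtain ⟨z', hz'⟩ := c'.2.2
    have h1 : u * (c : F) * (u * c') = 1 := by
      have h2 : u * (c : F) = (u * c')⁻¹ := by linear_combination -h
      rw [h2, inv_mul_cancel₀ (hne0 c')]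
    apply hu (u * z * z')
    rw [← hz, ← hz'] at h1
    linear_combination u * h1
  have hinj : Function.Injective φ := by
    intro c c' h
    have hv := congrArg Subtype.val h
    apply Subtype.ext
    by_cases h1 : ∃ y, y ^ 3 = 1 - u * (c : F) <;> by_cases h2 : ∃ y, y ^ 3 = 1 - u * (c' : F)
    · simp only [φ, h1, h2, dite_true] at hv
      exact mul_left_cancel₀ hu0 (by linear_combination -hv)
    · simp only [φ, h1, h2, dite_true, dite_false] at hv
      exact absurd hv (hcross c c')
    · simp only [φ, h1, h2, dite_true, dite_false] at hv
      exact absurd hv.symm (hcross c' c)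
    · simp only [φ, h1, h2, dite_false] at hv
      have : (u * (c : F))⁻¹ = (u * c')⁻¹ := by linear_combination -hv
      exact mul_left_cancel₀ hu0 (inv_injective this)
  obtain ⟨c, hc⟩ := Finite.surjective_of_injective hinj ⟨1, one_ne_zero, 1, one_pow 3⟩
  have hv := congrArg Subtype.val hc
  by_cases h1 : ∃ y, y ^ 3 = 1 - u * (c : F)
  · simp only [φ, h1, dite_true] at hv
    exact hne0 c (by linear_combination -hv)
  · simp only [φ, h1, dite_false] at hv
    exact inv_ne_zero (hne0 c) (by linear_combination -hv)

end finiteField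

universe u

section discrete

variable {E : Type u} [Field E] (w : Valuation E ℝ≥0)

/-- Every `x` in the unit ball is within distance less than `c` of a fixed finite set. -/
def HasFiniteNet (c : ℝ≥0) : Prop :=
  ∃ S : Set E, S.Finite ∧ ∀ x, w x ≤ 1 → ∃ s ∈ S, w (x - s) < c

variable {w}

theorem HasFiniteNet.mono {c c' : ℝ≥0} (h : HasFiniteNet w c) (hc : c ≤ c') :
    HasFiniteNet w c' := by
  obtain ⟨S, hS, h⟩ := h
  exact ⟨S, hS, fun x hx => (h x hx).imp fun s hs => ⟨hs.1, hs.2.trans_le hc⟩⟩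

theorem HasFiniteNet.exists_uniformizer {a : E} (h : HasFiniteNet w (w a)) (ha0 : a ≠ 0)
    (ha : w a < 1) : ∃ π : E, π ≠ 0 ∧ w π < 1 ∧ ∀ x, x ≠ 0 → ∃ n : ℤ, w x = w π ^ n := by
  obtain ⟨S, hS, h⟩ := h
  let V : Set ℝ≥0 := {r | w a ≤ r ∧ r < 1 ∧ ∃ x, w x = r}
  have hV : V.Finite := by
    refine (hS.image w).subset ?_
    rintro _ ⟨h1, h2, x, rfl⟩
    obtain ⟨s, hs, hxs⟩ := h x h2.le
    refine ⟨s, hs, ?_⟩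
    rw [← w.map_sub_swap] at hxs
    have h3 := Valuation.map_add_eq_of_lt_right w (hxs.trans_le h1)
    rw [sub_add_cancel] at h3
    exact h3
  obtain ⟨r, ⟨hr1, hr2, π, rfl⟩, hmax⟩ := hV.exists_maximal ⟨w a, le_rfl, ha, a, rfl⟩
  have hπ0 : π ≠ 0 := by
    rintro rfl
    rw [w.map_zero] at hr1
    exact ha0 ((Valuation.zero_iff w).1 (le_antisymm hr1 zero_le))
  refine ⟨π, hπ0, hr2, fun x hx => ?_⟩
  have hpos : 0 < w π := (Valuation.pos_iff w).2 hπ0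
  obtain ⟨n, hn1, hn2⟩ := exists_mem_Ico_zpow ((Valuation.pos_iff w).2 hx)
    ((one_lt_inv₀ hpos).2 hr2)
  have e : w (x * π ^ (n + 1)) = w x * w π ^ (n + 1) := by rw [map_mul, map_zpow₀]
  have hne : (w π) ^ (n + 1) ≠ 0 := zpow_ne_zero _ hpos.ne'
  have h1 : w π ≤ w (x * π ^ (n + 1)) := by
    rw [e]
    calc w π = (w π)⁻¹ ^ n * w π ^ (n + 1) := by
          rw [inv_zpow, zpow_add_one₀ hpos.ne', inv_mul_cancel_left₀ (zpow_ne_zero _ hpos.ne')]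
      _ ≤ _ := by gcongr
  have h2 : w (x * π ^ (n + 1)) < 1 := by
    rw [e]
    calc w x * w π ^ (n + 1) < (w π)⁻¹ ^ (n + 1) * w π ^ (n + 1) := by
          have : 0 < w π ^ (n + 1) := zpow_pos hpos _
          gcongr
      _ = 1 := by rw [inv_zpow, inv_mul_cancel₀ hne]
  have h3 := le_antisymm (hmax ⟨hr1.trans h1, h2, _, rfl⟩ h1) h1
  refine ⟨-n, ?_⟩
  rw [e] at h3
  have : w x = w π * (w π ^ (n + 1))⁻¹ := (eq_mul_inv_iff_mul_eq₀ hne).2 h3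
  rw [this, ← zpow_neg, mul_comm, ← zpow_add_one₀ hpos.ne']
  congr 1; ring

theorem HasFiniteNet.exists_residue (h : HasFiniteNet w 1) :
    ∃ (F : Type u) (_ : Field F) (_ : Finite F) (r : w.valuationSubring →+* F),
      Function.Surjective r ∧ ∀ x, r x = 0 ↔ w x < 1 := by
  obtain ⟨S, hS, h⟩ := h
  have hr : ∀ x : w.valuationSubring, IsLocalRing.residue w.valuationSubring x = 0 ↔ w x < 1 :=
    fun x => by rw [IsLocalRing.residue_eq_zero_iff, Valuation.mem_maximalIdeal_iff]
  refine ⟨IsLocalRing.ResidueField w.valuationSubring, inferInstance, ?_,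
    IsLocalRing.residue _, IsLocalRing.residue_surjective, hr⟩
  have := hS.to_subtype
  classical
  let f : S → IsLocalRing.ResidueField w.valuationSubring := fun s =>
    if hs : w s ≤ 1 then IsLocalRing.residue _ ⟨s, hs⟩ else 0
  refine Finite.of_surjective f fun y => ?_
  obtain ⟨⟨x, hx⟩, rfl⟩ := IsLocalRing.residue_surjective y
  obtain ⟨s, hs, hxs⟩ := h x hx
  have hs1 : w s ≤ 1 := by
    have e : s = x - (x - s) := by ring
    rw [e]
    exact (Valuation.map_sub w _ _).trans (max_le hx hxs.le)
  refine ⟨⟨s, hs⟩, ?_⟩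
  simp only [f, hs1, dite_true]
  rw [← sub_eq_zero, ← map_sub, hr]
  change w (s - x) < 1
  rw [w.map_sub_swap]
  exact hxs

end discrete

/-! ### The rigid pair attached to `ℓ`-th powers -/

/-- The nonzero `ℓ`-th powers of a field. -/
def powSet (L : Type*) [Field L] (ℓ : ℕ) : Set L := {x | ∃ y, y ≠ 0 ∧ y ^ ℓ = x}

/-- The products of units of the subfield `E` with nonzero `ℓ`-th powers. -/
def unitPowSet {E L : Type*} [Field E] [Field L] (ι : E →+* L) (w : Valuation E ℝ≥0) (ℓ : ℕ) :
    Set L :=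
  {x | ∃ c, w c = 1 ∧ ∃ y, y ≠ 0 ∧ x = ι c * y ^ ℓ}

/-- The properties of an extension `L / E` of a local field `E` which make the pair formed by
`powSet` and `unitPowSet` rigid. -/
structure IsTame {E L : Type*} [Field E] [Field L] (ι : E →+* L) (w : Valuation E ℝ≥0)
    (ℓ : ℕ) : Prop where
  hensel : ∀ x, w (x - 1) < 1 → ∃ y, y ^ ℓ = x
  descend : ∀ c y, y ^ ℓ = ι c → ∃ d, d ^ ℓ = c
  neg_one : ∃ y : E, y ^ ℓ = -1
  root : ∃ ζ : E, ζ ^ ℓ = 1 ∧ w (ζ - 1) = 1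
  net : HasFiniteNet w 1
  weak : ∀ x : L, x ≠ 0 → x ∉ unitPowSet ι w ℓ → ∃ i < ℓ, (1 - x) / x ^ i ∈ powSet L ℓ
  eq_two_or_three : ℓ = 2 ∨ ℓ = 3

theorem isMulSubgroup_powSet (L : Type*) [Field L] (ℓ : ℕ) : IsMulSubgroup (powSet L ℓ) where
  one_mem := ⟨1, one_ne_zero, one_pow ℓ⟩
  mul_mem := by
    rintro _ _ ⟨x, hx, rfl⟩ ⟨y, hy, rfl⟩
    exact ⟨x * y, mul_ne_zero hx hy, mul_pow x y ℓ⟩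
  inv_mem := by
    rintro _ ⟨x, hx, rfl⟩
    exact ⟨x⁻¹, inv_ne_zero hx, inv_pow x ℓ⟩
  ne_zero := by
    rintro _ ⟨x, hx, rfl⟩
    exact pow_ne_zero ℓ hx

theorem isMulSubgroup_unitPowSet {E L : Type*} [Field E] [Field L] (ι : E →+* L)
    (w : Valuation E ℝ≥0) (ℓ : ℕ) : IsMulSubgroup (unitPowSet ι w ℓ) where
  one_mem := ⟨1, w.map_one, 1, one_ne_zero, by simp⟩
  mul_mem := by
    rintro _ _ ⟨c, hc, x, hx, rfl⟩ ⟨d, hd, y, hy, rfl⟩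
    exact ⟨c * d, by rw [map_mul, hc, hd, one_mul], x * y, mul_ne_zero hx hy, by
      rw [map_mul]; ring⟩
  inv_mem := by
    rintro _ ⟨c, hc, x, hx, rfl⟩
    exact ⟨c⁻¹, by rw [map_inv₀, hc, inv_one], x⁻¹, inv_ne_zero hx, by
      rw [map_inv₀, mul_inv, inv_pow]⟩
  ne_zero := by
    rintro _ ⟨c, hc, x, hx, rfl⟩
    refine mul_ne_zero ((map_ne_zero ι).2 ?_) (pow_ne_zero ℓ hx)
    rintro rfl
    simp at hc

namespace IsTame


variable {E : Type u} {L : Type*} [Field E] [Field L] {ι : E →+* L} {w : Valuation E ℝ≥0} {ℓ : ℕ}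
  (h : IsTame ι w ℓ)

theorem map_mem_unitPowSet {c : E} (hc : w c = 1) : ι c ∈ unitPowSet ι w ℓ :=
  ⟨c, hc, 1, one_ne_zero, by simp⟩

theorem powSet_subset : powSet L ℓ ⊆ unitPowSet ι w ℓ := by
  rintro _ ⟨y, hy, rfl⟩
  exact ⟨1, w.map_one, y, hy, by simp⟩

theorem ne_zero_of_map_eq_one {c : E} (hc : w c = 1) : c ≠ 0 := by
  rintro rfl; simp at hc

theorem pow_mem_powSet {L : Type*} [Field L] {ℓ : ℕ} {y : L} (hy : y ≠ 0) : y ^ ℓ ∈ powSet L ℓ :=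
  ⟨y, hy, rfl⟩

include h

theorem pos : 0 < ℓ := by rcases h.eq_two_or_three with rfl | rfl <;> norm_num

theorem map_mem_powSet_iff {c : E} : ι c ∈ powSet L ℓ ↔ c ≠ 0 ∧ ∃ d, d ^ ℓ = c := by
  constructor
  · rintro ⟨y, hy, hyc⟩
    refine ⟨?_, h.descend c y hyc⟩
    rintro rfl
    rw [map_zero] at hyc
    exact hy (pow_eq_zero_iff h.pos.ne' |>.1 hyc)
  · rintro ⟨hc, d, rfl⟩
    refine ⟨ι d, ?_, (map_pow ι d ℓ).symm⟩
    rw [Ne, map_eq_zero]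
    rintro rfl
    exact hc (zero_pow h.pos.ne')

theorem map_mem_of_sub_lt {c : E} (hc : w (c - 1) < 1) : ι c ∈ powSet L ℓ :=
  h.map_mem_powSet_iff.2 ⟨ne_zero_of_map_eq_one (map_eq_one_of_sub_one_lt w hc), h.hensel c hc⟩

theorem map_div_mem_of_sub_lt {c d : E} (hd : w d = 1) (hc : w (c - d) < 1) :
    ι c / ι d ∈ powSet L ℓ := by
  have hd0 := ne_zero_of_map_eq_one hd
  rw [← map_div₀]
  apply h.map_mem_of_sub_lt
  have e : c / d - 1 = (c - d) / d := by field_simp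
  rwa [e, map_div₀, hd, div_one]

theorem map_mem_of_residue {c d : E} (hd : w d = 1) (hc : w (c - d) < 1) :
    ι c ∈ powSet L ℓ ↔ ι d ∈ powSet L ℓ := by
  have hT := isMulSubgroup_powSet L ℓ
  have h1 := h.map_div_mem_of_sub_lt hd hc
  have hd0 : ι d ≠ 0 := (map_ne_zero ι).2 (ne_zero_of_map_eq_one hd)
  have e : ι c = ι c / ι d * ι d := by field_simp
  rw [e, hT.mul_mem_iff_left h1]

theorem exists_generator : ∃ u : E, w u = 1 ∧ ι u ∉ powSet L ℓ ∧
    ∀ c, w c = 1 → ∃ n < ℓ, ι c / ι u ^ n ∈ powSet L ℓ := by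
  obtain ⟨F, _, _, r, hr, hr0⟩ := h.net.exists_residue
  have hunit : ∀ x : w.valuationSubring, r x ≠ 0 ↔ w x = 1 := by
    intro x
    rw [Ne, hr0, not_lt]
    exact ⟨fun h1 => le_antisymm x.2 h1, fun h1 => h1.ge⟩
  obtain ⟨ζ, hζ, hζ1⟩ := h.root
  have hζw : w ζ = 1 := by
    have : w ζ ^ ℓ = 1 := by rw [← map_pow, hζ, map_one]
    exact (pow_eq_one_iff_of_nonneg zero_le h.pos.ne').1 this
  have h1 : r ⟨ζ, hζw.le⟩ ^ ℓ = 1 := by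
    rw [← map_pow]; convert map_one r; exact Subtype.ext hζ
  have h2 : r ⟨ζ, hζw.le⟩ ≠ 1 := by
    intro h3
    have : r (⟨ζ, hζw.le⟩ - 1) = 0 := by rw [map_sub, h3, map_one, sub_self]
    rw [hr0] at this
    exact this.ne hζ1
  obtain ⟨u, hu0, hu, hgen⟩ := exists_generator_mod_powers h.pos h1 h2
  obtain ⟨u, rfl⟩ := hr u
  have huw := (hunit u).1 hu0
  refine ⟨u, huw, fun hcon => ?_, fun c hc => ?_⟩
  · obtain ⟨-, d, hd⟩ := h.map_mem_powSet_iff.1 hcon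
    have hdw : w d = 1 := by
      have : w d ^ ℓ = 1 := by rw [← map_pow, hd, huw]
      exact (pow_eq_one_iff_of_nonneg zero_le h.pos.ne').1 this
    apply hu (r ⟨d, hdw.le⟩)
    rw [← map_pow]; congr 1; exact Subtype.ext hd
  · obtain ⟨n, hn, y, hy⟩ := hgen (r ⟨c, hc.le⟩) ((hunit _).2 hc)
    obtain ⟨y, rfl⟩ := hr y
    have hy1 : w (u ^ n * y ^ ℓ : E) = 1 := by
      have := (hunit (u ^ n * y ^ ℓ)).1 (by
        rw [map_mul, map_pow, map_pow, ← hy]; exact (hunit _).2 hc)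
      exact this
    have hlt : w (c - u ^ n * y ^ ℓ) < 1 := by
      have := (hr0 (⟨c, hc.le⟩ - u ^ n * y ^ ℓ)).1 (by
        rw [map_sub, map_mul, map_pow, map_pow, ← hy, sub_self])
      exact this
    refine ⟨n, hn, ?_⟩
    have h3 := h.map_div_mem_of_sub_lt hy1 hlt
    have hy0 : (y : E) ≠ 0 := by
      intro h0
      rw [h0, zero_pow h.pos.ne', mul_zero, map_zero] at hy1
      exact zero_ne_one hy1
    have h4 : ι y ^ ℓ ∈ powSet L ℓ := pow_mem_powSet ((map_ne_zero ι).2 hy0)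
    have hι : ι y ≠ 0 := (map_ne_zero ι).2 hy0
    have := (isMulSubgroup_powSet L ℓ).mul_mem h3 h4
    convert this using 1
    rw [map_mul, map_pow, map_pow]
    field_simp

theorem exists_mul_one_sub (hℓ : ℓ = 3) : ∃ c : E, w c = 1 ∧ w (1 - c) = 1 ∧ ι c ∉ powSet L ℓ ∧
    ι (c * (1 - c)) ∈ powSet L ℓ := by
  subst hℓ
  obtain ⟨F, _, _, r, hr, hr0⟩ := h.net.exists_residue
  have hunit : ∀ x : w.valuationSubring, r x ≠ 0 ↔ w x = 1 := by
    intro x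
    rw [Ne, hr0, not_lt]
    exact ⟨fun h1 => le_antisymm x.2 h1, fun h1 => h1.ge⟩
  obtain ⟨ζ, hζ, hζ1⟩ := h.root
  have hζw : w ζ = 1 := by
    have : w ζ ^ 3 = 1 := by rw [← map_pow, hζ, map_one]
    exact (pow_eq_one_iff_of_nonneg zero_le h.pos.ne').1 this
  have h1 : r ⟨ζ, hζw.le⟩ ^ 3 = 1 := by
    rw [← map_pow]; convert map_one r; exact Subtype.ext hζ
  have h2 : r ⟨ζ, hζw.le⟩ ≠ 1 := by
    intro h3
    have : r (⟨ζ, hζw.le⟩ - 1) = 0 := by rw [map_sub, h3, map_one, sub_self]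
    rw [hr0] at this
    exact this.ne hζ1
  obtain ⟨c, d, hc0, hc, hd⟩ := exists_mul_one_sub_cube h1 h2
  obtain ⟨c, rfl⟩ := hr c
  obtain ⟨d, rfl⟩ := hr d
  have hcw := (hunit c).1 hc0
  have h1c : r (1 - c) ≠ 0 := by
    intro h0
    rw [map_sub, map_one] at h0
    exact hc 1 (by linear_combination h0)
  have h1cw := (hunit (1 - c)).1 h1c
  have hdw : w d = 1 := by
    apply (hunit d).1
    intro h0
    rw [h0, zero_pow (by norm_num), ← map_one r, ← map_sub] at hd
    exact (mul_ne_zero hc0 h1c) hd.symm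
  refine ⟨c, hcw, h1cw, fun hcon => ?_, ?_⟩
  · obtain ⟨-, y, hy⟩ := h.map_mem_powSet_iff.1 hcon
    have hyw : w y = 1 := by
      have : w y ^ 3 = 1 := by rw [← map_pow, hy, hcw]
      exact (pow_eq_one_iff_of_nonneg zero_le h.pos.ne').1 this
    apply hc (r ⟨y, hyw.le⟩)
    rw [← map_pow]; congr 1; exact Subtype.ext hy
  · have hlt : w (c * (1 - c) - d ^ 3 : E) < 1 := by
      have := (hr0 (c * (1 - c) - d ^ 3)).1 (by
        rw [map_sub, map_mul, map_pow, hd, map_sub, map_one, sub_self])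
      exact this
    rw [h.map_mem_of_residue (by rw [map_pow, hdw, one_pow]) hlt, map_pow]
    exact pow_mem_powSet ((map_ne_zero ι).2 (ne_zero_of_map_eq_one hdw))

theorem exists_pow_sub_one_lt {c : E} (hc : w c = 1) : ∃ n : ℕ, w (c ^ (n + 1) - 1) < 1 := by
  obtain ⟨F, _, _, r, hr, hr0⟩ := h.net.exists_residue
  have hc0 : r ⟨c, hc.le⟩ ≠ 0 := by
    rw [Ne, hr0, not_lt]; exact hc.ge
  obtain ⟨n, hn, hn1⟩ := (isOfFinOrder_of_finite (Units.mk0 _ hc0)).exists_pow_eq_one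
  obtain ⟨n, rfl⟩ := Nat.exists_eq_add_of_lt hn
  refine ⟨n, ?_⟩
  have hu : r ⟨c, hc.le⟩ ^ (n + 1) = 1 := by simpa using congrArg Units.val hn1
  have := (hr0 (⟨c, hc.le⟩ ^ (n + 1) - 1)).1 (by rw [map_sub, map_pow, hu, map_one, sub_self])
  exact this

end IsTame

namespace IsTame


variable {E : Type u} {L : Type*} [Field E] [Field L] {ι : E →+* L} {w : Valuation E ℝ≥0} {ℓ : ℕ}
  (h : IsTame ι w ℓ)
include h

theorem neg_one_mem_powSet : (-1 : L) ∈ powSet L ℓ := by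
  obtain ⟨y, hy⟩ := h.neg_one
  have : ι (-1 : E) ∈ powSet L ℓ := h.map_mem_powSet_iff.2 ⟨by simp, y, hy⟩
  simpa using this

theorem neg_mem_powSet_iff {x : L} : -x ∈ powSet L ℓ ↔ x ∈ powSet L ℓ := by
  rw [neg_eq_neg_one_mul, (isMulSubgroup_powSet L ℓ).mul_mem_iff_left h.neg_one_mem_powSet]

theorem neg_mem_unitPowSet_iff {x : L} : -x ∈ unitPowSet ι w ℓ ↔ x ∈ unitPowSet ι w ℓ := by
  rw [neg_eq_neg_one_mul, (isMulSubgroup_unitPowSet ι w ℓ).mul_mem_iff_left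
    (powSet_subset h.neg_one_mem_powSet)]

theorem not_one_sub_div_sq_mem (hℓ : ℓ = 3) {z : L} (hz0 : z ≠ 0) (hz : z ∉ unitPowSet ι w ℓ) :
    (1 - z) / z ^ 2 ∉ powSet L ℓ := by
  intro hb
  have hT := isMulSubgroup_powSet L ℓ
  have hH := isMulSubgroup_unitPowSet ι w ℓ
  have hTH : powSet L ℓ ⊆ unitPowSet ι w ℓ := powSet_subset
  obtain ⟨c, hc, hc1, hcT, hd⟩ := h.exists_mul_one_sub hℓ
  have hγH : ι c ∈ unitPowSet ι w ℓ := map_mem_unitPowSet hc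
  have hγ0 : ι c ≠ 0 := (map_ne_zero ι).2 (ne_zero_of_map_eq_one hc)
  have hδ0 : 1 - ι c ≠ 0 := by
    rw [← map_one ι, ← map_sub]
    exact (map_ne_zero ι).2 (ne_zero_of_map_eq_one hc1)
  rw [map_mul, map_sub, map_one] at hd
  generalize ι c = γ at *
  have hcube : ∀ y : L, y ≠ 0 → y ^ 3 ∈ powSet L ℓ := fun y hy => by
    subst hℓ; exact pow_mem_powSet hy
  have hsq : z ^ 2 ∉ unitPowSet ι w ℓ := by
    intro h2
    apply hz
    have := hH.div_mem (hTH (hcube z hz0)) h2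
    rwa [show z ^ 3 / z ^ 2 = z by field_simp] at this
  have hγz : γ * z ∉ unitPowSet ι w ℓ := by rwa [hH.mul_mem_iff_left hγH]
  obtain ⟨j, hj, ha⟩ := h.weak (γ * z) (mul_ne_zero hγ0 hz0) hγz
  have h1z : 1 - z ≠ 0 := fun h0 => hT.ne_zero hb (by rw [h0, zero_div])
  have hb0 := hT.ne_zero hb
  have ha0 := hT.ne_zero ha
  have hd0 := hT.ne_zero hd
  set b := (1 - z) / z ^ 2 with hbdef
  set a := (1 - γ * z) / (γ * z) ^ j with hadef
  set d := γ * (1 - γ) with hddef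
  set B := -(b / d) * (γ * z) ^ 2 with hBdef
  have hbd : -(b / d) ∈ powSet L ℓ := h.neg_mem_powSet_iff.2 (hT.div_mem hb hd)
  have hB0 : B ≠ 0 := mul_ne_zero (hT.ne_zero hbd) (pow_ne_zero 2 (mul_ne_zero hγ0 hz0))
  have hBH : B ∉ unitPowSet ι w ℓ := by
    rw [hBdef, hH.mul_mem_iff_left (hTH hbd), mul_pow, hH.mul_mem_iff_left (hH.pow_mem hγH 2)]
    exact hsq
  obtain ⟨i, hi, hAB⟩ := h.weak B hB0 hBH
  have hA : 1 - B = a / d * ((γ * z) ^ j * γ) := by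
    have e1 : a * (γ * z) ^ j = 1 - γ * z := by
      rw [hadef, div_mul_cancel₀]; exact pow_ne_zero _ (mul_ne_zero hγ0 hz0)
    have e2 : b * z ^ 2 = 1 - z := by
      rw [hbdef, div_mul_cancel₀]; exact pow_ne_zero _ hz0
    have e3 : a / d * ((γ * z) ^ j * γ) = (1 - γ * z) * γ / d := by rw [← e1]; ring
    have e4 : B = - (γ ^ 2 * (1 - z)) / d := by rw [← e2, hBdef]; ring
    rw [e3, e4, hddef]; field_simp; ring
  have key : γ * (γ * z) ^ (j + i) ∈ powSet L ℓ := by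
    have h1 : (a / d) ∈ powSet L ℓ := hT.div_mem ha hd
    have h2 := hT.mul_mem (hT.div_mem hAB h1) (hT.mul_mem (hT.pow_mem hbd i)
      (hT.pow_mem (hcube _ (mul_ne_zero hγ0 hz0)) i))
    convert h2 using 1
    have h3 := hT.ne_zero hbd
    have h4 := hT.ne_zero h1
    have h5 : γ * z ≠ 0 := mul_ne_zero hγ0 hz0
    rw [hA, hBdef]
    generalize -(b / d) = r at *
    generalize a / d = q at *
    generalize γ * z = m at *
    field_simp
    ring
  have hm : ∀ m, γ * (γ * z) ^ m ∈ powSet L ℓ → m = 1 ∨ m = 2 → False := by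
    rintro m h1 (rfl | rfl)
    · have := hTH h1
      rw [hH.mul_mem_iff_left hγH, pow_one] at this
      exact hγz this
    · have := hTH h1
      rw [hH.mul_mem_iff_left hγH, mul_pow, hH.mul_mem_iff_left (hH.pow_mem hγH 2)] at this
      exact hsq this
  have hm3 : ∀ m, γ * (γ * z) ^ (m + 3) ∈ powSet L ℓ → γ * (γ * z) ^ m ∈ powSet L ℓ := by
    intro m h1
    rw [pow_add, ← mul_assoc, hT.mul_mem_iff_right (hcube _ (mul_ne_zero hγ0 hz0))] at h1
    exact h1
  have hlt : j + i ≤ 4 := by omega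
  generalize j + i = m at *
  interval_cases m
  · apply hcT; simpa using key
  · exact hm 1 key (Or.inl rfl)
  · exact hm 2 key (Or.inr rfl)
  · apply hcT; simpa using hm3 0 key
  · exact hm 1 (hm3 1 key) (Or.inl rfl)

theorem rigid (x : L) (hx0 : x ≠ 0) (hx : x ∉ unitPowSet ι w ℓ) :
    1 + x ∈ powSet L ℓ ∨ (1 + x) / x ∈ powSet L ℓ := by
  have hx' : -x ∉ unitPowSet ι w ℓ := by rwa [h.neg_mem_unitPowSet_iff]
  obtain ⟨i, hi, hmem⟩ := h.weak (-x) (neg_ne_zero.2 hx0) hx'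
  have hi' : i = 0 ∨ i = 1 ∨ (ℓ = 3 ∧ i = 2) := by
    rcases h.eq_two_or_three with h2 | h2 <;> omega
  rcases hi' with rfl | rfl | ⟨h3, rfl⟩
  · left; simpa using hmem
  · right
    rw [pow_one, sub_neg_eq_add, div_neg, h.neg_mem_powSet_iff] at hmem
    exact hmem
  · exact absurd hmem (h.not_one_sub_div_sq_mem h3 (neg_ne_zero.2 hx0) hx')

/-- The units of `E` which multiply the rigid part into itself. -/
def Scales (_ : IsTame ι w ℓ) (c : E) : Prop :=
  ∀ z ∈ rigidPart (powSet L ℓ) (unitPowSet ι w ℓ), ι c * z ∈ rigidPart (powSet L ℓ)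
    (unitPowSet ι w ℓ)

theorem scales_of_notMem {c : E} (hc : w c = 1) (hc1 : w (1 - c) = 1)
    (hcT : ι (c / (1 - c)) ∉ powSet L ℓ) : h.Scales c := by
  rintro z ⟨hz0, hzH, hz1⟩
  have hT := isMulSubgroup_powSet L ℓ
  have hH := isMulSubgroup_unitPowSet ι w ℓ
  have hTH : powSet L ℓ ⊆ unitPowSet ι w ℓ := powSet_subset
  have hγH : ι c ∈ unitPowSet ι w ℓ := map_mem_unitPowSet hc
  have hδH : ι (1 - c) ∈ unitPowSet ι w ℓ := map_mem_unitPowSet hc1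
  have hγ0 : ι c ≠ 0 := hH.ne_zero hγH
  have hδ0 : ι (1 - c) ≠ 0 := hH.ne_zero hδH
  rw [map_div₀] at hcT
  rw [map_sub, map_one] at hδH hδ0 hcT
  generalize ι c = γ at *
  have hγz : γ * z ∉ unitPowSet ι w ℓ := by rwa [hH.mul_mem_iff_left hγH]
  have hγz0 := mul_ne_zero hγ0 hz0
  refine ⟨hγz0, hγz, ?_⟩
  rcases h.rigid (γ * z) hγz0 hγz with h1 | h1
  · exact h1
  exfalso
  have hA : (1 + γ * z) / (1 - γ) ∉ unitPowSet ι w ℓ := by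
    rw [hH.div_mem_iff_right hδH]
    intro h2
    apply hγz
    have h3 := hH.div_mem h2 (hTH h1)
    have h4 := hH.ne_zero h2
    rwa [show (1 + γ * z) / ((1 + γ * z) / (γ * z)) = γ * z by field_simp] at h3
  have hA0 : (1 + γ * z) / (1 - γ) ≠ 0 := by
    refine div_ne_zero (fun h0 => hT.ne_zero h1 (by rw [h0, zero_div])) hδ0
  have hz1' := hT.ne_zero hz1
  have e : 1 + -((1 + γ * z) / (1 - γ)) = -(γ / (1 - γ) * (1 + z)) := by field_simp; ring
  rcases h.rigid (-((1 + γ * z) / (1 - γ))) (neg_ne_zero.2 hA0)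
    (by rwa [h.neg_mem_unitPowSet_iff]) with h2 | h2
  · rw [e, h.neg_mem_powSet_iff, hT.mul_mem_iff_right hz1] at h2
    exact hcT h2
  · rw [e, neg_div_neg_eq] at h2
    apply hA
    have h3 := hH.div_mem (hH.mul_mem (hH.div_mem hγH hδH) (hTH hz1)) (hTH h2)
    have h4 : γ / (1 - γ) * (1 + z) ≠ 0 := mul_ne_zero (div_ne_zero hγ0 hδ0) hz1'
    generalize γ / (1 - γ) * (1 + z) = B at *
    rwa [show B / (B / ((1 + γ * z) / (1 - γ))) = (1 + γ * z) / (1 - γ) by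
      field_simp] at h3

theorem scales_inv_of_notMem {c : E} (hc : w c = 1) (hc1 : w (1 - c) = 1)
    (hcT : ι (1 - c) ∉ powSet L ℓ) : h.Scales c⁻¹ := by
  have hc0 := ne_zero_of_map_eq_one hc
  have hd0 := ne_zero_of_map_eq_one hc1
  have hd0' : c - 1 ≠ 0 := by rwa [← neg_sub, neg_ne_zero]
  have e : 1 - c⁻¹ = -(1 - c) / c := by field_simp; ring
  apply h.scales_of_notMem
  · rw [map_inv₀, hc, inv_one]
  · rw [e, map_div₀, Valuation.map_neg, hc, hc1, div_one]
  · have e2 : c⁻¹ / (1 - c⁻¹) = -(1 - c)⁻¹ := by rw [e]; field_simp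
    rwa [e2, map_neg, h.neg_mem_powSet_iff, map_inv₀, (isMulSubgroup_powSet L ℓ).inv_mem_iff]

theorem Scales.mul {c d : E} (hc : h.Scales c) (hd : h.Scales d) : h.Scales (c * d) := by
  intro z hz
  rw [map_mul, mul_assoc]
  exact hc _ (hd _ hz)

theorem Scales.pow {c : E} (hc : h.Scales c) (n : ℕ) : h.Scales (c ^ n) := by
  induction n with
  | zero => intro z hz; simpa using hz
  | succ n ih => rw [pow_succ]; exact Scales.mul h ih hc

theorem map_one_sub_eq_one {u : E} (hu : w u = 1) (huT : ι u ∉ powSet L ℓ) : w (1 - u) = 1 := by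
  have h1 : w (1 - u) ≤ 1 := (w.map_sub 1 u).trans (by rw [map_one, hu, max_self])
  refine le_antisymm h1 (not_lt.1 fun hlt => huT ?_)
  rw [Valuation.map_sub_swap] at hlt
  exact h.map_mem_of_sub_lt hlt

theorem scales_of_sub_one_lt {c : E} (hc : w (c - 1) < 1) : h.Scales c := by
  have hT := isMulSubgroup_powSet L ℓ
  have hcw := map_eq_one_of_sub_one_lt w hc
  have hcT := h.map_mem_of_sub_lt hc
  obtain ⟨b, hb, hb1, hbT, hbT'⟩ : ∃ b, w b = 1 ∧ w (1 - b) = 1 ∧ ι (b / (1 - b)) ∉ powSet L ℓ ∧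
      ι (1 - b) ∉ powSet L ℓ := by
    obtain ⟨u, hu, huT, -⟩ := h.exists_generator
    have hu1 := h.map_one_sub_eq_one hu huT
    have hu0 := ne_zero_of_map_eq_one hu
    have hu10 := ne_zero_of_map_eq_one hu1
    by_cases h1 : ι (1 - u) ∈ powSet L ℓ
    · refine ⟨1 - u, hu1, by rwa [sub_sub_cancel], ?_, by rwa [sub_sub_cancel]⟩
      rw [sub_sub_cancel, map_div₀, ← hT.inv_mem_iff, inv_div, hT.div_mem_iff_right h1]
      exact huT
    by_cases h2 : ι ((1 - u) / u) ∈ powSet L ℓ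
    · have e : 1 - u⁻¹ = -((1 - u) / u) := by field_simp; ring
      refine ⟨1 - u⁻¹, ?_, ?_, ?_, ?_⟩
      · rw [e, Valuation.map_neg, map_div₀, hu, hu1, div_one]
      · rw [sub_sub_cancel, map_inv₀, hu, inv_one]
      · rw [sub_sub_cancel, div_inv_eq_mul, e, map_mul, map_neg, neg_mul, h.neg_mem_powSet_iff,
          hT.mul_mem_iff_left h2]
        exact huT
      · rwa [sub_sub_cancel, map_inv₀, hT.inv_mem_iff]
    · refine ⟨u, hu, hu1, ?_, h1⟩
      rwa [← hT.inv_mem_iff, ← map_inv₀, inv_div]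
  have hb0 := ne_zero_of_map_eq_one hb
  have hb10 := ne_zero_of_map_eq_one hb1
  have hlt : w ((1 - b * c) - (1 - b)) < 1 := by
    have : (1 - b * c) - (1 - b) = -(b * (c - 1)) := by ring
    rwa [this, Valuation.map_neg, map_mul, hb, one_mul]
  have hbc1 : w (1 - b * c) = 1 := by
    have := Valuation.map_add_eq_of_lt_right w (x := (1 - b * c) - (1 - b)) (y := 1 - b)
      (by rwa [hb1])
    rwa [sub_add_cancel, hb1] at this
  have h1 := h.map_div_mem_of_sub_lt hb1 hlt
  have s1 : h.Scales (b * c) := by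
    apply h.scales_of_notMem (by rw [map_mul, hb, hcw, one_mul]) hbc1
    intro h2
    apply hbT
    have h3 := hT.div_mem (hT.mul_mem h2 h1) hcT
    have hbc0 := ne_zero_of_map_eq_one hbc1
    have hc0 := ne_zero_of_map_eq_one hcw
    rw [← map_div₀, ← map_mul, ← map_div₀] at h3
    convert h3 using 2
    field_simp
  have s2 := h.scales_inv_of_notMem hb hb1 hbT'
  have := Scales.mul h s2 s1
  rwa [inv_mul_cancel_left₀ hb0] at this

theorem Scales.inv {c : E} (hcw : w c = 1) (hc : h.Scales c) : h.Scales c⁻¹ := by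
  obtain ⟨n, hn⟩ := h.exists_pow_sub_one_lt hcw
  have hc0 := ne_zero_of_map_eq_one hcw
  have h1 : h.Scales (c ^ (n + 1))⁻¹ := by
    apply h.scales_of_sub_one_lt
    have e : (c ^ (n + 1))⁻¹ - 1 = -(c ^ (n + 1) - 1) / c ^ (n + 1) := by field_simp; ring
    rwa [e, map_div₀, Valuation.map_neg, map_pow, hcw, one_pow, div_one]
  have := Scales.mul h (Scales.pow h hc n) h1
  convert this using 1
  rw [pow_succ]; field_simp

theorem scales_of_nonresidue {u : E} (hu : w u = 1) (huT : ι u ∉ powSet L ℓ) : h.Scales u := by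
  have hT := isMulSubgroup_powSet L ℓ
  have hu1 := h.map_one_sub_eq_one hu huT
  have hu10 := ne_zero_of_map_eq_one hu1
  by_cases h1 : ι (u / (1 - u)) ∈ powSet L ℓ
  · by_cases h2 : ι (1 - u) ∈ powSet L ℓ
    · refine absurd ?_ huT
      have := hT.mul_mem h1 h2
      rwa [← map_mul, div_mul_cancel₀ _ hu10] at this
    · have h3 := h.scales_inv_of_notMem hu hu1 h2
      have := Scales.inv h (by rw [map_inv₀, hu, inv_one]) h3
      rwa [inv_inv] at this
  · exact h.scales_of_notMem hu hu1 h1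

theorem scales {c : E} (hc : w c = 1) : h.Scales c := by
  by_cases hcT : ι c ∈ powSet L ℓ
  · obtain ⟨u, hu, huT, -⟩ := h.exists_generator
    have hu0 := ne_zero_of_map_eq_one hu
    have h1 : h.Scales (u * c) := by
      apply h.scales_of_nonresidue (by rw [map_mul, hu, hc, one_mul])
      rwa [map_mul, (isMulSubgroup_powSet L ℓ).mul_mem_iff_right hcT]
    have := Scales.mul h (Scales.inv h hu (h.scales_of_nonresidue hu huT)) h1
    rwa [inv_mul_cancel_left₀ hu0] at this
  · exact h.scales_of_nonresidue hc hcT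

theorem exists_unit_notMem {α β : L} (hαβ : ℓ = 2 → (α ∈ powSet L ℓ ↔ β ∈ powSet L ℓ)) :
    ∃ c, w c = 1 ∧ ι c * α ∉ powSet L ℓ ∧ ι c * β ∉ powSet L ℓ := by
  have hT := isMulSubgroup_powSet L ℓ
  obtain ⟨u, hu, huT, -⟩ := h.exists_generator
  have hu0 : ι u ≠ 0 := (map_ne_zero ι).2 (ne_zero_of_map_eq_one hu)
  by_cases h1 : α ∉ powSet L ℓ ∧ β ∉ powSet L ℓ
  · exact ⟨1, by simp, by simpa using h1.1, by simpa using h1.2⟩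
  by_cases h2 : ι u * α ∉ powSet L ℓ ∧ ι u * β ∉ powSet L ℓ
  · exact ⟨u, hu, h2⟩
  have hu2 : ∀ {x}, x ∈ powSet L ℓ → ι u * x ∉ powSet L ℓ := fun {x} hx hux =>
    huT ((hT.mul_mem_iff_right hx).1 hux)
  have h3 : ℓ = 3 := by
    rcases h.eq_two_or_three with h3 | h3
    · exfalso
      have := hαβ h3
      have hα : α ∈ powSet L ℓ := by tauto
      exact h2 ⟨hu2 hα, hu2 (this.1 hα)⟩
    · exact h3
  have hu3 : ∀ {x}, x ∈ powSet L ℓ → ι u ^ 2 * x ∉ powSet L ℓ := fun {x} hx hux => by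
    have h4 := (hT.mul_mem_iff_right hx).1 hux
    have h5 : ι u ^ 3 ∈ powSet L ℓ := by subst h3; exact pow_mem_powSet hu0
    have h6 := hT.div_mem h5 h4
    rw [show ι u ^ 3 / ι u ^ 2 = ι u by field_simp] at h6
    exact huT h6
  have hu4 : ∀ {x}, ι u * x ∈ powSet L ℓ → ι u ^ 2 * x ∉ powSet L ℓ := fun {x} hx hux => by
    rw [pow_two, mul_assoc] at hux
    exact hu2 hx hux
  refine ⟨u ^ 2, by rw [map_pow, hu, one_pow], ?_⟩
  rw [map_pow]
  have hα := @hu2 α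
  have hβ := @hu2 β
  have hα3 := @hu3 α
  have hβ3 := @hu3 β
  have hα4 := @hu4 α
  have hβ4 := @hu4 β
  tauto

theorem isRigidPair : IsRigidPair (powSet L ℓ) (unitPowSet ι w ℓ) where
  left := isMulSubgroup_powSet L ℓ
  right := isMulSubgroup_unitPowSet ι w ℓ
  le := powSet_subset
  neg_one_mem := h.neg_one_mem_powSet
  rigid := h.rigid
  neg_mem := by
    intro x hx
    have := h.scales (c := -1) (by simp) x hx
    simpa using this
  exists_scale := by
    rintro x hx y hy
    obtain ⟨c, hc, h1, h2⟩ := h.exists_unit_notMem (α := y / x) (β := y * x) (by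
      rintro rfl
      have : y * x = y / x * x ^ 2 := by field_simp [hx.1]
      rw [this, (isMulSubgroup_powSet L 2).mul_mem_iff_right (pow_mem_powSet hx.1)])
    refine ⟨ι c, map_mem_unitPowSet hc, h.scales hc, ?_, by rwa [mul_div_assoc],
      by rwa [mul_assoc]⟩
    rw [← map_inv₀]
    exact h.scales (by rw [map_inv₀, hc, inv_one])

theorem map_mem_valuationSubring_of_eq_one {c : E} (hc : w c = 1) :
    ι c ∈ h.isRigidPair.valuationSubring :=
  h.isRigidPair.mem_valuationSubring_iff.2 (Or.inr (Or.inr ⟨map_mem_unitPowSet hc, h.scales hc⟩))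

theorem map_mem_rigidPart {π : E} (hπ0 : π ≠ 0) (hπ : w π < 1)
    (hgen : ∀ x, x ≠ 0 → ∃ n : ℤ, w x = w π ^ n) :
    ι π ∈ rigidPart (powSet L ℓ) (unitPowSet ι w ℓ) := by
  refine ⟨(map_ne_zero ι).2 hπ0, ?_, ?_⟩
  · rintro ⟨c, hc, y, hy, e⟩
    have hc0 := ne_zero_of_map_eq_one hc
    obtain ⟨d, hd⟩ := h.descend (π / c) y (by
      rw [map_div₀, e]; field_simp [(map_ne_zero ι).2 hc0])
    have hd0 : d ≠ 0 := by
      rintro rfl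
      rw [zero_pow h.pos.ne'] at hd
      exact div_ne_zero hπ0 hc0 hd.symm
    obtain ⟨n, hn⟩ := hgen d hd0
    have h1 : w π = w π ^ (n * ℓ) := by
      rw [zpow_mul, ← hn, zpow_natCast, ← map_pow, hd, map_div₀, hc, div_one]
    have hp : (0 : ℝ≥0) < w π := by
      rw [pos_iff_ne_zero, Ne, map_eq_zero]; exact hπ0
    have h2 : (1 : ℤ) = n * ℓ := by
      apply zpow_right_injective₀ hp hπ.ne
      simpa using h1
    have h3 : IsUnit (ℓ : ℤ) := IsUnit.of_mul_eq_one n (by rw [mul_comm]; exact h2.symm)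
    rcases h.eq_two_or_three with rfl | rfl <;> exact absurd h3 (by decide)
  · have := h.map_mem_of_sub_lt (c := 1 + π) (by simpa using hπ)
    simpa using this

theorem map_mem_valuationSubring {x : E} (hx : w x ≤ 1) {a : E} (ha0 : a ≠ 0) (ha : w a < 1)
    (hnet : HasFiniteNet w (w a)) : ι x ∈ h.isRigidPair.valuationSubring := by
  obtain ⟨π, hπ0, hπ, hgen⟩ := hnet.exists_uniformizer ha0 ha
  rcases eq_or_ne x 0 with rfl | hx0
  · rw [map_zero]; exact zero_mem _
  obtain ⟨n, hn⟩ := hgen x hx0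
  have hp : (0 : ℝ≥0) < w π := by
    rw [pos_iff_ne_zero, Ne, map_eq_zero]; exact hπ0
  have hn0 : 0 ≤ n := by
    by_contra hneg
    push Not at hneg
    have := one_lt_zpow_of_neg₀ hp hπ hneg
    rw [← hn] at this
    exact absurd hx (not_le.2 this)
  obtain ⟨m, rfl⟩ := Int.eq_ofNat_of_zero_le hn0
  have h1 : ι π ∈ h.isRigidPair.valuationSubring :=
    h.isRigidPair.mem_valuationSubring_iff.2 (Or.inr (Or.inl (h.map_mem_rigidPart hπ0 hπ hgen)))
  have h2 : ι (x / π ^ m) ∈ h.isRigidPair.valuationSubring := by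
    apply h.map_mem_valuationSubring_of_eq_one
    rw [map_div₀, hn, map_pow, zpow_natCast, div_self (pow_ne_zero m hp.ne')]
  have := mul_mem h2 (pow_mem h1 m)
  rwa [← map_pow, ← map_mul, div_mul_cancel₀ _ (pow_ne_zero m hπ0)] at this

theorem map_inv_notMem_valuationSubring {a : E} (ha0 : a ≠ 0) (ha : w a < 1)
    (hnet : HasFiniteNet w (w a)) : ι a⁻¹ ∉ h.isRigidPair.valuationSubring := by
  obtain ⟨π, hπ0, hπ, hgen⟩ := hnet.exists_uniformizer ha0 ha
  obtain ⟨n, hn⟩ := hgen a ha0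
  have hp : (0 : ℝ≥0) < w π := by
    rw [pos_iff_ne_zero, Ne, map_eq_zero]; exact hπ0
  have hle : w (a / π) ≤ 1 := by
    rw [map_div₀]
    apply div_le_one_of_le₀ _ zero_le
    have hn1 : 1 ≤ n := by
      by_contra hneg
      push Not at hneg
      have : (1 : ℝ≥0) ≤ w π ^ n := one_le_zpow_of_nonpos₀ hp hπ.le (by omega)
      rw [← hn] at this
      exact absurd ha (not_lt.2 this)
    rw [hn]
    calc w π ^ n ≤ w π ^ (1 : ℤ) := zpow_le_zpow_right_of_le_one₀ hp hπ.le hn1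
      _ = w π := zpow_one _
  intro hcon
  have h1 := mul_mem hcon (h.map_mem_valuationSubring hle ha0 ha hnet)
  rw [← map_mul, show a⁻¹ * (a / π) = π⁻¹ by field_simp, map_inv₀] at h1
  exact h.isRigidPair.inv_notMem_valuationSubring (h.map_mem_rigidPart hπ0 hπ hgen) h1

end IsTame

/-! ### Weak rigidity of the fixed fields -/

section kummer

variable {G A : Type*} [Group G] [Field A] [MulSemiringAction G A]

theorem exists_isCyclicStep_of_pow_mem (W : Subgroup G) {ℓ : ℕ} (hℓ : ℓ.Prime) {ζ : A}
    (hζ : IsPrimitiveRoot ζ ℓ) (hζW : ζ ∈ fixedSubfield A W) {ρ : A} (hρ0 : ρ ≠ 0)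
    (hρ : ρ ^ ℓ ∈ fixedSubfield A W) (hρn : ρ ∉ fixedSubfield A W) :
    ∃ (W' : Subgroup G) (g : G) (ξ : A), IsCyclicStep W W' g ℓ ∧ IsPrimitiveRoot ξ ℓ ∧
      ξ ∈ fixedSubfield A W ∧ g • ρ = ξ * ρ ∧ ρ ∈ fixedSubfield A W' := by
  have : NeZero ℓ := ⟨hℓ.ne_zero⟩
  have hroot : ∀ {ξ : A}, IsPrimitiveRoot ξ ℓ → ∀ g ∈ W, ∃ j < ℓ, g • ρ = ξ ^ j * ρ := by
    intro ξ hξ g hg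
    have h1 : (g • ρ / ρ) ^ ℓ = 1 := by
      rw [div_pow, ← smul_pow', hρ g hg, div_self (pow_ne_zero _ hρ0)]
    obtain ⟨j, hj, hj'⟩ := hξ.eq_pow_of_pow_eq_one h1
    exact ⟨j, hj, by rw [hj', div_mul_cancel₀ _ hρ0]⟩
  rw [mem_fixedSubfield_iff] at hρn
  push Not at hρn
  obtain ⟨g, hg, hgρ⟩ := hρn
  obtain ⟨j, hj, hgj⟩ := hroot hζ g hg
  have hj0 : j ≠ 0 := by rintro rfl; exact hgρ (by simpa using hgj)
  have hξ : IsPrimitiveRoot (ζ ^ j) ℓ :=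
    hζ.pow_of_coprime j ((hℓ.coprime_iff_not_dvd.2
      (Nat.not_dvd_of_pos_of_lt (Nat.pos_of_ne_zero hj0) hj)).symm)
  have hξW : ζ ^ j ∈ fixedSubfield A W := pow_mem hζW j
  generalize ζ ^ j = ξ at *
  have hpow : ∀ n : ℕ, g ^ n • ρ = ξ ^ n * ρ := by
    intro n
    induction n with
    | zero => simp
    | succ n ih =>
      rw [pow_succ', mul_smul, ih, smul_mul', smul_pow', hξW g hg, hgj, pow_succ, mul_assoc]
  refine ⟨W ⊓ MulAction.stabilizer G ρ, g, ξ, ⟨inf_le_left, hg, Subgroup.mem_inf.2 ⟨pow_mem hg ℓ, ?_⟩,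
    ?_, ?_⟩, hξ,
    hξW, hgj, fun h hh => hh.2⟩
  · rw [MulAction.mem_stabilizer_iff, hpow, hξ.pow_eq_one, one_mul]
  · intro h hh
    obtain ⟨hh, hh'⟩ := Subgroup.mem_inf.1 hh
    refine Subgroup.mem_inf.2 ⟨mul_mem (mul_mem (inv_mem hg) hh) hg, ?_⟩
    rw [MulAction.mem_stabilizer_iff] at hh' ⊢
    rw [mul_smul, mul_smul, hgj, smul_mul', hξW h hh, hh', ← hgj, inv_smul_smul]
  · intro h hh
    obtain ⟨i, -, hi⟩ := hroot hξ h hh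
    refine ⟨i, Subgroup.mem_inf.2 ⟨mul_mem (inv_mem (pow_mem hg i)) hh, ?_⟩⟩
    rw [MulAction.mem_stabilizer_iff, mul_smul, hi, ← hpow, inv_smul_smul]

end kummer

section eigen

variable {G A : Type*} [Group G] [Field A] [MulSemiringAction G A] {W W' : Subgroup G} {g : G}
  {ℓ : ℕ} {ζ : A}

/-- The projection to the `ζ ^ i`-eigenspace of `g`, multiplied by `ℓ`. -/
def eigenSum (g : G) (ζ : A) (ℓ i : ℕ) (c : A) : A :=
  ∑ j ∈ Finset.range ℓ, (ζ⁻¹ ^ i) ^ j * g ^ j • c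

theorem eigenSum_mem_left (h : IsCyclicStep W W' g ℓ) (hζW : ζ ∈ fixedSubfield A W) {c : A}
    (hc : c ∈ fixedSubfield A W') (i : ℕ) : eigenSum g ζ ℓ i c ∈ fixedSubfield A W' :=
  sum_mem fun j _ => mul_mem (pow_mem (pow_mem (inv_mem (mem_fixedSubfield_iff.2 fun w hw => hζW w (h.le hw))) i) j)
    (h.pow_smul_mem hc j)

theorem smul_eigenSum (h : IsCyclicStep W W' g ℓ) (hζ : IsPrimitiveRoot ζ ℓ) (hℓ : ℓ ≠ 0)
    (hζW : ζ ∈ fixedSubfield A W) {c : A} (hc : c ∈ fixedSubfield A W') (i : ℕ) :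
    g • eigenSum g ζ ℓ i c = ζ ^ i * eigenSum g ζ ℓ i c := by
  have hζ0 : ζ ≠ 0 := hζ.ne_zero hℓ
  have hinv : g • ζ⁻¹ = ζ⁻¹ := by rw [smul_inv'', hζW g h.mem]
  have h1 := Finset.sum_range_succ (fun j => (ζ⁻¹ ^ i) ^ j * g ^ j • c) ℓ
  rw [Finset.sum_range_succ', pow_zero, pow_zero, one_smul, hc _ h.pow_mem, ← pow_mul,
    mul_comm i, pow_mul, hζ.inv.pow_eq_one, one_pow] at h1
  have h2 := add_right_cancel h1
  unfold eigenSum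
  conv_rhs => rw [← h2]
  rw [Finset.mul_sum, Finset.smul_sum]
  refine Finset.sum_congr rfl fun j _ => ?_
  rw [smul_mul', smul_pow', smul_pow', hinv, ← mul_smul, ← pow_succ', pow_succ (ζ⁻¹ ^ i) j]
  have h3 : ζ ^ i * ζ⁻¹ ^ i = 1 := by rw [← mul_pow, mul_inv_cancel₀ hζ0, one_pow]
  linear_combination -((ζ⁻¹ ^ i) ^ j * g ^ (j + 1) • c) * h3

theorem sum_eigenSum (hζ : IsPrimitiveRoot ζ ℓ) (hℓ : ℓ ≠ 0) (g : G) (c : A) :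
    ∑ i ∈ Finset.range ℓ, eigenSum g ζ ℓ i c = ℓ * c := by
  unfold eigenSum
  rw [Finset.sum_comm, Finset.sum_eq_single 0]
  · simp
  · intro j hj hj0
    rw [← Finset.sum_mul]
    have hne : ζ⁻¹ ^ j ≠ 1 := hζ.inv.pow_ne_one_of_pos_of_lt hj0 (Finset.mem_range.1 hj)
    have : ∑ i ∈ Finset.range ℓ, (ζ⁻¹ ^ i) ^ j = 0 := by
      have h1 := geom_sum_mul (ζ⁻¹ ^ j) ℓ
      rw [← pow_mul, mul_comm j, pow_mul, hζ.inv.pow_eq_one, one_pow, sub_self] at h1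
      have h2 := (mul_eq_zero.1 h1).resolve_right (sub_ne_zero.2 hne)
      rw [← h2]
      refine Finset.sum_congr rfl fun i _ => ?_
      rw [← pow_mul, ← pow_mul, mul_comm]
    rw [this, zero_mul]
  · intro h0
    simp at h0
    exact absurd h0 hℓ

variable (v : Valuation A ℝ≥0) (hv : ∀ (g : G) x, v (g • x) = v x)
include hv

theorem exists_sub_mul_pow_lt (h : IsCyclicStep W W' g ℓ) (hℓ : ℓ.Prime) (hℓv : v (ℓ : A) = 1)
    (hζ : IsPrimitiveRoot ζ ℓ) (hζW : ζ ∈ fixedSubfield A W) {ρ : A} (hρ0 : ρ ≠ 0)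
    (hρ : ρ ^ ℓ ∈ fixedSubfield A W) (hgρ : g • ρ = ζ * ρ) (hρW : ρ ∈ fixedSubfield A W')
    (hval : ∀ d ∈ fixedSubfield A W, d ≠ 0 → v d ≠ v ρ) {c : A} (hc : c ∈ fixedSubfield A W')
    (hc0 : c ≠ 0) :
    ∃ i < ℓ, ∃ b ∈ fixedSubfield A W, b ≠ 0 ∧ v (c - b * ρ ^ i) < v c := by
  have hℓ0 : (ℓ : A) ≠ 0 := by
    intro h0; rw [h0, map_zero] at hℓv; exact zero_ne_one hℓv
  have hζ0 : ζ ≠ 0 := hζ.ne_zero hℓ.ne_zero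
  have hζv : v ζ⁻¹ = 1 := by
    have : v ζ ^ ℓ = 1 := by rw [← map_pow, hζ.pow_eq_one, map_one]
    rw [map_inv₀, (pow_eq_one_iff_of_nonneg zero_le hℓ.ne_zero).1 this, inv_one]
  have hcv : 0 < v c := by rw [pos_iff_ne_zero, Ne, map_eq_zero]; exact hc0
  set b : ℕ → A := fun i => (ℓ : A)⁻¹ * eigenSum g ζ ℓ i c / ρ ^ i with hb
  have hbW : ∀ i, b i ∈ fixedSubfield A W := by
    intro i
    have hℓm : ∀ U : Subgroup G, (ℓ : A)⁻¹ ∈ fixedSubfield A U := fun U =>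
      inv_mem (natCast_mem _ ℓ)
    refine h.mem_of_smul_eq (div_mem (mul_mem (hℓm W') (eigenSum_mem_left h hζW hc i))
      (pow_mem hρW i)) ?_
    rw [hb]
    simp only
    rw [smul_div₀', smul_mul', hℓm W g h.mem, smul_eigenSum h hζ hℓ.ne_zero hζW hc, smul_pow',
      hgρ, mul_pow]
    field_simp
  have hbρ : ∀ i, b i * ρ ^ i = (ℓ : A)⁻¹ * eigenSum g ζ ℓ i c := fun i => by
    rw [hb]; exact div_mul_cancel₀ _ (pow_ne_zero i hρ0)
  have hsum : ∑ i ∈ Finset.range ℓ, b i * ρ ^ i = c := by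
    simp only [hbρ]
    rw [← Finset.mul_sum, sum_eigenSum hζ hℓ.ne_zero, inv_mul_cancel_left₀ hℓ0]
  have hle : ∀ i, v (b i * ρ ^ i) ≤ v c := by
    intro i
    rw [hbρ, map_mul, map_inv₀, hℓv, inv_one, one_mul]
    refine v.map_sum_le fun j _ => ?_
    rw [map_mul, map_pow, map_pow, hζv, one_pow, one_pow, one_mul, hv]
  obtain ⟨i, hi, hiv⟩ : ∃ i ∈ Finset.range ℓ, v c ≤ v (b i * ρ ^ i) := by
    by_contra! hcon
    have := v.map_sum_lt hcv.ne' hcon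
    rw [hsum] at this
    exact lt_irrefl _ this
  have hbi : b i ≠ 0 := by
    intro h0
    rw [h0, zero_mul, map_zero] at hiv
    exact absurd hcv (not_lt.2 hiv)
  refine ⟨i, Finset.mem_range.1 hi, b i, hbW i, hbi, ?_⟩
  have hsub : c - b i * ρ ^ i = ∑ j ∈ (Finset.range ℓ).erase i, b j * ρ ^ j := by
    rw [← hsum, ← Finset.add_sum_erase _ _ hi, add_sub_cancel_left]
  rw [hsub]
  refine v.map_sum_lt hcv.ne' fun j hj => lt_of_le_of_ne (hle j) fun heq => ?_
  obtain ⟨hji, hj⟩ := Finset.mem_erase.1 hj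
  have hbj : b j ≠ 0 := by
    intro h0
    rw [h0, zero_mul, map_zero] at heq
    exact hcv.ne heq
  have heq2 : v (b j * ρ ^ j) = v (b i * ρ ^ i) := heq.trans (le_antisymm hiv (hle i))
  have hρv : v ρ ≠ 0 := by rwa [Ne, map_eq_zero]
  have hbiv : v (b i) ≠ 0 := by rwa [Ne, map_eq_zero]
  have hbjv : v (b j) ≠ 0 := by rwa [Ne, map_eq_zero]
  have hd1 : v ρ ^ ((i : ℤ) - j) = v (b j / b i) := by
    rw [map_mul, map_mul, map_pow, map_pow] at heq2
    rw [zpow_sub₀ hρv, zpow_natCast, zpow_natCast, map_div₀]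
    field_simp
    rw [mul_comm, ← heq2, mul_comm]
  have hcop : IsCoprime ((i : ℤ) - j) (ℓ : ℤ) := by
    refine IsCoprime.symm ((Prime.coprime_iff_not_dvd (Nat.prime_iff_prime_int.1 hℓ)).2 ?_)
    rintro hdvd
    have h1 := Int.eq_zero_of_abs_lt_dvd hdvd (by
      have := Finset.mem_range.1 hi
      have := Finset.mem_range.1 hj
      rw [abs_lt]; omega)
    omega
  obtain ⟨m, n, hmn⟩ := hcop
  refine hval ((b j / b i) ^ m * (ρ ^ ℓ) ^ n)
    (mul_mem (zpow_mem (div_mem (hbW j) (hbW i)) m) (zpow_mem hρ n))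
    (mul_ne_zero (zpow_ne_zero _ (div_ne_zero hbj hbi)) (zpow_ne_zero _ (pow_ne_zero _ hρ0))) ?_
  rw [map_mul, map_zpow₀, map_zpow₀, ← hd1, map_pow, ← zpow_natCast, ← zpow_mul, ← zpow_mul,
    ← zpow_add₀ hρv, mul_comm _ m, mul_comm _ n, hmn, zpow_one]

end eigen

theorem map_natCast_le_one {A : Type*} [Field A] (v : Valuation A ℝ≥0) (n : ℕ) :
    v (n : A) ≤ 1 := by
  induction n with
  | zero => simp
  | succ n ih =>
    rw [Nat.cast_succ]
    exact v.map_add_le ih (by simp)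

theorem map_intCast_le_one {A : Type*} [Field A] (v : Valuation A ℝ≥0) (n : ℤ) :
    v (n : A) ≤ 1 := by
  obtain ⟨m, rfl | rfl⟩ := n.eq_nat_or_neg
  · simpa using map_natCast_le_one v _
  · simpa using map_natCast_le_one v _

theorem map_natCast_eq_one {A : Type*} [Field A] (v : Valuation A ℝ≥0) {p n : ℕ}
    (hp : v (p : A) < 1) (h : n.Coprime p) : v (n : A) = 1 := by
  refine le_antisymm (map_natCast_le_one v n) (not_lt.1 fun hlt => ?_)
  obtain ⟨a, b, hab⟩ := Nat.isCoprime_iff_coprime.2 h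
  have h1 : v ((a : A) * n + b * p) < 1 := by
    refine v.map_add_lt ?_ ?_ <;> rw [map_mul, mul_comm]
    · exact mul_lt_one_of_lt_of_le hlt (map_intCast_le_one v a)
    · exact mul_lt_one_of_lt_of_le hp (map_intCast_le_one v b)
  have h2 : (a : A) * n + b * p = 1 := by exact_mod_cast congrArg (Int.cast : ℤ → A) hab
  rw [h2, map_one] at h1
  exact lt_irrefl _ h1

theorem map_prod_sub_one_lt {A ι : Type*} [Field A] (v : Valuation A ℝ≥0) (s : Finset ι)
    (f : ι → A) (h : ∀ i ∈ s, v (f i - 1) < 1) : v (∏ i ∈ s, f i - 1) < 1 := by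
  refine Finset.prod_induction f (fun x => v (x - 1) < 1) (fun x y hx hy => ?_) (by simp) h
  have e : x * y - 1 = x * (y - 1) + (x - 1) := by ring
  rw [e]
  refine v.map_add_lt ?_ hx
  rwa [map_mul, map_eq_one_of_sub_one_lt v hx, one_mul]

section weak

variable {k A M : Type*} [Field k] [Field A] [Field M] [Algebra k A] [Algebra A M]
  [MulSemiringAction (A ≃ₐ[k] A) M] [IsAlgClosed A] [IsAlgClosed M]

theorem IsSmoothAction.exists_pow_mul_pow_eq_one_sub (hM : IsSmoothAction k A M)
    (v : Valuation A ℝ≥0) (hv : ∀ (g : A ≃ₐ[k] A) x, v (g x) = v x) (W : Subgroup (A ≃ₐ[k] A))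
    {ℓ : ℕ} (hℓ : ℓ.Prime) (hℓv : v (ℓ : A) = 1) {ζ : A} (hζ : IsPrimitiveRoot ζ ℓ)
    (hζW : ζ ∈ fixedSubfield A W) {ε : A} (hε : ε ∈ fixedSubfield A W) (hε1 : ε ^ ℓ = -1) {x : M}
    (hx : x ∈ fixedSubfield M W) (hx0 : x ≠ 0)
    (hxH : ∀ c ∈ fixedSubfield A W, v c = 1 → ∀ y ∈ fixedSubfield M W, y ≠ 0 →
      x ≠ algebraMap A M c * y ^ ℓ) :
    ∃ i < ℓ, ∃ y ∈ fixedSubfield M W, y ≠ 0 ∧ y ^ ℓ = (1 - x) / x ^ i := by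
  have hinj : Function.Injective (algebraMap A M) := (algebraMap A M).injective
  obtain ⟨a, haW, ha0, t, ht, ht0, rfl⟩ := hM.exists_eq_mul_pow W hℓ.ne_zero hx hx0
  obtain ⟨ρ, rfl⟩ := IsAlgClosed.exists_pow_nat_eq a hℓ.pos
  have hρ0 : ρ ≠ 0 := by rintro rfl; exact ha0 (zero_pow hℓ.ne_zero)
  have hval : ∀ d ∈ fixedSubfield A W, d ≠ 0 → v d ≠ v ρ := by
    intro d hd hd0 heq
    refine hxH (ρ ^ ℓ / d ^ ℓ) (div_mem haW (pow_mem hd ℓ)) ?_ (algebraMap A M d * t)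
      (mul_mem (hM.algebraMap_mem_iff.2 hd) ht) (mul_ne_zero (by simpa using hd0) ht0) ?_
    · rw [map_div₀, map_pow, map_pow, heq, div_self]
      exact pow_ne_zero _ (by rwa [Ne, map_eq_zero])
    · rw [mul_pow, ← mul_assoc, ← map_pow _ d, ← map_mul, div_mul_cancel₀ _ (pow_ne_zero _ hd0)]
  obtain ⟨W', g, ξ, hstep, hξ, hξW, hgρ, hρW'⟩ := exists_isCyclicStep_of_pow_mem W hℓ hζ hζW hρ0
    haW (fun h => hval ρ h hρ0 rfl)
  have hgn : ∀ j : ℕ, g ^ j • ρ = ξ ^ j * ρ := by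
    intro n
    induction n with
    | zero => simp
    | succ n ih =>
      rw [pow_succ', mul_smul, ih, smul_mul', smul_pow', hξW g hstep.mem, hgρ, pow_succ, mul_assoc]
  have htW' : t ∈ fixedSubfield M W' := fun w hw => ht w (hstep.le hw)
  set y : M := 1 - algebraMap A M ρ * t with hy
  have hyW' : y ∈ fixedSubfield M W' :=
    sub_mem (one_mem _) (mul_mem (hM.algebraMap_mem_iff.2 hρW') htW')
  have hprod : ∏ j ∈ Finset.range ℓ, g ^ j • y = 1 - algebraMap A M (ρ ^ ℓ) * t ^ ℓ := by
    have h1 := X_pow_sub_C_eq_prod (hξ.map_of_injective hinj) hℓ.pos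
      (α := algebraMap A M ρ * t) rfl
    have h2 := congrArg (Polynomial.eval 1) h1
    simp only [Polynomial.eval_sub, Polynomial.eval_pow, Polynomial.eval_X, one_pow,
      Polynomial.eval_C, Polynomial.eval_prod, mul_pow, ← map_pow] at h2
    rw [h2]
    refine Finset.prod_congr rfl fun j _ => ?_
    rw [hy, smul_sub, smul_one, smul_mul', hM.smul_algebraMap, ht _ (pow_mem hstep.mem j)]
    have := hgn j
    rw [AlgEquiv.smul_def] at this
    rw [this, map_mul, mul_assoc]
  have hy0 : y ≠ 0 := by
    intro h0
    have h1 : ∏ j ∈ Finset.range ℓ, g ^ j • y = 0 := by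
      refine Finset.prod_eq_zero (Finset.mem_range.2 hℓ.pos) ?_
      rw [h0, smul_zero]
    rw [hprod] at h1
    refine hxH 1 (one_mem _) (map_one v) 1 (one_mem _) one_ne_zero ?_
    rw [map_one, one_pow, one_mul]
    exact (sub_eq_zero.1 h1).symm
  obtain ⟨c, hc, hc0, z, hz, hz0, hcz⟩ := hM.exists_eq_mul_pow W' hℓ.ne_zero hyW' hy0
  obtain ⟨i, hi, b, hb, hb0, hlt⟩ := exists_sub_mul_pow_lt v hv hstep hℓ hℓv hξ hξW hρ0 haW hgρ
    hρW' hval hc hc0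
  set e : A := c / (b * ρ ^ i) with he
  have hbρ0 : b * ρ ^ i ≠ 0 := mul_ne_zero hb0 (pow_ne_zero _ hρ0)
  have hbρW' : b * ρ ^ i ∈ fixedSubfield A W' :=
    mul_mem (mem_fixedSubfield_iff.2 fun w hw => hb w (hstep.le hw)) (pow_mem hρW' i)
  have heW' : e ∈ fixedSubfield A W' := div_mem hc hbρW'
  have hvb : v (b * ρ ^ i) = v c := by
    have := v.map_sub_eq_of_lt_right (x := c - b * ρ ^ i) (y := c) hlt
    rwa [sub_sub_cancel_left, Valuation.map_neg] at this
  have he1 : v (e - 1) < 1 := by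
    have e1 : e - 1 = (c - b * ρ ^ i) / (b * ρ ^ i) := by rw [he]; field_simp
    rw [e1, map_div₀, hvb]
    exact (div_lt_one₀ (by rw [pos_iff_ne_zero, Ne, map_eq_zero]; exact hc0)).2 hlt
  obtain ⟨d, hd, hdℓ, hd1⟩ := exists_fixed_pow_eq v W (fun g _ x hx => by
    rw [AlgEquiv.smul_def, hv]; exact hx) hℓv (hstep.prod_mem heW')
    (map_prod_sub_one_lt v _ _ fun j _ => by
      have : g ^ j • e - 1 = g ^ j • (e - 1) := by rw [smul_sub, smul_one]
      rw [this, AlgEquiv.smul_def, hv]; exact he1)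
  have hd0 : d ≠ 0 := by
    rintro rfl
    rw [zero_sub, Valuation.map_neg, map_one] at hd1
    exact lt_irrefl _ hd1
  have hε0 : ε ≠ 0 := by
    rintro rfl
    rw [zero_pow hℓ.ne_zero] at hε1
    exact one_ne_zero (neg_eq_zero.1 hε1.symm)
  have hNρ : ∏ j ∈ Finset.range ℓ, g ^ j • ρ = (ε ^ (ℓ + 1)) ^ ℓ * ρ ^ ℓ := by
    have h1 := X_pow_sub_C_eq_prod hξ hℓ.pos (α := ρ) rfl
    have h2 := congrArg (Polynomial.eval 0) h1
    simp only [Polynomial.eval_sub, Polynomial.eval_pow, Polynomial.eval_X,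
      Polynomial.eval_C, Polynomial.eval_prod, zero_sub, zero_pow hℓ.ne_zero,
      Finset.prod_neg, Finset.card_range] at h2
    rw [← pow_mul, mul_comm _ ℓ, pow_mul, hε1, pow_succ, mul_assoc, neg_one_mul, h2, ← mul_assoc,
      ← mul_pow, neg_one_mul, neg_neg, one_pow, one_mul]
    exact Finset.prod_congr rfl fun j _ => hgn j
  have hNc : ∏ j ∈ Finset.range ℓ, g ^ j • c =
      (d * b * (ε ^ (ℓ + 1)) ^ i) ^ ℓ * (ρ ^ ℓ) ^ i := by
    have h1 : c = e * b * ρ ^ i := by rw [he]; field_simp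
    have h2 : ∀ j ∈ Finset.range ℓ, g ^ j • c = g ^ j • e * b * (g ^ j • ρ) ^ i := by
      intro j _
      conv_lhs => rw [h1]
      rw [smul_mul', smul_mul', smul_pow', hb _ (pow_mem hstep.mem j)]
    rw [Finset.prod_congr rfl h2, Finset.prod_mul_distrib, Finset.prod_mul_distrib, ← hdℓ,
      Finset.prod_pow, hNρ, Finset.prod_const, Finset.card_range]
    ring
  set N : M := ∏ j ∈ Finset.range ℓ, g ^ j • z with hN
  have hNW : N ∈ fixedSubfield M W := hstep.prod_mem hz
  have hN0 : N ≠ 0 := Finset.prod_ne_zero_iff.2 fun j _ => by rwa [Ne, smul_eq_zero_iff_eq]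
  have hfinal : 1 - algebraMap A M (ρ ^ ℓ) * t ^ ℓ =
      algebraMap A M ((d * b * (ε ^ (ℓ + 1)) ^ i) ^ ℓ * (ρ ^ ℓ) ^ i) * N ^ ℓ := by
    rw [← hprod, ← hNc, map_prod, hN, ← Finset.prod_pow, ← Finset.prod_mul_distrib]
    refine Finset.prod_congr rfl fun j _ => ?_
    rw [hcz, smul_mul', smul_pow', hM.smul_algebraMap, AlgEquiv.smul_def]
  refine ⟨i, hi, algebraMap A M (d * b * (ε ^ (ℓ + 1)) ^ i) * N / t ^ i, ?_, ?_, ?_⟩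
  · exact div_mem (mul_mem (hM.algebraMap_mem_iff.2
      (mul_mem (mul_mem hd hb) (pow_mem (pow_mem hε _) _))) hNW) (pow_mem ht i)
  · exact div_ne_zero (mul_ne_zero (by
      simpa using ⟨⟨hd0, hb0⟩, fun h => absurd h hε0⟩) hN0) (pow_ne_zero _ ht0)
  · have h1 : algebraMap A M (ρ ^ ℓ) ≠ 0 := (map_ne_zero _).2 ha0
    rw [hfinal]
    generalize d * b * (ε ^ (ℓ + 1)) ^ i = q
    rw [map_mul, map_pow, map_pow _ (ρ ^ ℓ)]
    generalize algebraMap A M (ρ ^ ℓ) = r at *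
    rw [div_pow, mul_pow, mul_pow]
    field_simp
    ring

end weak

/-! ### Valuation rings on the fixed fields and their limit -/

theorem IsRigidPair.map_mem_valuationSubring {L : Type*} [Field L] {T H : Set L}
    (h : IsRigidPair T H) (φ : L ≃+* L) (hT : ∀ x, φ x ∈ T ↔ x ∈ T) (hH : ∀ x, φ x ∈ H ↔ x ∈ H)
    {x : L} (hx : x ∈ h.valuationSubring) : φ x ∈ h.valuationSubring := by
  have hP : ∀ x, φ x ∈ rigidPart T H ↔ x ∈ rigidPart T H := fun x => by
    have h1 : 1 + φ x = φ (1 + x) := by rw [map_add, map_one]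
    simp only [rigidPart, Set.mem_ofPred_eq, h1, hT, hH, Ne, EmbeddingLike.map_eq_zero_iff]
  rw [h.mem_valuationSubring_iff] at hx ⊢
  rcases hx with rfl | hx | ⟨hx, hx'⟩
  · exact Or.inl (map_zero φ)
  · exact Or.inr (Or.inl ((hP x).2 hx))
  · refine Or.inr (Or.inr ⟨(hH x).2 hx, fun y hy => ?_⟩)
    obtain ⟨z, rfl⟩ := φ.surjective y
    rw [← map_mul, hP]
    exact hx' z ((hP z).1 hy)

section level

variable {k A M : Type*} [Field k] [Field A] [Field M] [Algebra k A] [Algebra A M]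
  [MulSemiringAction (A ≃ₐ[k] A) M]

/-- The inclusion of the fixed field in `A` into the fixed field in `M`. -/
def IsSmoothAction.fixedMap (hM : IsSmoothAction k A M) (W : Subgroup (A ≃ₐ[k] A)) :
    fixedSubfield A W →+* fixedSubfield M W :=
  ((algebraMap A M).comp (fixedSubfield A W).subtype).codRestrict (fixedSubfield M W)
    fun a => hM.algebraMap_mem_iff.2 a.2

/-- The restriction of a valuation of `A` to a fixed field. -/
noncomputable def fixedValuation (v : Valuation A ℝ≥0) (W : Subgroup (A ≃ₐ[k] A)) :
    Valuation (fixedSubfield A W) ℝ≥0 :=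
  v.comap (fixedSubfield A W).subtype

theorem IsSmoothAction.isTame [IsAlgClosed A] [IsAlgClosed M] (hM : IsSmoothAction k A M)
    (v : Valuation A ℝ≥0) (hv : ∀ (g : A ≃ₐ[k] A) x, v (g x) = v x) (W : Subgroup (A ≃ₐ[k] A))
    {ℓ : ℕ} (hℓ : ℓ.Prime) (hℓ23 : ℓ = 2 ∨ ℓ = 3)
    (hℓv : v (ℓ : A) = 1) {ζ : A} (hζ : IsPrimitiveRoot ζ ℓ)
    (hζW : ζ ∈ fixedSubfield A W) {ε : A} (hε : ε ∈ fixedSubfield A W) (hε1 : ε ^ ℓ = -1)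
    (hnet : HasFiniteNet (fixedValuation v W) 1) :
    IsTame (hM.fixedMap W) (fixedValuation v W) ℓ where
  hensel x hx := by
    obtain ⟨y, hy, hyx, -⟩ := exists_fixed_pow_eq v W (fun g _ x hx => by
      rw [AlgEquiv.smul_def, hv]; exact hx) hℓv x.2 hx
    exact ⟨⟨y, hy⟩, Subtype.ext hyx⟩
  descend c y hy := by
    have : NeZero ℓ := ⟨hℓ.ne_zero⟩
    have hy' : (y : M) ^ ℓ = algebraMap A M c := congrArg Subtype.val hy
    obtain ⟨d, hd⟩ := IsAlgClosed.exists_pow_nat_eq (c : A) hℓ.pos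
    by_cases hd0 : d = 0
    · refine ⟨0, ?_⟩
      rw [hd0, zero_pow hℓ.ne_zero] at hd
      rw [zero_pow hℓ.ne_zero]
      exact Subtype.ext hd
    have hd0' : algebraMap A M d ≠ 0 := (map_ne_zero _).2 hd0
    obtain ⟨i, -, hi⟩ := (hζ.map_of_injective (algebraMap A M).injective).eq_pow_of_pow_eq_one
      (ξ := (y : M) / algebraMap A M d) (by
        rw [div_pow, hy', ← hd, map_pow, div_self (pow_ne_zero _ hd0')])
    have hi' : algebraMap A M (ζ ^ i * d) = y := by
      rw [map_mul, map_pow, hi, div_mul_cancel₀ _ hd0']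
    refine ⟨⟨ζ ^ i * d, hM.algebraMap_mem_iff.1 (hi' ▸ y.2)⟩, Subtype.ext ?_⟩
    change (ζ ^ i * d) ^ ℓ = c
    rw [mul_pow, ← pow_mul, mul_comm i, pow_mul, hζ.pow_eq_one, one_pow, one_mul, hd]
  neg_one := ⟨⟨ε, hε⟩, Subtype.ext hε1⟩
  root := by
    refine ⟨⟨ζ, hζW⟩, Subtype.ext hζ.pow_eq_one, le_antisymm ?_ (not_lt.1 fun h => ?_)⟩
    · have hvζ : v ζ = 1 := by
        have := congrArg v hζ.pow_eq_one
        rw [map_pow, map_one] at this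
        exact (pow_eq_one_iff_of_nonneg zero_le hℓ.ne_zero).1 this
      exact v.map_sub_le hvζ.le (map_one v).le
    · exact hζ.ne_one hℓ.one_lt (eq_one_of_pow_eq_one v hℓv hζ.pow_eq_one h)
  net := hnet
  weak x hx0 hx := by
    obtain ⟨i, hi, y, hy, hy0, hyx⟩ := hM.exists_pow_mul_pow_eq_one_sub v hv W hℓ hℓv hζ hζW hε hε1
      x.2 (fun h => hx0 (Subtype.ext h)) fun c hc hvc y hy hy0 hxy =>
        hx ⟨⟨c, hc⟩, hvc, ⟨y, hy⟩, fun h => hy0 (congrArg Subtype.val h), Subtype.ext hxy⟩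
    exact ⟨i, hi, ⟨y, hy⟩, fun h => hy0 (congrArg Subtype.val h), Subtype.ext hyx⟩
  eq_two_or_three := hℓ23

/-- The valuation ring of the fixed field of `W` in `M` cut out by `ℓ`-th powers. -/
def IsSmoothAction.levelSet (hM : IsSmoothAction k A M) (v : Valuation A ℝ≥0) (ℓ : ℕ)
    (W : Subgroup (A ≃ₐ[k] A)) : Set M :=
  {x | ∃ (hx : x ∈ fixedSubfield M W) (h : IsTame (hM.fixedMap W) (fixedValuation v W) ℓ),
    (⟨x, hx⟩ : fixedSubfield M W) ∈ h.isRigidPair.valuationSubring}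

/-- The action of `g` on the fixed field of a normal subgroup. -/
def fixedEquiv (M : Type*) [Field M] {G : Type*} [Group G] [MulSemiringAction G M]
    (W : Subgroup G) [hW : W.Normal] (g : G) : fixedSubfield M W ≃+* fixedSubfield M W where
  toFun x := ⟨g • (x : M), fun w hw => by
    have := x.2 _ (hW.conj_mem' w hw g)
    rw [mul_smul, mul_smul] at this
    rw [← smul_left_cancel_iff (g⁻¹), this, inv_smul_smul]⟩
  invFun x := ⟨g⁻¹ • (x : M), fun w hw => by
    have := x.2 _ (hW.conj_mem w hw g)
    rw [mul_smul, mul_smul] at this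
    rw [← smul_left_cancel_iff g, this, smul_inv_smul]⟩
  left_inv x := Subtype.ext (inv_smul_smul g (x : M))
  right_inv x := Subtype.ext (smul_inv_smul g (x : M))
  map_mul' x y := Subtype.ext (smul_mul' g (x : M) y)
  map_add' x y := Subtype.ext (smul_add g (x : M) y)

theorem IsSmoothAction.smul_mem_levelSet (hM : IsSmoothAction k A M) {v : Valuation A ℝ≥0}
    (hv : ∀ (g : A ≃ₐ[k] A) x, v (g x) = v x) {ℓ : ℕ} {W : Subgroup (A ≃ₐ[k] A)} [W.Normal]
    {x : M} (hx : x ∈ hM.levelSet v ℓ W) (g : A ≃ₐ[k] A) : g • x ∈ hM.levelSet v ℓ W := by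
  obtain ⟨hxW, h, hx⟩ := hx
  have hT : ∀ (g : A ≃ₐ[k] A) (x : fixedSubfield M W), x ∈ powSet (fixedSubfield M W) ℓ →
      fixedEquiv M W g x ∈ powSet (fixedSubfield M W) ℓ := by
    rintro g _ ⟨y, hy, rfl⟩
    exact ⟨fixedEquiv M W g y, by simpa using hy, (map_pow _ _ _).symm⟩
  have hH : ∀ (g : A ≃ₐ[k] A) (x : fixedSubfield M W),
      x ∈ unitPowSet (hM.fixedMap W) (fixedValuation v W) ℓ →
      fixedEquiv M W g x ∈ unitPowSet (hM.fixedMap W) (fixedValuation v W) ℓ := by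
    rintro g _ ⟨c, hc, y, hy, rfl⟩
    refine ⟨fixedEquiv A W g c, (hv g c).trans hc, fixedEquiv M W g y, by simpa using hy, ?_⟩
    rw [map_mul, map_pow]
    exact congrArg (· * _) (Subtype.ext (hM.smul_algebraMap g c))
  have hinv : ∀ x : fixedSubfield M W, fixedEquiv M W g⁻¹ (fixedEquiv M W g x) = x := fun x =>
    Subtype.ext (inv_smul_smul g (x : M))
  exact ⟨_, h, h.isRigidPair.map_mem_valuationSubring (fixedEquiv M W g)
    (fun x => ⟨fun hx => hinv x ▸ hT g⁻¹ _ hx, hT g x⟩)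
    (fun x => ⟨fun hx => hinv x ▸ hH g⁻¹ _ hx, hH g x⟩) hx⟩

variable {p : ℕ} {v : Valuation A ℝ≥0}

theorem IsLocalNorm.hasFiniteNet [IsGalois k A] (hv : IsLocalNorm p k A v)
    (E : IntermediateField k A) [FiniteDimensional k E] :
    HasFiniteNet (fixedValuation v E.fixingSubgroup) (v (p : A)) := by
  have hE : ∀ x, x ∈ fixedSubfield A E.fixingSubgroup ↔ x ∈ E := by
    intro x
    conv_rhs => rw [← InfiniteGalois.fixedField_fixingSubgroup E]
    rw [IntermediateField.mem_fixedField_iff]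
    rfl
  obtain ⟨S, hS, hSE, hnet⟩ := hv.exists_finite_net E inferInstance
  refine ⟨Subtype.val ⁻¹' S, hS.preimage Subtype.val_injective.injOn, fun x hx => ?_⟩
  obtain ⟨s, hs, hlt⟩ := hnet x ((hE _).1 x.2) hx
  exact ⟨⟨s, (hE s).2 (hSE hs)⟩, hs, hlt⟩

theorem IsSmoothAction.exists_valuationSubring [CharZero A] [IsAlgClosed A] [IsAlgClosed M]
    [IsGalois k A] (hM : IsSmoothAction k A M) (hv : IsLocalNorm p k A v) (hp : p.Prime) :
    ∃ O : ValuationSubring M, (∀ (g : A ≃ₐ[k] A), ∀ x ∈ O, g • x ∈ O) ∧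
      (∀ a : A, v a ≤ 1 → algebraMap A M a ∈ O) ∧ algebraMap A M (p : A)⁻¹ ∉ O := by
  obtain ⟨ℓ, hℓ, hℓ23, hℓp⟩ : ∃ ℓ : ℕ, ℓ.Prime ∧ (ℓ = 2 ∨ ℓ = 3) ∧ ℓ.Coprime p := by
    by_cases h2 : p = 2
    · exact ⟨3, Nat.prime_three, Or.inr rfl, by rw [h2]; norm_num⟩
    · exact ⟨2, Nat.prime_two, Or.inl rfl, (Nat.coprime_primes Nat.prime_two hp).2 (Ne.symm h2)⟩
  have hℓv := map_natCast_eq_one v hv.map_prime_lt_one hℓp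
  have : NeZero (ℓ : A) := ⟨Nat.cast_ne_zero.2 hℓ.ne_zero⟩
  obtain ⟨ζ, hζ⟩ := HasEnoughRootsOfUnity.exists_primitiveRoot A ℓ
  obtain ⟨ε, hε⟩ := IsAlgClosed.exists_pow_nat_eq (-1 : A) hℓ.pos
  set Φ : Ultrafilter (FiniteGaloisIntermediateField k A) := Ultrafilter.of Filter.atTop with hΦ
  have hΦle : (Φ : Filter (FiniteGaloisIntermediateField k A)) ≤ Filter.atTop :=
    Ultrafilter.of_le _
  have hfix : ∀ a : A, ∀ᶠ E in (Φ : Filter (FiniteGaloisIntermediateField k A)),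
      a ∈ fixedSubfield A E.fixingSubgroup := by
    intro a
    refine hΦle ?_
    filter_upwards [Filter.eventually_ge_atTop (FiniteGaloisIntermediateField.adjoin k {a})]
      with E hE g hg
    exact hg ⟨a, FiniteGaloisIntermediateField.adjoin_simple_le_iff.1 hE⟩
  have hfixM : ∀ x : M, ∀ᶠ E in (Φ : Filter (FiniteGaloisIntermediateField k A)),
      x ∈ fixedSubfield M E.fixingSubgroup := by
    intro x
    obtain ⟨E₀, hE₀, hfix⟩ := hM.exists_fixing x
    let E₁ : FiniteGaloisIntermediateField k A :=
      { IntermediateField.normalClosure k E₀ A with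
        finiteDimensional := normalClosure.is_finiteDimensional k E₀ A
        isGalois := IsGalois.normalClosure k E₀ A }
    refine hΦle ?_
    filter_upwards [Filter.eventually_ge_atTop E₁] with E hE g hg
    exact hfix g (IntermediateField.fixingSubgroup_le (E₀.le_normalClosure.trans hE) hg)
  have htame : ∀ᶠ E in (Φ : Filter (FiniteGaloisIntermediateField k A)),
      IsTame (hM.fixedMap E.fixingSubgroup) (fixedValuation v E.fixingSubgroup) ℓ := by
    filter_upwards [hfix ζ, hfix ε] with E hζE hεE
    exact hM.isTame v hv.map_equiv _ hℓ hℓ23 hℓv hζ hζE hεE hε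
      ((hv.hasFiniteNet E.toIntermediateField).mono hv.map_prime_lt_one.le)
  let O : ValuationSubring M :=
    { carrier := {x | ∀ᶠ E in (Φ : Filter (FiniteGaloisIntermediateField k A)),
        x ∈ hM.levelSet v ℓ E.fixingSubgroup}
      mul_mem' := fun {x y} hx hy => by
        filter_upwards [hx, hy] with E ⟨h1, h, h2⟩ ⟨h3, _, h4⟩
        exact ⟨mul_mem h1 h3, h, mul_mem h2 h4⟩
      one_mem' := by
        filter_upwards [htame] with E h
        exact ⟨one_mem _, h, one_mem h.isRigidPair.valuationSubring⟩
      add_mem' := fun {x y} hx hy => by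
        filter_upwards [hx, hy] with E ⟨h1, h, h2⟩ ⟨h3, _, h4⟩
        exact ⟨add_mem h1 h3, h, add_mem h2 h4⟩
      zero_mem' := by
        filter_upwards [htame] with E h
        exact ⟨zero_mem _, h, zero_mem h.isRigidPair.valuationSubring⟩
      neg_mem' := fun {x} hx => by
        filter_upwards [hx] with E ⟨h1, h, h2⟩
        exact ⟨neg_mem h1, h, neg_mem h2⟩
      mem_or_inv_mem' := fun x => by
        refine Ultrafilter.eventually_or.1 ?_
        filter_upwards [htame, hfixM x] with E h hx
        rcases h.isRigidPair.valuationSubring.mem_or_inv_mem ⟨x, hx⟩ with h1 | h1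
        · exact Or.inl ⟨hx, h, h1⟩
        · exact Or.inr ⟨inv_mem hx, h, h1⟩ }
  have hO : ∀ x, x ∈ O ↔ ∀ᶠ E in (Φ : Filter (FiniteGaloisIntermediateField k A)),
      x ∈ hM.levelSet v ℓ E.fixingSubgroup := fun x => Iff.rfl
  have hpfix : ∀ W : Subgroup (A ≃ₐ[k] A), (p : A) ∈ fixedSubfield A W := fun W => natCast_mem _ _
  have hp0 : (p : A) ≠ 0 := Nat.cast_ne_zero.2 hp.ne_zero
  refine ⟨O, fun g x hx => ?_, fun a ha => ?_, fun h => ?_⟩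
  · rw [hO] at hx ⊢
    filter_upwards [hx] with E hE
    exact hM.smul_mem_levelSet hv.map_equiv hE g
  · rw [hO]
    filter_upwards [htame, hfix a] with E h hE
    exact ⟨hM.algebraMap_mem_iff.2 hE, h, h.map_mem_valuationSubring (x := ⟨a, hE⟩) ha
      (a := ⟨p, hpfix _⟩) (fun h0 => hp0 (congrArg Subtype.val h0)) hv.map_prime_lt_one
      (hv.hasFiniteNet E.toIntermediateField)⟩
  · rw [hO] at h
    obtain ⟨E, hE, h, h1⟩ := h.exists
    exact h.map_inv_notMem_valuationSubring (a := ⟨p, hpfix _⟩)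
      (fun h0 => hp0 (congrArg Subtype.val h0)) hv.map_prime_lt_one
      (hv.hasFiniteNet E.toIntermediateField) h1

end level

/-! ### Artin-Schreier extensions in mixed characteristic -/

section residueChar

variable {M : Type*} [Field M] {Γ : Type*} [LinearOrderedCommGroupWithZero Γ]
  (V : Valuation M Γ) {p : ℕ}

theorem exists_add_pow_eq (hp : p.Prime) {x y : M} (hx : V x ≤ 1) (hy : V y ≤ 1) :
    ∃ r, V r ≤ 1 ∧ (x + y) ^ p = x ^ p + y ^ p + p * x * y * r := by
  obtain ⟨r, hr⟩ := exists_add_pow_prime_eq (R := V.valuationSubring) hp ⟨x, hx⟩ ⟨y, hy⟩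
  exact ⟨r, r.2, by simpa using congrArg Subtype.val hr⟩

theorem eq_of_pow_sub_eq (hp : p.Prime) (hVp : V (p : M) < 1) {x y : M} (hy : V y ≤ 1)
    (hxy : V (x - y) < 1) (h : x ^ p - x = y ^ p - y) : x = y := by
  obtain ⟨r, hr, he⟩ := exists_add_pow_eq V hp hy hxy.le
  rw [add_sub_cancel] at he
  by_contra hne
  have h0 : x - y ≠ 0 := sub_ne_zero.2 hne
  have h1 : (x - y) * ((x - y) ^ (p - 1) + p * (y * r)) = (x - y) * 1 := by
    have : (x - y) ^ p = (x - y) * (x - y) ^ (p - 1) := by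
      rw [← pow_succ', Nat.sub_add_cancel hp.one_le]
    rw [mul_add, ← this]
    linear_combination h - he
  have h2 := mul_left_cancel₀ h0 h1
  have h3 : V ((x - y) ^ (p - 1) + p * (y * r)) < 1 := by
    refine V.map_add_lt ?_ ?_
    · rw [map_pow]
      exact pow_lt_one₀ zero_le hxy (Nat.sub_ne_zero_of_lt hp.one_lt)
    · rw [map_mul, map_mul]
      exact mul_lt_one_of_lt_of_le hVp (mul_le_one' hy hr)
  rw [h2, map_one] at h3
  exact lt_irrefl _ h3

theorem exists_int_sub_lt (hp : p.Prime) (hVp : V (p : M) < 1) {x : M} (hx : V x ≤ 1)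
    (h : V (x ^ p - x) < 1) : ∃ n : ℤ, V (x - n) < 1 := by
  have : Fact p.Prime := ⟨hp⟩
  have hr : ∀ x : V.valuationSubring, IsLocalRing.residue V.valuationSubring x = 0 ↔ V x < 1 :=
    fun x => by rw [IsLocalRing.residue_eq_zero_iff, Valuation.mem_maximalIdeal_iff]
  have hchar : CharP (IsLocalRing.ResidueField V.valuationSubring) p := by
    rw [CharP.charP_iff_prime_eq_zero hp, ← map_natCast (IsLocalRing.residue V.valuationSubring),
      hr]
    exact hVp
  have h1 : (IsLocalRing.residue V.valuationSubring ⟨x, hx⟩) ^ p =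
      IsLocalRing.residue V.valuationSubring ⟨x, hx⟩ := by
    rw [← sub_eq_zero, ← map_pow, ← map_sub, hr]
    exact h
  rw [← Subfield.mem_bot_iff_pow_eq_self, mem_bot_iff_intCast p] at h1
  obtain ⟨n, hn⟩ := h1
  refine ⟨n, ?_⟩
  rw [← sub_eq_zero, ← map_intCast (IsLocalRing.residue V.valuationSubring), ← map_sub, hr,
    AddSubgroupClass.coe_sub, V.map_sub_swap] at hn
  simpa using hn

theorem intCast_dvd_of_map_lt_one (hp : p.Prime) {v : Valuation M ℝ≥0} (hVp : v (p : M) < 1)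
    {n : ℤ} (hn : v (n : M) < 1) : (n : ZMod p) = 0 := by
  rw [ZMod.intCast_zmod_eq_zero_iff_dvd]
  by_contra hdvd
  obtain ⟨m, rfl | rfl⟩ := n.eq_nat_or_neg
  · have := map_natCast_eq_one v hVp (n := m)
      ((Nat.Prime.coprime_iff_not_dvd hp).2 (by exact_mod_cast hdvd)).symm
    exact hn.ne (by exact_mod_cast this)
  · have := map_natCast_eq_one v hVp (n := m)
      ((Nat.Prime.coprime_iff_not_dvd hp).2 (by rw [dvd_neg] at hdvd; exact_mod_cast hdvd)).symm
    refine hn.ne ?_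
    rw [Int.cast_neg, Valuation.map_neg]
    exact_mod_cast this

end residueChar

theorem isCyclicStep_ker {G : Type*} [Group G] {p : ℕ} (hp : p.Prime)
    (χ : G →* Multiplicative (ZMod p)) {g : G} (hg : χ g ≠ 1) :
    IsCyclicStep ⊤ χ.ker g p where
  le := le_top
  mem := Subgroup.mem_top g
  pow_mem := by
    rw [MonoidHom.mem_ker, map_pow, ← toAdd_eq_zero, toAdd_pow, nsmul_eq_mul, ZMod.natCast_self,
      zero_mul]
  conj_mem h hh := by
    rw [MonoidHom.mem_ker] at hh ⊢
    rw [map_mul, map_mul, hh, mul_one, map_inv, inv_mul_cancel]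
  exists_pow h _ := by
    have : Fact p.Prime := ⟨hp⟩
    have hg' : (χ g).toAdd ≠ 0 := hg
    refine ⟨((χ h).toAdd / (χ g).toAdd).val, ?_⟩
    rw [MonoidHom.mem_ker, map_mul, map_inv, map_pow, inv_mul_eq_one, ← Multiplicative.toAdd.injective.eq_iff, toAdd_pow,
      nsmul_eq_mul, ZMod.natCast_zmod_val, div_mul_cancel₀ _ hg']

section artinSchreier

variable {k A : Type*} [Field k] [Field A] [Algebra k A] {p : ℕ} {v : Valuation A ℝ≥0}

theorem IsLocalNorm.hasFiniteNet_base (hv : IsLocalNorm p k A v) :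
    HasFiniteNet (v.comap (algebraMap k A)) (v.comap (algebraMap k A) (p : k)) := by
  obtain ⟨S, hS, hSE, hnet⟩ := hv.exists_finite_net ⊥ inferInstance
  refine ⟨algebraMap k A ⁻¹' S, hS.preimage (algebraMap k A).injective.injOn, fun x hx => ?_⟩
  obtain ⟨s, hs, hlt⟩ := hnet (algebraMap k A x) ⟨x, rfl⟩ hx
  obtain ⟨t, rfl⟩ := hSE hs
  refine ⟨t, hs, ?_⟩
  rw [Valuation.comap_apply, Valuation.comap_apply, map_sub, map_natCast]
  exact hlt

theorem IsLocalNorm.exists_forall_one_le (hv : IsLocalNorm p k A v) (hp : p.Prime) :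
    ∃ a : k, v (algebraMap k A a) = 1 ∧
      ∀ c : k, v (algebraMap k A c) ≤ 1 → 1 ≤ v (algebraMap k A (c ^ p - c - a)) := by
  have hpw : v.comap (algebraMap k A) (p : k) ≤ 1 := by
    rw [Valuation.comap_apply, map_natCast]; exact hv.map_prime_lt_one.le
  obtain ⟨F, _, _, r, hr, hr0⟩ := (hv.hasFiniteNet_base.mono hpw).exists_residue
  have hns : ¬ Function.Surjective fun x : F => x ^ p - x := by
    rw [← Finite.injective_iff_surjective]
    intro hinj
    exact one_ne_zero (hinj (a₁ := (1 : F)) (a₂ := 0) (by simp [hp.ne_zero]))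
  obtain ⟨b, hb⟩ := not_forall.1 hns
  obtain ⟨a, rfl⟩ := hr b
  refine ⟨a, le_antisymm a.2 (not_lt.1 fun h => hb ⟨0, ?_⟩), fun c hc => not_lt.1 fun h => hb
    ⟨r ⟨c, hc⟩, ?_⟩⟩
  · rw [(hr0 a).2 h]; simp [hp.ne_zero]
  · simp only
    rw [← map_pow, ← map_sub, ← sub_eq_zero, ← map_sub, hr0]
    exact h

theorem IsLocalNorm.exists_artinSchreier [IsAlgClosed A] [IsGalois k A]
    (hv : IsLocalNorm p k A v) (hp : p.Prime) :
    ∃ (a : k) (θ : A) (W : Subgroup (A ≃ₐ[k] A)) (g : A ≃ₐ[k] A),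
      v (algebraMap k A a) = 1 ∧ θ ^ p - θ = algebraMap k A a ∧ v θ = 1 ∧ IsCyclicStep ⊤ W g p ∧
      θ ∈ fixedSubfield A W ∧
      ∀ i < p, ∀ j < p, i ≠ j → v ((g ^ i) θ - (g ^ j) θ) = 1 := by
  obtain ⟨a, ha, hane⟩ := hv.exists_forall_one_le hp
  have hvp := hv.map_prime_lt_one
  have : Fact p.Prime := ⟨hp⟩
  have hdeg : (Polynomial.X ^ p - Polynomial.X - Polynomial.C (algebraMap k A a)).degree ≠ 0 := by
    rw [sub_sub, Polynomial.degree_sub_eq_left_of_degree_lt]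
    · rw [Polynomial.degree_X_pow]; exact_mod_cast hp.ne_zero
    · rw [Polynomial.degree_X_add_C, Polynomial.degree_X_pow]
      exact_mod_cast hp.one_lt
  obtain ⟨θ, hθ⟩ := IsAlgClosed.exists_root _ hdeg
  have hθ : θ ^ p - θ = algebraMap k A a := by simpa [sub_eq_zero] using hθ
  have hvθ : v θ = 1 := by
    refine le_antisymm (not_lt.1 fun h => ?_) (not_lt.1 fun h => ?_)
    · have h1 : v θ < v (θ ^ p) := by
        rw [map_pow]
        exact lt_self_pow₀ h hp.one_lt
      have h2 := v.map_sub_eq_of_lt_right h1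
      rw [v.map_sub_swap, hθ, ha] at h2
      rw [← h2] at h1
      exact lt_asymm h h1
    · have h1 : v (θ ^ p - θ) < 1 := v.map_sub_lt (by
        rw [map_pow]; exact pow_lt_one₀ zero_le h hp.ne_zero) h
      rw [hθ, ha] at h1
      exact lt_irrefl _ h1
  have hvg : ∀ g : A ≃ₐ[k] A, v (g θ) = 1 := fun g => by rw [hv.map_equiv, hvθ]
  have hθg : ∀ g : A ≃ₐ[k] A, (g θ) ^ p - g θ = θ ^ p - θ := fun g => by
    rw [← map_pow, ← map_sub, hθ, AlgEquiv.commutes]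
  have hd : ∀ g : A ≃ₐ[k] A, ∃ n : ℤ, v (g θ - θ - n) < 1 := by
    intro g
    have h1 : v (g θ - θ) ≤ 1 := v.map_sub_le (hvg g).le hvθ.le
    refine exists_int_sub_lt v hp hvp h1 ?_
    obtain ⟨r, hr, he⟩ := exists_add_pow_eq v hp hvθ.le h1
    rw [add_sub_cancel] at he
    have e : (g θ - θ) ^ p - (g θ - θ) = -(p * (θ * (g θ - θ) * r)) := by
      linear_combination hθg g - he
    rw [e, Valuation.map_neg, map_mul, map_mul, map_mul, hvθ, one_mul]
    exact mul_lt_one_of_lt_of_le hvp (mul_le_one' h1 hr)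
  choose d hd using hd
  have huniq : ∀ (x : A) (m n : ℤ), v (x - m) < 1 → v (x - n) < 1 → (m : ZMod p) = n := by
    intro x m n hm hn
    rw [← sub_eq_zero, ← Int.cast_sub]
    refine intCast_dvd_of_map_lt_one hp hvp (M := A) ?_
    have e : ((m - n : ℤ) : A) = (x - n) - (x - m) := by push_cast; ring
    rw [e]
    exact v.map_sub_lt hn hm
  let χ : (A ≃ₐ[k] A) →* Multiplicative (ZMod p) :=
    { toFun := fun g => Multiplicative.ofAdd (d g : ZMod p)
      map_one' := by
        rw [← ofAdd_zero]
        refine congrArg _ ?_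
        have := huniq 0 (d 1) 0 (by simpa using hd 1) (by simp)
        simpa using this
      map_mul' := fun g h => by
        rw [← ofAdd_add, ← Int.cast_add]
        refine congrArg _ (huniq _ _ _ (hd (g * h)) ?_)
        have e : (g * h) θ - θ - ((d g + d h : ℤ) : A) = g (h θ - θ - d h) + (g θ - θ - d g) := by
          rw [map_sub, map_sub, map_intCast, AlgEquiv.mul_apply]
          push_cast; ring
        rw [e]
        exact v.map_add_lt (by rw [hv.map_equiv]; exact hd h) (hd g) }
  have hχ : ∀ g, χ g = Multiplicative.ofAdd (d g : ZMod p) := fun g => rfl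
  have hχ1 : ∀ g, χ g = 1 ↔ v (g θ - θ) < 1 := by
    intro g
    rw [hχ, ← ofAdd_zero, Multiplicative.ofAdd.injective.eq_iff]
    constructor
    · intro h
      rw [ZMod.intCast_zmod_eq_zero_iff_dvd] at h
      obtain ⟨m, hm⟩ := h
      have e : g θ - θ = (g θ - θ - d g) + p * (m : A) := by rw [hm]; push_cast; ring
      rw [e]
      refine v.map_add_lt (hd g) ?_
      rw [map_mul]
      exact mul_lt_one_of_lt_of_le hvp (map_intCast_le_one v m)
    · intro h
      have := huniq _ (d g) 0 (hd g) (by simpa using h)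
      simpa using this
  have hker : ∀ g, χ g = 1 → g θ = θ := fun g hg =>
    eq_of_pow_sub_eq v hp hvp hvθ.le ((hχ1 g).1 hg) (hθg g)
  obtain ⟨g, hg⟩ : ∃ g, χ g ≠ 1 := by
    by_contra! h
    obtain ⟨c, rfl⟩ := (InfiniteGalois.mem_range_algebraMap_iff_fixed (k := k) θ).2
      fun g => hker g (h g)
    have := hane c hvθ.le
    have h0 : algebraMap k A (c ^ p - c - a) = 0 := by
      rw [map_sub, ← hθ, map_sub, map_pow, sub_self]
    rw [h0, map_zero] at this
    exact not_lt.2 this one_pos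
  refine ⟨a, θ, χ.ker, g, ha, hθ, hvθ, isCyclicStep_ker hp χ hg, fun h hh => hker h hh, ?_⟩
  have key : ∀ i j : ℕ, i < j → j < p → v ((g ^ i) θ - (g ^ j) θ) = 1 := by
    intro i j hij hj
    have e : (g ^ i) θ - (g ^ j) θ = (g ^ i) (θ - (g ^ (j - i)) θ) := by
      rw [map_sub, ← AlgEquiv.mul_apply, ← pow_add, Nat.add_sub_cancel' hij.le]
    rw [e, hv.map_equiv, v.map_sub_swap]
    refine le_antisymm (v.map_sub_le (hvg _).le hvθ.le) (not_lt.1 fun h => ?_)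
    rw [← hχ1, map_pow, ← toAdd_eq_zero, toAdd_pow, nsmul_eq_mul, mul_eq_zero,
      ZMod.natCast_eq_zero_iff] at h
    rcases h with h | h
    · exact absurd (Nat.le_of_dvd (Nat.sub_pos_of_lt hij) h) (by omega)
    · exact hg h
  intro i hi j hj hij
  rcases lt_or_gt_of_ne hij with h | h
  · exact key i j h hj
  · rw [v.map_sub_swap]; exact key j i h hi

end artinSchreier

/-! ### The residual part of the valuation ring -/

section unramified

variable {k A : Type*} [Field k] [Field A] [Algebra k A] {p : ℕ} {v : Valuation A ℝ≥0}

theorem prod_sub_eq_pow_sub {M : Type*} [Field M] (hp : p.Prime) {b : ℕ → M} {a : M}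
    (hb : Set.InjOn b (Finset.range p)) (h : ∀ j ∈ Finset.range p, b j ^ p - b j = a) (x : M) :
    ∏ j ∈ Finset.range p, (x - b j) = x ^ p - x - a := by
  have hmonic : (Polynomial.X ^ p - Polynomial.X - Polynomial.C a).Monic ∧
      (Polynomial.X ^ p - Polynomial.X - Polynomial.C a).degree = (p : WithBot ℕ) := by
    have hlt : (-(Polynomial.X + Polynomial.C a)).degree < (p : WithBot ℕ) := by
      rw [Polynomial.degree_neg, Polynomial.degree_X_add_C]
      exact_mod_cast hp.one_lt
    rw [sub_sub, sub_eq_add_neg]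
    refine ⟨Polynomial.monic_X_pow_add hlt, ?_⟩
    rw [Polynomial.degree_add_eq_left_of_degree_lt] <;> rw [Polynomial.degree_X_pow]
    exact hlt
  have hprod := Polynomial.monic_prod_X_sub_C b (Finset.range p)
  have hdeg : (∏ j ∈ Finset.range p, (Polynomial.X - Polynomial.C (b j))).degree = (p : WithBot ℕ) := by
    simp [Polynomial.degree_prod]
  have := Polynomial.eq_of_degree_le_of_eval_index_eq (Finset.range p) hb
    (f := ∏ j ∈ Finset.range p, (Polynomial.X - Polynomial.C (b j)))
    (g := Polynomial.X ^ p - Polynomial.X - Polynomial.C a)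
    (by rw [hdeg, Finset.card_range]) (by rw [hdeg, hmonic.2])
    (by rw [hprod.leadingCoeff, hmonic.1.leadingCoeff]) (fun j hj => by
      rw [Polynomial.eval_prod, Finset.prod_eq_zero hj (by simp)]
      simp [h j hj])
  simpa [Polynomial.eval_prod] using congrArg (Polynomial.eval x) this

theorem mem_fixedSubfield_top_iff [IsGalois k A] {a : A} :
    a ∈ fixedSubfield A (⊤ : Subgroup (A ≃ₐ[k] A)) ↔ ∃ c : k, algebraMap k A c = a := by
  rw [← Set.mem_range, InfiniteGalois.mem_range_algebraMap_iff_fixed, mem_fixedSubfield_iff]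
  exact ⟨fun h g => h g (Subgroup.mem_top g), fun h g _ => h g⟩

theorem exists_map_algebraMap_eq [IsGalois k A] (hv : ∀ (g : A ≃ₐ[k] A) x, v (g x) = v x)
    (hp : p.Prime) {W : Subgroup (A ≃ₐ[k] A)} {g : A ≃ₐ[k] A} (hW : IsCyclicStep ⊤ W g p) {θ : A}
    (hvθ : v θ = 1) (hθW : θ ∈ fixedSubfield A W)
    (hθ : ∀ i < p, ∀ j < p, i ≠ j → v ((g ^ i) θ - (g ^ j) θ) = 1)
    {c : A} (hc : c ∈ fixedSubfield A W) (hc0 : c ≠ 0) :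
    ∃ b : k, b ≠ 0 ∧ v (algebraMap k A b) = v c := by
  by_contra! hne
  have htr : ∀ m : ℕ, v (∑ j ∈ Finset.range p, (g ^ j) c * (g ^ j) θ ^ m) < v c := by
    intro m
    have h1 : ∑ j ∈ Finset.range p, (g ^ j) c * (g ^ j) θ ^ m =
        ∑ j ∈ Finset.range p, g ^ j • (c * θ ^ m) := by
      refine Finset.sum_congr rfl fun j _ => ?_
      rw [AlgEquiv.smul_def, map_mul, map_pow]
    obtain ⟨b, hb⟩ := mem_fixedSubfield_top_iff.1 (hW.sum_mem (mul_mem hc (pow_mem hθW m)))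
    have hle : v (∑ j ∈ Finset.range p, (g ^ j) c * (g ^ j) θ ^ m) ≤ v c := by
      refine v.map_sum_le fun j _ => ?_
      rw [map_mul, map_pow, hv, hv, hvθ, one_pow, mul_one]
    refine lt_of_le_of_ne hle fun heq => ?_
    rw [h1, ← hb] at heq
    refine hne b ?_ heq
    rintro rfl
    rw [map_zero, map_zero] at heq
    exact hc0 ((Valuation.zero_iff v).1 heq.symm)
  have key : ∀ (S : Finset ℕ) (m : ℕ), v (∑ j ∈ Finset.range p, (g ^ j) c *
      ((g ^ j) θ ^ m * ∏ i ∈ S, ((g ^ j) θ - (g ^ i) θ))) < v c := by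
    intro S
    induction S using Finset.induction_on with
    | empty => simpa using htr
    | insert i S hi ih =>
      intro m
      have e : ∑ j ∈ Finset.range p, (g ^ j) c *
          ((g ^ j) θ ^ m * ∏ i ∈ insert i S, ((g ^ j) θ - (g ^ i) θ)) =
          ∑ j ∈ Finset.range p, (g ^ j) c *
            ((g ^ j) θ ^ (m + 1) * ∏ i ∈ S, ((g ^ j) θ - (g ^ i) θ)) -
          (g ^ i) θ * ∑ j ∈ Finset.range p, (g ^ j) c *
            ((g ^ j) θ ^ m * ∏ i ∈ S, ((g ^ j) θ - (g ^ i) θ)) := by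
        rw [Finset.mul_sum, ← Finset.sum_sub_distrib]
        refine Finset.sum_congr rfl fun j _ => ?_
        rw [Finset.prod_insert hi]
        ring
      rw [e]
      refine v.map_sub_lt (ih (m + 1)) ?_
      rw [map_mul, hv, hvθ, one_mul]
      exact ih m
  have h1 := key ((Finset.range p).erase 0) 0
  rw [Finset.sum_eq_single_of_mem 0 (Finset.mem_range.2 hp.pos)] at h1
  · have h2 : ∀ i ∈ (Finset.range p).erase 0, v ((g ^ 0) θ - (g ^ i) θ) = 1 := fun i hi =>
      hθ 0 hp.pos i (Finset.mem_range.1 (Finset.mem_of_mem_erase hi)) (Finset.ne_of_mem_erase hi).symm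
    rw [map_mul, map_mul, map_prod, Finset.prod_congr rfl h2, Finset.prod_const_one, hv, mul_one,
      pow_zero, map_one, mul_one] at h1
    exact lt_irrefl _ h1
  · intro j hj hj0
    rw [Finset.prod_eq_zero (Finset.mem_erase.2 ⟨hj0, hj⟩) (sub_self _), mul_zero, mul_zero]

theorem IsLocalNorm.exists_pow_sub_lt (hv : IsLocalNorm p k A v) (hp : p.Prime) {c : k}
    (hc : v (algebraMap k A c) = 1) :
    ∃ d : k, v (algebraMap k A d) = 1 ∧ v (algebraMap k A (c - d ^ p)) < 1 := by
  have hpw : v.comap (algebraMap k A) (p : k) < 1 := by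
    rw [Valuation.comap_apply, map_natCast]; exact hv.map_prime_lt_one
  obtain ⟨F, _, _, r, hr, hr0⟩ := (hv.hasFiniteNet_base.mono hpw.le).exists_residue
  have : Fact p.Prime := ⟨hp⟩
  have : CharP F p := by
    rw [CharP.charP_iff_prime_eq_zero hp, ← map_natCast r, hr0]
    exact hpw
  obtain ⟨y, hy⟩ := Finite.injective_iff_surjective.1 (frobenius_inj F p) (r ⟨c, hc.le⟩)
  obtain ⟨d, rfl⟩ := hr y
  rw [frobenius_def, eq_comm, ← sub_eq_zero, ← map_pow, ← map_sub, hr0] at hy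
  have hlt : v (algebraMap k A (c - d ^ p)) < 1 := hy
  refine ⟨d, ?_, hlt⟩
  rw [map_sub, v.map_sub_swap, ← hc] at hlt
  have h1 := Valuation.map_add_eq_of_lt_right v hlt
  rw [sub_add_cancel, hc, map_pow, map_pow] at h1
  exact (pow_eq_one_iff_of_nonneg zero_le hp.ne_zero).1 h1

theorem IsLocalNorm.exists_uniformizer (hv : IsLocalNorm p k A v) :
    ∃ π : k, π ≠ 0 ∧ v (algebraMap k A π) < 1 ∧
      ∀ x : k, x ≠ 0 → ∃ n : ℤ, v (algebraMap k A x) = v (algebraMap k A π) ^ n := by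
  refine hv.hasFiniteNet_base.exists_uniformizer ?_ ?_
  · intro h
    have := hv.map_prime_pos
    rw [← map_natCast (algebraMap k A), h, map_zero, map_zero] at this
    exact lt_irrefl _ this
  · rw [Valuation.comap_apply, map_natCast]; exact hv.map_prime_lt_one

end unramified

section residual

variable {k A M : Type*} [Field k] [Field A] [Field M] [Algebra k A] [Algebra A M]
  [MulSemiringAction (A ≃ₐ[k] A) M] {p : ℕ} {v : Valuation A ℝ≥0}
  {Γ : Type*} [LinearOrderedCommGroupWithZero Γ] {V : Valuation M Γ}

/-- The products of units of `k` with `p`-th powers of elements fixed by the whole group. -/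
def baseUnitPowSet (M : Type*) [Field M] [Algebra A M] [MulSemiringAction (A ≃ₐ[k] A) M]
    (v : Valuation A ℝ≥0) (p : ℕ) : Set M :=
  {x | ∃ c : k, v (algebraMap k A c) = 1 ∧ ∃ t ∈ fixedSubfield M (⊤ : Subgroup (A ≃ₐ[k] A)),
    x = algebraMap A M (algebraMap k A c) * t ^ p}

theorem one_add_mem_baseUnitPowSet [IsAlgClosed A] [IsAlgClosed M] [IsGalois k A]
    (hM : IsSmoothAction k A M) (hv : IsLocalNorm p k A v) (hp : p.Prime)
    (hVG : ∀ (g : A ≃ₐ[k] A) x, V x < 1 → V (g • x) < 1)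
    (hVA : (V.comap (algebraMap A M)).IsEquiv v) {y : M}
    (hy : y ∈ fixedSubfield M (⊤ : Subgroup (A ≃ₐ[k] A))) (hy1 : V y < 1) :
    1 + y ∈ baseUnitPowSet (k := k) M v p := by
  obtain ⟨a, θ, W, g, ha, hθ, hvθ, hW, hθW, hdist⟩ := hv.exists_artinSchreier hp
  have hVp : V (p : M) < 1 := by
    rw [← map_natCast (algebraMap A M)]
    exact hVA.lt_one_iff_lt_one.2 hv.map_prime_lt_one
  have hVθ : V (algebraMap A M θ) = 1 := hVA.eq_one_iff_eq_one.2 hvθ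
  set α : M := algebraMap A M (algebraMap k A a) with hα
  have hVα : V α = 1 := hVA.eq_one_iff_eq_one.2 ha
  have hαG : ∀ g : A ≃ₐ[k] A, g • α = α := fun g => by
    rw [hα, hM.smul_algebraMap, AlgEquiv.commutes]
  have hmonic : (Polynomial.X ^ p - Polynomial.X + Polynomial.C (α * y)).Monic := by
    rw [sub_add, sub_eq_add_neg]
    refine Polynomial.monic_X_pow_add ?_
    rw [Polynomial.degree_neg, Polynomial.degree_X_sub_C]
    exact_mod_cast hp.one_lt
  obtain ⟨x, hx, hx1⟩ := exists_root_sub_lt V hmonic (x := 0) (by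
    simpa [hp.ne_zero, hVα] using hy1)
  have hx1 : V x < 1 := by simpa using hx1
  have hx : x ^ p - x = -(α * y) := by
    rw [eq_neg_iff_add_eq_zero]; simpa using hx
  have hxG : x ∈ fixedSubfield M (⊤ : Subgroup (A ≃ₐ[k] A)) := by
    intro g hg
    refine eq_of_pow_sub_eq V hp hVp hx1.le (V.map_sub_lt (hVG g x hx1) hx1) ?_
    rw [← smul_pow', ← smul_sub, hx, smul_neg, smul_mul', hαG, hy g hg]
  set z : M := x - algebraMap A M θ with hz
  have hz0 : z ≠ 0 := by
    intro h0
    rw [hz, sub_eq_zero] at h0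
    rw [h0, hVθ] at hx1
    exact lt_irrefl _ hx1
  have hzW : z ∈ fixedSubfield M W :=
    sub_mem (fun g _ => hxG g (Subgroup.mem_top g)) (hM.algebraMap_mem_iff.2 hθW)
  have hprod : ∏ j ∈ Finset.range p, g ^ j • z = -α * (1 + y) := by
    have e : ∏ j ∈ Finset.range p, g ^ j • z =
        ∏ j ∈ Finset.range p, (x - algebraMap A M ((g ^ j) θ)) := by
      refine Finset.prod_congr rfl fun j _ => ?_
      rw [hz, smul_sub, hxG _ (Subgroup.mem_top _), hM.smul_algebraMap]
    have hinj : Set.InjOn (fun j => (g ^ j) θ) (Finset.range p) := by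
      intro i hi j hj hij
      by_contra hne
      have := hdist i (by simpa using hi) j (by simpa using hj) hne
      rw [sub_eq_zero.2 hij, map_zero] at this
      exact zero_ne_one this
    rw [e, prod_sub_eq_pow_sub hp (b := fun j => algebraMap A M ((g ^ j) θ)) (a := α)
      ((algebraMap A M).injective.comp_injOn hinj) (fun j _ => ?_)]
    · linear_combination hx
    · rw [← map_pow (algebraMap A M), ← map_sub, ← map_pow, ← map_sub, hθ, AlgEquiv.commutes]
  obtain ⟨c, hc, hc0, t, ht, ht0, hct⟩ := hM.exists_eq_mul_pow W hp.ne_zero hzW hz0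
  obtain ⟨b, hb0, hb⟩ := exists_map_algebraMap_eq hv.map_equiv hp hW hvθ hθW hdist hc hc0
  obtain ⟨d, hd⟩ := mem_fixedSubfield_top_iff.1 (hW.prod_mem hc)
  have hvd : v (algebraMap k A d) = v c ^ p := by
    rw [hd, map_prod, Finset.prod_congr rfl (fun j _ => by
      rw [AlgEquiv.smul_def, hv.map_equiv]), Finset.prod_const, Finset.card_range]
  have ha0 : a ≠ 0 := by
    rintro rfl
    simp at ha
  have hvc0 : v c ≠ 0 := (Valuation.ne_zero_iff v).2 hc0
  refine ⟨-(d / (a * b ^ p)), ?_, algebraMap A M (algebraMap k A b) *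
    ∏ j ∈ Finset.range p, g ^ j • t, mul_mem (hM.algebraMap_mem_iff.2
      (mem_fixedSubfield_top_iff.2 ⟨b, rfl⟩)) (hW.prod_mem ht), ?_⟩
  · rw [map_neg, Valuation.map_neg, map_div₀, map_div₀, hvd, map_mul, map_mul, map_pow, map_pow,
      hb, ha, one_mul, div_self (pow_ne_zero _ hvc0)]
  · have h1 : algebraMap A M (algebraMap k A d) * (∏ j ∈ Finset.range p, g ^ j • t) ^ p =
        -α * (1 + y) := by
      rw [← hprod, hd, map_prod, ← Finset.prod_pow, ← Finset.prod_mul_distrib]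
      refine Finset.prod_congr rfl fun j _ => ?_
      rw [hct, smul_mul', smul_pow', hM.smul_algebraMap, AlgEquiv.smul_def]
    have hα0 : α ≠ 0 := by simpa [hα] using ha0
    have hb0' : algebraMap A M (algebraMap k A b) ≠ 0 := by simpa using hb0
    rw [map_neg, map_neg, map_div₀, map_div₀, map_mul, map_mul, map_pow, map_pow, ← hα]
    field_simp
    linear_combination (algebraMap A M (algebraMap k A b)) ^ p * h1

end residual

/-! ### Approximation of fixed elements by elements of the base field -/

section approximation

variable {k A M : Type*} [Field k] [Field A] [Field M] [Algebra k A] [Algebra A M]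
  [MulSemiringAction (A ≃ₐ[k] A) M] {p : ℕ} {v : Valuation A ℝ≥0}
  {Γ : Type*} [LinearOrderedCommGroupWithZero Γ] {V : Valuation M Γ}

theorem map_le_of_map_lt_one {π : k} (hπ0 : π ≠ 0) (hπ1 : v (algebraMap k A π) < 1)
    (hπ : ∀ x : k, x ≠ 0 → ∃ n : ℤ, v (algebraMap k A x) = v (algebraMap k A π) ^ n) {b : k}
    (hb : v (algebraMap k A b) < 1) : v (algebraMap k A b) ≤ v (algebraMap k A π) := by
  rcases eq_or_ne b 0 with rfl | hb0
  · simp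
  obtain ⟨n, hn⟩ := hπ b hb0
  have h0 : 0 < v (algebraMap k A π) := by
    rw [pos_iff_ne_zero, Valuation.ne_zero_iff]; simpa using hπ0
  rw [hn] at hb ⊢
  have h1 : 0 < n := by
    by_contra! hle
    exact absurd hb (not_lt.2 (one_le_zpow_of_nonpos₀ h0 hπ1.le hle))
  calc v (algebraMap k A π) ^ n ≤ v (algebraMap k A π) ^ (1 : ℤ) :=
        zpow_le_zpow_right_of_le_one₀ h0 hπ1.le h1
    _ = _ := zpow_one _

theorem sub_one_lt_of_pow (hp : p.Prime) (hVp : V (p : M) < 1) {t : M} (ht : V t ≤ 1)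
    (h : V (t ^ p - 1) < 1) : V (t - 1) < 1 := by
  have h1 : V (t - 1) ≤ 1 := V.map_sub_le ht V.map_one.le
  obtain ⟨r, hr, he⟩ := exists_add_pow_eq V hp h1 V.map_one.le
  rw [sub_add_cancel, one_pow, mul_one] at he
  have h2 : V ((t - 1) ^ p) < 1 := by
    rw [show (t - 1) ^ p = (t ^ p - 1) - p * ((t - 1) * r) by linear_combination -he]
    refine V.map_sub_lt h ?_
    rw [map_mul, map_mul]
    exact mul_lt_one_of_lt_of_le hVp (mul_le_one' h1 hr)
  rw [map_pow] at h2
  by_contra! h3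
  exact absurd h2 (not_lt.2 (one_le_pow₀ h3))

theorem exists_one_add_eq [IsAlgClosed A] [IsAlgClosed M] [IsGalois k A]
    (hM : IsSmoothAction k A M) (hv : IsLocalNorm p k A v) (hp : p.Prime)
    (hVG : ∀ (g : A ≃ₐ[k] A) x, V x < 1 → V (g • x) < 1)
    (hVA : (V.comap (algebraMap A M)).IsEquiv v) {y : M}
    (hy : y ∈ fixedSubfield M (⊤ : Subgroup (A ≃ₐ[k] A))) (hy1 : V y < 1) :
    ∃ b : k, v (algebraMap k A b) < 1 ∧ ∃ t ∈ fixedSubfield M (⊤ : Subgroup (A ≃ₐ[k] A)),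
      V (t - 1) < 1 ∧ 1 + y = (1 + algebraMap A M (algebraMap k A b)) * t ^ p := by
  obtain ⟨c, hc, t, ht, hct⟩ := one_add_mem_baseUnitPowSet hM hv hp hVG hVA hy hy1
  obtain ⟨d, hd, hcd⟩ := hv.exists_pow_sub_lt hp hc
  have hVp : V (p : M) < 1 := by
    rw [← map_natCast (algebraMap A M)]
    exact hVA.lt_one_iff_lt_one.2 hv.map_prime_lt_one
  have hd0 : d ≠ 0 := by rintro rfl; simp at hd
  have hb : v (algebraMap k A ((c - d ^ p) / d ^ p)) < 1 := by
    rwa [map_div₀, map_div₀, map_pow, map_pow, hd, one_pow, div_one]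
  have hVb : V (algebraMap A M (algebraMap k A ((c - d ^ p) / d ^ p))) < 1 :=
    hVA.lt_one_iff_lt_one.2 hb
  have he : 1 + y = (1 + algebraMap A M (algebraMap k A ((c - d ^ p) / d ^ p))) *
      (algebraMap A M (algebraMap k A d) * t) ^ p := by
    have hd0' : algebraMap A M (algebraMap k A d) ≠ 0 := by simpa using hd0
    rw [hct, map_div₀, map_div₀, map_sub, map_sub, map_pow, map_pow]
    field_simp
    ring
  refine ⟨_, hb, _, mul_mem (hM.algebraMap_mem_iff.2 (mem_fixedSubfield_top_iff.2 ⟨d, rfl⟩)) ht,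
    ?_, he⟩
  have h1 : V (1 + y) = 1 := map_eq_one_of_sub_one_lt V (by simpa using hy1)
  have h2 : V (1 + algebraMap A M (algebraMap k A ((c - d ^ p) / d ^ p))) = 1 :=
    map_eq_one_of_sub_one_lt V (by simpa using hVb)
  have h3 : V ((algebraMap A M (algebraMap k A d) * t) ^ p) = 1 := by
    rwa [he, map_mul, h2, one_mul] at h1
  refine sub_one_lt_of_pow hp hVp ?_ ?_
  · rw [map_pow] at h3
    exact ((pow_eq_one_iff_of_nonneg zero_le hp.ne_zero).1 h3).le
  · rw [show (algebraMap A M (algebraMap k A d) * t) ^ p - 1 = y -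
      algebraMap A M (algebraMap k A ((c - d ^ p) / d ^ p)) *
        (algebraMap A M (algebraMap k A d) * t) ^ p by linear_combination -he]
    refine V.map_sub_lt hy1 ?_
    rwa [map_mul, h3, mul_one]

theorem mem_baseUnitPowSet_of_lt [IsAlgClosed A] [IsAlgClosed M] [IsGalois k A]
    (hM : IsSmoothAction k A M) (hv : IsLocalNorm p k A v) (hp : p.Prime)
    (hVG : ∀ (g : A ≃ₐ[k] A) x, V x < 1 → V (g • x) < 1)
    (hVA : (V.comap (algebraMap A M)).IsEquiv v) {π : k} (hπ0 : π ≠ 0)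
    (hπ1 : v (algebraMap k A π) < 1)
    (hπ : ∀ x : k, x ≠ 0 → ∃ n : ℤ, v (algebraMap k A x) = v (algebraMap k A π) ^ n) {y : M}
    (hy : y ∈ fixedSubfield M (⊤ : Subgroup (A ≃ₐ[k] A))) (hy1 : V y < 1)
    (hy2 : V (algebraMap A M (algebraMap k A π)) < V y) :
    y ∈ baseUnitPowSet (k := k) M v p := by
  obtain ⟨b, hb, t, ht, ht1, he⟩ := exists_one_add_eq hM hv hp hVG hVA hy hy1
  have hVb : V (algebraMap A M (algebraMap k A b)) < V y :=
    lt_of_le_of_lt ((hVA _ _).2 (map_le_of_map_lt_one hπ0 hπ1 hπ hb)) hy2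
  have hVp : V (p : M) < V y := by
    refine lt_of_le_of_lt ?_ hy2
    rw [← map_natCast (algebraMap A M), ← map_natCast (algebraMap k A)]
    refine (hVA _ _).2 (map_le_of_map_lt_one hπ0 hπ1 hπ ?_)
    rw [map_natCast]
    exact hv.map_prime_lt_one
  have hVt := map_eq_one_of_sub_one_lt V ht1
  obtain ⟨s, hs, hes⟩ := exists_add_pow_eq V hp ht1.le V.map_one.le
  rw [sub_add_cancel, one_pow, mul_one] at hes
  have hy0 : y ≠ 0 := by
    rintro rfl
    rw [map_zero] at hy2
    exact not_lt_zero hy2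
  have hlt : V ((t - 1) ^ p - y) < V y := by
    rw [show (t - 1) ^ p - y = -(p * ((t - 1) * s) + algebraMap A M (algebraMap k A b) * t ^ p) by
      linear_combination -he - hes, Valuation.map_neg]
    refine V.map_add_lt ?_ ?_
    · rw [map_mul, map_mul]
      exact lt_of_le_of_lt (mul_le_of_le_one_right' (mul_le_one' ht1.le hs)) hVp
    · rwa [map_mul, map_pow, hVt, one_pow, mul_one]
  have hr : t - 1 ∈ fixedSubfield M (⊤ : Subgroup (A ≃ₐ[k] A)) := sub_mem ht (one_mem _)
  obtain ⟨c, hc, w, hw, hcw⟩ := one_add_mem_baseUnitPowSet hM hv hp hVG hVA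
    (y := ((t - 1) ^ p - y) / y) (div_mem (sub_mem (pow_mem hr p) hy) hy) (by
      rw [map_div₀]
      exact (div_lt_one₀ (by rw [pos_iff_ne_zero, Valuation.ne_zero_iff]; exact hy0)).2 hlt)
  have e : (t - 1) ^ p = y * (algebraMap A M (algebraMap k A c) * w ^ p) := by
    rw [← hcw]; field_simp; ring
  have hr0 : (t - 1) ^ p ≠ 0 := by
    intro h0
    rw [h0, zero_sub, Valuation.map_neg] at hlt
    exact lt_irrefl _ hlt
  have hcw0 : algebraMap A M (algebraMap k A c) * w ^ p ≠ 0 := by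
    intro h0
    rw [h0, mul_zero] at e
    exact hr0 e
  have hw0 : w ≠ 0 := by
    rintro rfl
    exact hcw0 (by rw [zero_pow hp.ne_zero, mul_zero])
  have hc0 : algebraMap A M (algebraMap k A c) ≠ 0 := left_ne_zero_of_mul hcw0
  refine ⟨c⁻¹, by rw [map_inv₀, map_inv₀, hc, inv_one], (t - 1) / w, div_mem hr hw, ?_⟩
  rw [div_pow, e, map_inv₀, map_inv₀]
  field_simp

theorem map_le_uniformizer [IsAlgClosed A] [IsAlgClosed M] [IsGalois k A]
    (hM : IsSmoothAction k A M) (hv : IsLocalNorm p k A v) (hp : p.Prime)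
    (hVG : ∀ (g : A ≃ₐ[k] A) x, V x < 1 → V (g • x) < 1)
    (hVA : (V.comap (algebraMap A M)).IsEquiv v) {π : k} (hπ0 : π ≠ 0)
    (hπ1 : v (algebraMap k A π) < 1)
    (hπ : ∀ x : k, x ≠ 0 → ∃ n : ℤ, v (algebraMap k A x) = v (algebraMap k A π) ^ n) {y : M}
    (hy : y ∈ fixedSubfield M (⊤ : Subgroup (A ≃ₐ[k] A))) (hy1 : V y < 1) :
    V y ≤ V (algebraMap A M (algebraMap k A π)) := by
  by_contra! hlt
  have hι0 : algebraMap A M (algebraMap k A π) ≠ 0 := by simpa using hπ0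
  have hVι0 : 0 < V (algebraMap A M (algebraMap k A π)) := by
    rwa [pos_iff_ne_zero, Valuation.ne_zero_iff]
  have hVy0 := hVι0.trans hlt
  have hy0 : y ≠ 0 := by
    rintro rfl
    rw [map_zero] at hVy0
    exact lt_irrefl _ hVy0
  have hιL : ∀ c : k, algebraMap A M (algebraMap k A c) ∈
      fixedSubfield M (⊤ : Subgroup (A ≃ₐ[k] A)) := fun c =>
    hM.algebraMap_mem_iff.2 (mem_fixedSubfield_top_iff.2 ⟨c, rfl⟩)
  obtain ⟨c, hc, t, ht, e⟩ := mem_baseUnitPowSet_of_lt hM hv hp hVG hVA hπ0 hπ1 hπ hy hy1 hlt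
  obtain ⟨c', hc', t', ht', e'⟩ := mem_baseUnitPowSet_of_lt hM hv hp hVG hVA hπ0 hπ1 hπ
    (y := algebraMap A M (algebraMap k A π) / y) (div_mem (hιL π) hy)
    (by rw [map_div₀]; exact (div_lt_one₀ hVy0).2 hlt)
    (by
      rw [map_div₀, lt_div_iff₀ hVy0]
      exact mul_lt_of_lt_one_right hVι0 hy1)
  have hw : (t * t') ^ p = algebraMap A M (algebraMap k A (π / (c * c'))) := by
    have h1 : algebraMap A M (algebraMap k A π) =
        (algebraMap A M (algebraMap k A c) * t ^ p) *
          (algebraMap A M (algebraMap k A c') * t' ^ p) := by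
      rw [← e, ← e']; field_simp
    have hc0 : algebraMap A M (algebraMap k A c) ≠ 0 := by
      have : c ≠ 0 := by rintro rfl; simp at hc
      simpa using this
    have hc0' : algebraMap A M (algebraMap k A c') ≠ 0 := by
      have : c' ≠ 0 := by rintro rfl; simp at hc'
      simpa using this
    rw [map_div₀, map_div₀, map_mul, map_mul, h1, mul_pow]
    field_simp
  have hsp : (Polynomial.X ^ p - Polynomial.C (algebraMap k A (π / (c * c')))).Splits :=
    IsAlgClosed.splits _
  obtain ⟨a, ha⟩ := hsp.mem_range_of_isRoot (i := algebraMap A M)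
    (Polynomial.X_pow_sub_C_ne_zero hp.pos _) (x := t * t') (by simp [hw])
  obtain ⟨d, rfl⟩ := mem_fixedSubfield_top_iff.1
    ((hM.algebraMap_mem_iff (a := a)).1 (ha ▸ mul_mem ht ht'))
  rw [← ha, ← map_pow, (algebraMap A M).injective.eq_iff, ← map_pow,
    (algebraMap k A).injective.eq_iff] at hw
  have hd0 : d ≠ 0 := by
    rintro rfl
    rw [zero_pow hp.ne_zero, eq_comm, div_eq_zero_iff] at hw
    rcases hw with h | h
    · exact hπ0 h
    · rcases mul_eq_zero.1 h with rfl | rfl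
      · simp at hc
      · simp at hc'
  obtain ⟨n, hn⟩ := hπ d hd0
  have h1 := congrArg (fun x => v (algebraMap k A x)) hw
  simp only [map_pow, map_div₀, map_mul, hc, hc', mul_one, div_one, hn] at h1
  rw [← zpow_natCast, ← zpow_mul] at h1
  have hvπ : 0 < v (algebraMap k A π) := by
    rw [pos_iff_ne_zero, Valuation.ne_zero_iff]; simpa using hπ0
  have h2 := zpow_right_injective₀ hvπ hπ1.ne (h1.trans (zpow_one _).symm)
  have h3 : (p : ℤ) ∣ 1 := Dvd.intro_left n h2
  exact hp.one_lt.ne' (by exact_mod_cast Int.eq_one_of_dvd_one (by positivity) h3)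

theorem exists_sub_le_uniformizer [IsAlgClosed A] [IsAlgClosed M] [IsGalois k A]
    (hM : IsSmoothAction k A M) (hv : IsLocalNorm p k A v) (hp : p.Prime)
    (hVG : ∀ (g : A ≃ₐ[k] A) x, V x < 1 → V (g • x) < 1)
    (hVA : (V.comap (algebraMap A M)).IsEquiv v) {π : k} (hπ0 : π ≠ 0)
    (hπ1 : v (algebraMap k A π) < 1)
    (hπ : ∀ x : k, x ≠ 0 → ∃ n : ℤ, v (algebraMap k A x) = v (algebraMap k A π) ^ n) {x : M}
    (hx : x ∈ fixedSubfield M (⊤ : Subgroup (A ≃ₐ[k] A))) (hx1 : V x ≤ 1) :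
    ∃ b : k, V (x - algebraMap A M (algebraMap k A b)) ≤
      V (algebraMap A M (algebraMap k A π)) := by
  have hι0 : algebraMap A M (algebraMap k A π) ≠ 0 := by simpa using hπ0
  have hVι0 : 0 < V (algebraMap A M (algebraMap k A π)) := by
    rwa [pos_iff_ne_zero, Valuation.ne_zero_iff]
  have hVι1 : V (algebraMap A M (algebraMap k A π)) < 1 := hVA.lt_one_iff_lt_one.2 hπ1
  have hVp : V (p : M) < 1 := by
    rw [← map_natCast (algebraMap A M)]
    exact hVA.lt_one_iff_lt_one.2 hv.map_prime_lt_one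
  have hιL : ∀ c : k, algebraMap A M (algebraMap k A c) ∈
      fixedSubfield M (⊤ : Subgroup (A ≃ₐ[k] A)) := fun c =>
    hM.algebraMap_mem_iff.2 (mem_fixedSubfield_top_iff.2 ⟨c, rfl⟩)
  obtain ⟨b, hb, t, ht, ht1, he⟩ := exists_one_add_eq hM hv hp hVG hVA (mul_mem (hιL π) hx)
    (by rw [map_mul]; exact mul_lt_one_of_lt_of_le hVι1 hx1)
  have htle := map_le_uniformizer hM hv hp hVG hVA hπ0 hπ1 hπ (sub_mem ht (one_mem _)) ht1
  obtain ⟨s, hs, hes⟩ := exists_add_pow_eq V hp ht1.le V.map_one.le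
  rw [sub_add_cancel, one_pow, mul_one] at hes
  have htp : V (t ^ p - 1) < V (algebraMap A M (algebraMap k A π)) := by
    rw [show t ^ p - 1 = (t - 1) * (t - 1) ^ (p - 1) + (t - 1) * (s * p) by
      rw [← pow_succ', Nat.sub_add_cancel hp.one_le, hes]; ring]
    have key : ∀ z, V z < 1 → V ((t - 1) * z) < V (algebraMap A M (algebraMap k A π)) := by
      intro z hz
      rw [map_mul]
      calc V (t - 1) * V z ≤ V (algebraMap A M (algebraMap k A π)) * V z :=
            mul_le_mul_left htle _
        _ < _ := mul_lt_of_lt_one_right hVι0 hz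
    refine V.map_add_lt (key _ ?_) (key _ ?_)
    · rw [map_pow]
      exact pow_lt_one₀ zero_le ht1 (Nat.sub_ne_zero_of_lt hp.one_lt)
    · rw [map_mul, mul_comm]
      exact mul_lt_one_of_lt_of_le hVp hs
  have hVb : V (1 + algebraMap A M (algebraMap k A b)) = 1 :=
    map_eq_one_of_sub_one_lt V (by simpa using hVA.lt_one_iff_lt_one.2 hb)
  refine ⟨b / π, map_le_uniformizer hM hv hp hVG hVA hπ0 hπ1 hπ (sub_mem hx (hιL _)) ?_⟩
  rw [show x - algebraMap A M (algebraMap k A (b / π)) =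
    (1 + algebraMap A M (algebraMap k A b)) * (t ^ p - 1) / algebraMap A M (algebraMap k A π) by
      rw [map_div₀, map_div₀]
      field_simp
      linear_combination he, map_div₀, map_mul, hVb, one_mul]
  exact (div_lt_one₀ hVι0).2 htp

/-- Fixed elements of the valuation ring are infinitely close to elements of `k`. -/
theorem exists_sub_le_pow [IsAlgClosed A] [IsAlgClosed M] [IsGalois k A]
    (hM : IsSmoothAction k A M) (hv : IsLocalNorm p k A v) (hp : p.Prime)
    (hVG : ∀ (g : A ≃ₐ[k] A) x, V x < 1 → V (g • x) < 1)
    (hVA : (V.comap (algebraMap A M)).IsEquiv v) {x : M}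
    (hx : x ∈ fixedSubfield M (⊤ : Subgroup (A ≃ₐ[k] A))) (hx1 : V x ≤ 1) :
    ∃ a : k, ∀ n : ℕ, V (x - algebraMap A M (algebraMap k A a)) ≤ V (p : M) ^ n := by
  obtain ⟨π, hπ0, hπ1, hπ⟩ := hv.exists_uniformizer
  have hι0 : algebraMap A M (algebraMap k A π) ≠ 0 := by simpa using hπ0
  have hVι0 : 0 < V (algebraMap A M (algebraMap k A π)) := by
    rwa [pos_iff_ne_zero, Valuation.ne_zero_iff]
  have hVι1 : V (algebraMap A M (algebraMap k A π)) < 1 := hVA.lt_one_iff_lt_one.2 hπ1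
  have hvπ : 0 < v (algebraMap k A π) := by
    rw [pos_iff_ne_zero, Valuation.ne_zero_iff]; simpa using hπ0
  have hιL : ∀ c : k, algebraMap A M (algebraMap k A c) ∈
      fixedSubfield M (⊤ : Subgroup (A ≃ₐ[k] A)) := fun c =>
    hM.algebraMap_mem_iff.2 (mem_fixedSubfield_top_iff.2 ⟨c, rfl⟩)
  have h1 : ∀ n : ℕ, ∃ a : k, V (x - algebraMap A M (algebraMap k A a)) ≤
      V (algebraMap A M (algebraMap k A π)) ^ n := by
    intro n
    induction n with
    | zero => exact ⟨0, by simpa using hx1⟩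
    | succ n ih =>
      obtain ⟨a, ha⟩ := ih
      obtain ⟨b, hb⟩ := exists_sub_le_uniformizer hM hv hp hVG hVA hπ0 hπ1 hπ
        (x := (x - algebraMap A M (algebraMap k A a)) / algebraMap A M (algebraMap k A π) ^ n)
        (div_mem (sub_mem hx (hιL a)) (pow_mem (hιL π) n)) (by
          rw [map_div₀, map_pow]
          exact div_le_one_of_le₀ ha zero_le)
      refine ⟨a + π ^ n * b, ?_⟩
      rw [show x - algebraMap A M (algebraMap k A (a + π ^ n * b)) =
        algebraMap A M (algebraMap k A π) ^ n *
        ((x - algebraMap A M (algebraMap k A a)) / algebraMap A M (algebraMap k A π) ^ n -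
          algebraMap A M (algebraMap k A b)) by
          simp only [map_add, map_mul, map_pow]
          field_simp
          ring, map_mul, map_pow, pow_succ]
      exact mul_le_mul_right hb _
  choose a ha using h1
  have hvle : ∀ (c : k) (n : ℕ), v (algebraMap k A c) ≤ v (algebraMap k A π) ^ n ↔
      V (algebraMap A M (algebraMap k A c)) ≤ V (algebraMap A M (algebraMap k A π)) ^ n := by
    intro c n
    rw [← map_pow v, ← map_pow V, ← map_pow (algebraMap A M)]
    exact (hVA _ _).symm
  obtain ⟨b, hb⟩ := hv.exists_limit (v (algebraMap k A π)) a hπ1 (by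
    intro n
    rw [hvle, map_sub, map_sub, show algebraMap A M (algebraMap k A (a (n + 1))) -
      algebraMap A M (algebraMap k A (a n)) = (x - algebraMap A M (algebraMap k A (a n))) -
      (x - algebraMap A M (algebraMap k A (a (n + 1)))) by ring]
    refine V.map_sub_le (ha n) ((ha (n + 1)).trans ?_)
    exact pow_le_pow_right_of_le_one' hVι1.le n.le_succ)
  have hb' : ∀ n : ℕ, V (x - algebraMap A M (algebraMap k A b)) ≤
      V (algebraMap A M (algebraMap k A π)) ^ n := by
    intro n
    rw [show x - algebraMap A M (algebraMap k A b) = (x - algebraMap A M (algebraMap k A (a n))) -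
      (algebraMap A M (algebraMap k A (b - a n))) by rw [map_sub, map_sub]; ring]
    exact V.map_sub_le (ha n) ((hvle _ n).1 (hb n))
  have hp0 : (p : k) ≠ 0 := by
    intro h
    have := hv.map_prime_pos
    rw [← map_natCast (algebraMap k A), h, map_zero, map_zero] at this
    exact lt_irrefl _ this
  obtain ⟨e, he⟩ := hπ p hp0
  obtain ⟨m, hm⟩ : ∃ m : ℕ, v (algebraMap k A π) ^ m ≤ v (algebraMap k A (p : k)) := by
    refine ⟨e.toNat, ?_⟩
    rw [he, ← zpow_natCast]
    exact zpow_le_zpow_right_of_le_one₀ hvπ hπ1.le (Int.self_le_toNat e)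
  have hm' : V (algebraMap A M (algebraMap k A π)) ^ m ≤ V (p : M) := by
    rw [← map_natCast (algebraMap A M), ← map_natCast (algebraMap k A), ← map_pow, ← map_pow]
    exact (hVA _ _).2 (by rwa [map_pow])
  refine ⟨b, fun n => (hb' (m * n)).trans ?_⟩
  rw [pow_mul]
  exact pow_le_pow_left' hm' n

end approximation

/-! ### Existence of the valuation -/

section coarsening

variable {k A M : Type*} [Field k] [Field A] [Field M] [Algebra k A] [Algebra A M]
  [MulSemiringAction (A ≃ₐ[k] A) M] {p : ℕ} {v : Valuation A ℝ≥0}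

theorem _root_.ValuationSubring.one_le_valuation_iff {F : Type*} [Field F]
    (O : ValuationSubring F) {x : F} (hx : x ≠ 0) : 1 ≤ O.valuation x ↔ x⁻¹ ∈ O := by
  rw [← O.valuation_le_one_iff, map_inv₀, inv_le_one₀]
  rwa [pos_iff_ne_zero, Valuation.ne_zero_iff]

theorem valuation_smul_lt_one {G : Type*} [Group G] [MulSemiringAction G M]
    (O : ValuationSubring M) (hO : ∀ (g : G), ∀ x ∈ O, g • x ∈ O) (g : G) (x : M)
    (hx : O.valuation x < 1) : O.valuation (g • x) < 1 := by
  rcases eq_or_ne x 0 with rfl | hx0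
  · simp
  contrapose! hx
  rw [O.one_le_valuation_iff ((smul_ne_zero_iff_ne g).2 hx0)] at hx
  rw [O.one_le_valuation_iff hx0]
  have := hO g⁻¹ _ hx
  rwa [smul_inv'', inv_smul_smul] at this

theorem isEquiv_comap_valuation (hv0 : 0 < v (p : A))
    {O : ValuationSubring M} (hA : ∀ a : A, v a ≤ 1 → algebraMap A M a ∈ O)
    (hpO : algebraMap A M (p : A)⁻¹ ∉ O) :
    (O.valuation.comap (algebraMap A M)).IsEquiv v := by
  refine Valuation.isEquiv_of_val_le_one fun a => ?_
  rw [Valuation.comap_apply, ValuationSubring.valuation_le_one_iff]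
  refine ⟨fun ha => ?_, hA a⟩
  by_contra! hlt
  have ha0 : v a ≠ 0 := (zero_lt_one.trans hlt).ne'
  obtain ⟨n, hn⟩ := pow_unbounded_of_one_lt (v (p : A))⁻¹ hlt
  have h1 : v ((p : A) * a ^ n)⁻¹ ≤ 1 := by
    rw [map_inv₀, map_mul, map_pow]
    refine inv_le_one_of_one_le₀ ?_
    rw [← mul_inv_cancel₀ hv0.ne']
    exact mul_le_mul_right hn.le _
  have h2 := mul_mem (hA _ h1) (pow_mem ha n)
  rw [← map_pow, ← map_mul, mul_inv, mul_assoc, inv_mul_cancel₀, mul_one] at h2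
  · exact hpO h2
  · exact pow_ne_zero _ ((Valuation.ne_zero_iff v).1 ha0)

/-- The valuation ring obtained by inverting `x`. -/
def _root_.ValuationSubring.away {F : Type*} [Field F] (O : ValuationSubring F) (x : F)
    (hx : x ∈ O) : ValuationSubring F :=
  O.ofLE
    { carrier := {y | ∃ n : ℕ, x ^ n * y ∈ O}
      mul_mem' := by
        rintro a b ⟨m, hm⟩ ⟨n, hn⟩
        exact ⟨m + n, by rw [pow_add, mul_mul_mul_comm]; exact mul_mem hm hn⟩
      one_mem' := ⟨0, by simp⟩
      add_mem' := by
        rintro a b ⟨m, hm⟩ ⟨n, hn⟩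
        refine ⟨m + n, ?_⟩
        rw [show x ^ (m + n) * (a + b) = x ^ n * (x ^ m * a) + x ^ m * (x ^ n * b) by ring]
        exact add_mem (mul_mem (pow_mem hx n) hm) (mul_mem (pow_mem hx m) hn)
      zero_mem' := ⟨0, by simp⟩
      neg_mem' := by
        rintro a ⟨n, hn⟩
        exact ⟨n, by rw [mul_neg]; exact neg_mem hn⟩ }
    fun y hy => ⟨0, by simpa using hy⟩

theorem IsSmoothAction.exists_residue_valuationSubring [CharZero A] [IsAlgClosed A]
    [IsAlgClosed M] [IsGalois k A] (hM : IsSmoothAction k A M) (hv : IsLocalNorm p k A v)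
    (hp : p.Prime) :
    ∃ O : ValuationSubring M, (∀ (g : A ≃ₐ[k] A), ∀ x ∈ O, g • x ∈ O) ∧
      (∀ a : A, algebraMap A M a ∈ O) ∧
      ∀ x ∈ fixedSubfield M (⊤ : Subgroup (A ≃ₐ[k] A)), x ∈ O →
        ∃ a : k, O.valuation (x - algebraMap A M (algebraMap k A a)) < 1 := by
  obtain ⟨R, hRG, hRA, hRp⟩ := hM.exists_valuationSubring hv hp
  have hpR : (p : M) ∈ R := natCast_mem R p
  have hVA := isEquiv_comap_valuation hv.map_prime_pos hRA hRp
  have hp0 : (p : A) ≠ 0 := by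
    intro h0
    have := hv.map_prime_pos
    rw [h0, map_zero] at this
    exact lt_irrefl _ this
  have hp0' : (p : M) ≠ 0 := by
    rw [← map_natCast (algebraMap A M)]
    exact (map_ne_zero _).2 hp0
  have hVp : R.valuation (p : M) < 1 := by
    rw [← map_natCast (algebraMap A M)]
    exact hVA.lt_one_iff_lt_one.2 hv.map_prime_lt_one
  have hVp0 : 0 < R.valuation (p : M) := by
    rwa [pos_iff_ne_zero, Valuation.ne_zero_iff]
  refine ⟨R.away p hpR, ?_, ?_, ?_⟩
  · rintro g x ⟨n, hn⟩
    refine ⟨n, ?_⟩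
    have := hRG g _ hn
    rwa [smul_mul', smul_pow', ← map_natCast (algebraMap A M), hM.smul_algebraMap,
      map_natCast, map_natCast] at this
  · intro a
    rcases eq_or_ne a 0 with rfl | ha0
    · rw [map_zero]; exact zero_mem _
    have hva : 0 < v a := by rwa [pos_iff_ne_zero, Valuation.ne_zero_iff]
    obtain ⟨n, hn⟩ := exists_pow_lt_of_lt_one (inv_pos.2 hva) hv.map_prime_lt_one
    rw [← one_div, lt_div_iff₀ hva] at hn
    refine ⟨n, ?_⟩
    have := hRA (p ^ n * a) (by
      rw [map_mul, map_pow]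
      exact hn.le)
    rwa [map_mul, map_pow, map_natCast] at this
  · rintro x hx ⟨n, hn⟩
    have hpL : (p : M) ∈ fixedSubfield M (⊤ : Subgroup (A ≃ₐ[k] A)) := natCast_mem _ p
    obtain ⟨a, ha⟩ := exists_sub_le_pow hM hv hp (valuation_smul_lt_one R hRG) hVA
      (mul_mem (pow_mem hpL n) hx) ((R.valuation_le_one_iff _).2 hn)
    refine ⟨a / p ^ n, ?_⟩
    set z := x - algebraMap A M (algebraMap k A (a / p ^ n)) with hz
    have hpz : p ^ n * x - algebraMap A M (algebraMap k A a) = p ^ n * z := by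
      rw [hz, map_div₀, map_div₀, map_pow, map_pow, map_natCast, map_natCast]
      field_simp
    rw [hpz] at ha
    by_contra! hle
    have hz0 : z ≠ 0 := by
      intro h0
      rw [h0, map_zero] at hle
      exact absurd hle (not_le.2 zero_lt_one)
    rw [ValuationSubring.one_le_valuation_iff _ hz0] at hle
    obtain ⟨m, hm⟩ := hle
    have hm' := (R.valuation_le_one_iff _).2 hm
    have hVz0 : 0 < R.valuation z := by rwa [pos_iff_ne_zero, Valuation.ne_zero_iff]
    rw [map_mul, map_pow, map_inv₀, mul_inv_le_iff₀ hVz0, one_mul] at hm'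
    have h1 := ha (n + m + 1)
    rw [map_mul, map_pow, pow_succ, pow_add] at h1
    have h2 : R.valuation (p : M) ^ n * R.valuation (p : M) ^ m ≤
        R.valuation (p : M) ^ n * R.valuation (p : M) ^ m * R.valuation (p : M) :=
      (mul_le_mul_right hm' _).trans h1
    exact absurd h2 (not_le.2 (mul_lt_of_lt_one_right
      (mul_pos (pow_pos hVp0 n) (pow_pos hVp0 m)) hVp))

end coarsening

/-! ### Uniqueness of the valuation -/

section uniqueness

variable {k A M : Type*} [Field k] [Field A] [Field M] [Algebra k A] [Algebra A M]
  {p : ℕ} {v : Valuation A ℝ≥0}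

theorem algebraMap_mem_of_isAlgebraic [Algebra.IsAlgebraic k A] {O : ValuationSubring M}
    (hk : ∀ c : k, algebraMap A M (algebraMap k A c) ∈ O) (a : A) : algebraMap A M a ∈ O := by
  have h1 : IsIntegral k a := Algebra.IsIntegral.isIntegral a
  obtain ⟨f, hf, hfa⟩ := h1
  let φ : k →+* O := ((algebraMap A M).comp (algebraMap k A)).codRestrict O hk
  have h2 : IsIntegral O (algebraMap A M a) := by
    refine ⟨f.map φ, hf.map φ, ?_⟩
    rw [Polynomial.eval₂_map]
    have : (algebraMap O M).comp φ = (algebraMap A M).comp (algebraMap k A) := rfl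
    rw [this, ← Polynomial.hom_eval₂, hfa, map_zero]
  obtain ⟨y, hy⟩ := IsIntegrallyClosed.isIntegral_iff.1 h2
  rw [← hy]
  exact y.2

theorem valuation_algebraMap_eq_one {O : ValuationSubring M}
    (hA : ∀ a : A, algebraMap A M a ∈ O) {a : A} (ha : a ≠ 0) :
    O.valuation (algebraMap A M a) = 1 := by
  refine le_antisymm ((O.valuation_le_one_iff _).2 (hA a)) ?_
  rw [O.one_le_valuation_iff (by simpa using ha), ← map_inv₀]
  exact hA _

/-- If the valuation ring of `O` in a subfield `K` has residue field `k`, then every residue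
class of an integral element algebraic over `K` is represented in the algebraic closure of `k`. -/
theorem exists_sub_lt_one_of_isAlgebraic [IsAlgClosed A] [IsAlgClosed M] {K : Type*} [Field K]
    [Algebra K M] [Algebra.IsAlgebraic K M] {O : ValuationSubring M}
    (hA : ∀ a : A, algebraMap A M a ∈ O)
    (hres : ∀ x : K, algebraMap K M x ∈ O →
        ∃ a : k, O.valuation (algebraMap K M x - algebraMap A M (algebraMap k A a)) < 1)
    {x : M} (hx : x ∈ O) : ∃ a : A, O.valuation (x - algebraMap A M a) < 1 := by
  have hxK : IsIntegral K x := Algebra.IsIntegral.isIntegral x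
  set f := minpoly K x with hf
  have hf0 : f ≠ 0 := minpoly.ne_zero hxK
  obtain ⟨i, hi, hmax⟩ := Finset.exists_max_image f.support
    (fun j => O.valuation (algebraMap K M (f.coeff j)))
    (Polynomial.support_nonempty.2 hf0)
  have hi0 : f.coeff i ≠ 0 := Polynomial.mem_support_iff.1 hi
  have hiM : algebraMap K M (f.coeff i) ≠ 0 := by simpa using hi0
  have hq : ∀ j, algebraMap K M (f.coeff j / f.coeff i) ∈ O := by
    intro j
    rw [← O.valuation_le_one_iff, map_div₀, map_div₀,
      div_le_one₀ (by rwa [pos_iff_ne_zero, Valuation.ne_zero_iff])]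
    by_cases hj : j ∈ f.support
    · exact hmax j hj
    · rw [Polynomial.notMem_support_iff.1 hj, map_zero, map_zero]
      exact zero_le
  choose e he using fun j => hres _ (hq j)
  have hei : e i ≠ 0 := by
    intro h0
    have := he i
    rw [h0, div_self hi0, map_one, map_zero, map_zero, sub_zero, map_one] at this
    exact lt_irrefl _ this
  let F : Polynomial k := ∑ j ∈ Finset.range (f.natDegree + 1), Polynomial.monomial j (e j)
  have hF0 : F ≠ 0 := by
    intro h0
    have h1 := congrArg (fun Q => Polynomial.coeff Q i) h0
    simp only [F, Polynomial.finsetSum_coeff, Polynomial.coeff_monomial, Finset.sum_ite_eq',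
      Finset.mem_range, Polynomial.coeff_zero] at h1
    rw [if_pos (Nat.lt_succ_of_le (Polynomial.le_natDegree_of_ne_zero hi0))] at h1
    exact hei h1
  let φ : k →+* M := (algebraMap A M).comp (algebraMap k A)
  have hFx : O.valuation ((F.map φ).eval x) < 1 := by
    have e1 : (F.map φ).eval x = -∑ j ∈ Finset.range (f.natDegree + 1),
        (algebraMap K M (f.coeff j / f.coeff i) - φ (e j)) * x ^ j := by
      have h1 : ∑ j ∈ Finset.range (f.natDegree + 1),
          algebraMap K M (f.coeff j / f.coeff i) * x ^ j = 0 := by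
        have h2 : Polynomial.aeval x f = 0 := minpoly.aeval K x
        rw [Polynomial.aeval_eq_sum_range] at h2
        simp only [Algebra.smul_def] at h2
        simp only [map_div₀, div_mul_eq_mul_div]
        rw [← Finset.sum_div, h2, zero_div]
      simp only [F, Polynomial.map_sum, Polynomial.map_monomial, Polynomial.eval_finsetSum,
        Polynomial.eval_monomial, sub_mul, Finset.sum_sub_distrib]
      rw [h1, zero_sub, neg_neg]
    rw [e1, Valuation.map_neg]
    refine Valuation.map_sum_lt _ one_ne_zero fun j _ => ?_
    rw [map_mul, map_pow]
    exact mul_lt_one_of_lt_of_le (he j)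
      (pow_le_one' ((O.valuation_le_one_iff _).2 hx) j)
  have hmonic := Polynomial.monic_mul_leadingCoeff_inv hF0
  have hgx : O.valuation (((F * Polynomial.C F.leadingCoeff⁻¹).map φ).eval x) < 1 := by
    rw [Polynomial.map_mul, Polynomial.map_C, Polynomial.eval_mul, Polynomial.eval_C, map_mul]
    exact mul_lt_one_of_lt_of_le hFx ((O.valuation_le_one_iff _).2 (hA _))
  obtain ⟨r, hr, hxr⟩ := exists_root_sub_lt O.valuation (hmonic.map φ) hgx
  obtain ⟨a, rfl⟩ := (IsAlgClosed.splits
    ((F * Polynomial.C F.leadingCoeff⁻¹).map (algebraMap k A))).mem_range_of_isRoot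
    (i := algebraMap A M) (hmonic.map _).ne_zero (x := r) (by
      rw [Polynomial.map_map]; exact hr)
  exact ⟨a, hxr⟩

variable [MulSemiringAction (A ≃ₐ[k] A) M]

/-- An algebraic description of the valuation ring. -/
theorem IsSmoothAction.mem_iff_exists_pow [CharZero A] [IsAlgClosed A] [IsAlgClosed M]
    [IsGalois k A]
    (hM : IsSmoothAction k A M) (hv : IsLocalNorm p k A v) {ℓ : ℕ} (hℓ : ℓ.Prime)
    (hℓp : ℓ.Coprime p) {O : ValuationSubring M} (hO : ∀ (g : A ≃ₐ[k] A), ∀ x ∈ O, g • x ∈ O)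
    (hA : ∀ a : A, algebraMap A M a ∈ O)
    (hres : ∀ x ∈ O, ∃ a : A, O.valuation (x - algebraMap A M a) < 1)
    (E : IntermediateField k A) [FiniteDimensional k E] {x : M}
    (hx : x ∈ fixedSubfield M E.fixingSubgroup) :
    x ∈ O ↔ ∃ c ∈ fixedSubfield A E.fixingSubgroup,
      (¬ ∃ d ∈ fixedSubfield A E.fixingSubgroup, d ^ ℓ = c) ∧
      ∃ w ∈ fixedSubfield M E.fixingSubgroup, 1 + algebraMap A M c * x ^ ℓ = w ^ ℓ := by
  have hVA : ∀ {a : A}, a ≠ 0 → O.valuation (algebraMap A M a) = 1 :=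
    fun h => valuation_algebraMap_eq_one hA h
  have hℓ1 : O.valuation (ℓ : M) = 1 := by
    rw [← map_natCast (algebraMap A M)]
    exact hVA (Nat.cast_ne_zero.2 hℓ.ne_zero)
  have hOlt := valuation_smul_lt_one O hO
  constructor
  · intro hxO
    have hVx := (O.valuation_le_one_iff _).2 hxO
    obtain ⟨a, ha⟩ := hres x hxO
    have haW : a ∈ fixedSubfield A E.fixingSubgroup := by
      intro g hg
      by_contra hne
      have h1 := hVA (sub_ne_zero.2 hne)
      have h2 := hOlt g _ ha
      rw [smul_sub, hx g hg, hM.smul_algebraMap] at h2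
      have h3 := O.valuation.map_sub_lt ha h2
      rw [sub_sub_sub_cancel_left, ← map_sub] at h3
      exact h3.ne h1
    have hp0 : (⟨(p : A), natCast_mem _ p⟩ : fixedSubfield A E.fixingSubgroup) ≠ 0 := by
      intro h0
      have h1 : (p : A) = 0 := congrArg Subtype.val h0
      have := hv.map_prime_pos
      rw [h1, map_zero] at this
      exact lt_irrefl _ this
    obtain ⟨π, hπ0, hπ1, hπ⟩ := HasFiniteNet.exists_uniformizer
      (a := (⟨(p : A), natCast_mem _ p⟩ : fixedSubfield A E.fixingSubgroup))
      (hv.hasFiniteNet E) hp0 hv.map_prime_lt_one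
    have hπ1 : v (π : A) < 1 := hπ1
    have hπA : (π : A) ≠ 0 := by simpa using hπ0
    have hvπ : 0 < v (π : A) := by rwa [pos_iff_ne_zero, Valuation.ne_zero_iff]
    obtain ⟨n, hn⟩ : ∃ n : ℕ, v (π : A) ^ n * v a ^ ℓ < 1 := by
      rcases eq_or_ne a 0 with rfl | ha0
      · exact ⟨0, by simp [hℓ.ne_zero]⟩
      have hva : 0 < v a ^ ℓ := pow_pos (by rwa [pos_iff_ne_zero, Valuation.ne_zero_iff]) _
      obtain ⟨n, hn⟩ := exists_pow_lt_of_lt_one (inv_pos.2 hva) hπ1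
      rw [← one_div, lt_div_iff₀ hva] at hn
      exact ⟨n, hn⟩
    have hnℓ : v (π : A) ^ (ℓ * n + 1) * v a ^ ℓ < 1 := by
      refine lt_of_le_of_lt (mul_le_mul_left ?_ _) hn
      refine pow_le_pow_right_of_le_one' hπ1.le ?_
      nlinarith [hℓ.one_lt]
    obtain ⟨c, hc⟩ : ∃ c : A, c = (π : A) ^ (ℓ * n + 1) := ⟨_, rfl⟩
    have hcW : c ∈ fixedSubfield A E.fixingSubgroup := hc ▸ pow_mem π.2 _
    obtain ⟨b, hbW, hb, hb1⟩ := exists_fixed_pow_eq v E.fixingSubgroup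
      (fun g _ y hy => by rwa [AlgEquiv.smul_def, hv.map_equiv])
      (map_natCast_eq_one v hv.map_prime_lt_one hℓp) (x := 1 + c * a ^ ℓ)
      (add_mem (one_mem _) (mul_mem hcW (pow_mem haW ℓ)))
      (by rwa [add_sub_cancel_left, map_mul, hc, map_pow, map_pow])
    have hb0 : b ≠ 0 := by
      rintro rfl
      rw [zero_sub, Valuation.map_neg, map_one] at hb1
      exact lt_irrefl _ hb1
    have hbM : algebraMap A M b ≠ 0 := by simpa using hb0
    refine ⟨c, hcW, ?_, ?_⟩
    · rintro ⟨d, hdW, hd⟩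
      have hc0 : c ≠ 0 := hc ▸ pow_ne_zero _ hπA
      have hd0 : d ≠ 0 := by
        rintro rfl
        exact hc0 (by rw [← hd, zero_pow hℓ.ne_zero])
      obtain ⟨m, hm⟩ := hπ ⟨d, hdW⟩ (fun h => hd0 (congrArg Subtype.val h))
      have hm : v d = v (π : A) ^ m := hm
      have h1 := congrArg v hd
      rw [map_pow, hm, hc, map_pow, ← zpow_natCast, ← zpow_natCast, ← zpow_mul] at h1
      have h2 := zpow_right_injective₀ hvπ hπ1.ne h1
      push_cast at h2
      have h3 : (ℓ : ℤ) ∣ 1 := ⟨m - n, by linear_combination -h2⟩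
      exact hℓ.one_lt.ne' (by exact_mod_cast Int.eq_one_of_dvd_one (by positivity) h3)
    · have hxa : O.valuation (x ^ ℓ - algebraMap A M a ^ ℓ) < 1 := by
        rw [← geom_sum₂_mul, map_mul, mul_comm]
        refine mul_lt_one_of_lt_of_le ha (O.valuation.map_sum_le fun i _ => ?_)
        rw [map_mul, map_pow, map_pow]
        exact mul_le_one' (pow_le_one' hVx _)
          (pow_le_one' ((O.valuation_le_one_iff _).2 (hA a)) _)
      obtain ⟨w, hw, hwx, -⟩ := exists_fixed_pow_eq O.valuation E.fixingSubgroup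
        (fun g _ => hOlt g) hℓ1
        (x := (1 + algebraMap A M c * x ^ ℓ) / algebraMap A M b ^ ℓ)
        (div_mem (add_mem (one_mem _) (mul_mem (hM.algebraMap_mem_iff.2 hcW) (pow_mem hx ℓ)))
          (pow_mem (hM.algebraMap_mem_iff.2 hbW) ℓ)) (by
          have hbM' : algebraMap A M b ^ ℓ =
              1 + algebraMap A M c * algebraMap A M a ^ ℓ := by
            rw [← map_pow, hb, map_add, map_one, map_mul, map_pow]
          rw [div_sub_one (pow_ne_zero _ hbM), map_div₀, map_pow, hVA hb0, one_pow, div_one, hbM',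
            add_sub_add_left_eq_sub, ← mul_sub, map_mul, mul_comm]
          exact mul_lt_one_of_lt_of_le hxa ((O.valuation_le_one_iff _).2 (hA c)))
      refine ⟨algebraMap A M b * w, mul_mem (hM.algebraMap_mem_iff.2 hbW) hw, ?_⟩
      rw [mul_pow, hwx, mul_div_cancel₀ _ (pow_ne_zero _ hbM)]
  · rintro ⟨c, hcW, hc, w, hw, hwx⟩
    by_contra hxO
    have hx0 : x ≠ 0 := by
      rintro rfl
      exact hxO (zero_mem O)
    have hc0 : c ≠ 0 := by
      rintro rfl
      exact hc ⟨0, zero_mem _, zero_pow hℓ.ne_zero⟩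
    have hcM : algebraMap A M c ≠ 0 := by simpa using hc0
    have hlt : O.valuation x⁻¹ < 1 := by
      rw [← not_le, O.one_le_valuation_iff (inv_ne_zero hx0), inv_inv]
      exact hxO
    have hcx : algebraMap A M c * x ^ ℓ ≠ 0 := mul_ne_zero hcM (pow_ne_zero _ hx0)
    have hcxL : algebraMap A M c * x ^ ℓ ∈ fixedSubfield M E.fixingSubgroup :=
      mul_mem (hM.algebraMap_mem_iff.2 hcW) (pow_mem hx ℓ)
    have hsub : O.valuation ((1 + algebraMap A M c * x ^ ℓ) / (algebraMap A M c * x ^ ℓ) - 1) <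
        1 := by
      rw [div_sub_one hcx, add_sub_cancel_right, one_div, mul_inv, map_mul, map_inv₀, hVA hc0,
        inv_one, one_mul, ← inv_pow, map_pow]
      exact pow_lt_one₀ zero_le hlt hℓ.ne_zero
    obtain ⟨y, hy, hyx, hy1⟩ := exists_fixed_pow_eq O.valuation E.fixingSubgroup
      (fun g _ => hOlt g) hℓ1
      (div_mem (add_mem (one_mem _) hcxL) hcxL) hsub
    have hy0 : y ≠ 0 := by
      rintro rfl
      rw [zero_sub, Valuation.map_neg, map_one] at hy1
      exact lt_irrefl _ hy1
    have hu : (w / (x * y)) ^ ℓ = algebraMap A M c := by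
      rw [div_pow, mul_pow, hyx, ← hwx]
      have : w ^ ℓ ≠ 0 := by
        intro h0
        rw [hwx, h0, zero_div] at hyx
        exact hy0 (pow_eq_zero_iff hℓ.ne_zero |>.1 hyx)
      rw [← hwx] at this
      field_simp
    obtain ⟨d, hd⟩ := (IsAlgClosed.splits (Polynomial.X ^ ℓ - Polynomial.C c)).mem_range_of_isRoot
      (i := algebraMap A M) (Polynomial.X_pow_sub_C_ne_zero hℓ.pos c) (x := w / (x * y))
      (by simp [hu])
    refine hc ⟨d, (hM.algebraMap_mem_iff (a := d)).1 (hd ▸ div_mem hw (mul_mem hx hy)), ?_⟩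
    rw [← hd, ← map_pow, (algebraMap A M).injective.eq_iff] at hu
    exact hu

theorem IsSmoothAction.eq_of_residue [CharZero A] [IsAlgClosed A] [IsAlgClosed M]
    [IsGalois k A] (hM : IsSmoothAction k A M) (hv : IsLocalNorm p k A v) {O O' : ValuationSubring M}
    (hO : ∀ (g : A ≃ₐ[k] A), ∀ x ∈ O, g • x ∈ O)
    (hA : ∀ a : A, algebraMap A M a ∈ O)
    (hres : ∀ x ∈ O, ∃ a : A, O.valuation (x - algebraMap A M a) < 1)
    (hO' : ∀ (g : A ≃ₐ[k] A), ∀ x ∈ O', g • x ∈ O')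
    (hA' : ∀ a : A, algebraMap A M a ∈ O')
    (hres' : ∀ x ∈ O', ∃ a : A, O'.valuation (x - algebraMap A M a) < 1) : O = O' := by
  have hp0 : p ≠ 0 := by
    rintro rfl
    have := hv.map_prime_pos
    rw [Nat.cast_zero, map_zero] at this
    exact lt_irrefl _ this
  obtain ⟨ℓ, hpℓ, hℓ⟩ := Nat.exists_infinite_primes (p + 1)
  have hℓp : ℓ.Coprime p := Nat.coprime_of_lt_prime hp0 (by lia) hℓ
  ext x
  obtain ⟨E, hE, hEx⟩ := hM.exists_fixing x
  rw [hM.mem_iff_exists_pow hv hℓ hℓp hO hA hres E hEx,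
    hM.mem_iff_exists_pow hv hℓ hℓp hO' hA' hres' E hEx]

end uniqueness

/-! ### The action of a Galois section -/

theorem _root_.ValuationSubring.valuation_comap_lt_one_iff {K L : Type*} [Field K] [Field L]
    (O : ValuationSubring L) (f : K →+* L) (x : K) :
    (O.comap f).valuation x < 1 ↔ O.valuation (f x) < 1 := by
  rcases eq_or_ne x 0 with rfl | hx
  · simp
  · rw [← not_le, ← not_le, ValuationSubring.one_le_valuation_iff _ hx,
      ValuationSubring.one_le_valuation_iff _ (by simpa using hx), ValuationSubring.mem_comap,
      map_inv₀]

theorem residueEmbed_bijective_iff {k K : Type*} [Field k] [Field K] [Algebra k K]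
    {O : ValuationSubring K} {h : ∀ a : k, algebraMap k K a ∈ O} :
    Function.Bijective (residueEmbed O h) ↔
      ∀ x ∈ O, ∃ a : k, O.valuation (x - algebraMap k K a) < 1 := by
  have key : ∀ (x : O) (a : k), residueEmbed O h a = IsLocalRing.residue O x ↔
      O.valuation (x - algebraMap k K a) < 1 := by
    intro x a
    rw [eq_comm, residueEmbed, ← sub_eq_zero, ← map_sub, IsLocalRing.residue_eq_zero_iff,
      O.valuation_lt_one_iff]
    rfl
  constructor
  · rintro ⟨-, hs⟩ x hx
    obtain ⟨a, ha⟩ := hs (IsLocalRing.residue O ⟨x, hx⟩)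
    exact ⟨a, (key ⟨x, hx⟩ a).1 ha⟩
  · intro H
    refine ⟨fun a b hab => ?_, fun y => ?_⟩
    · by_contra hne
      have h1 := (key ⟨algebraMap k K b, h b⟩ a).1 hab
      rw [← map_sub, ← not_le] at h1
      refine h1 ((O.one_le_valuation_iff ?_).2 ?_)
      · simpa [sub_eq_zero] using Ne.symm hne
      · rw [← map_inv₀]
        exact h _
    · obtain ⟨x, rfl⟩ := IsLocalRing.residue_surjective y
      obtain ⟨a, ha⟩ := H x x.2
      exact ⟨a, (key x a).2 ha⟩

variable {k F Kbar : Type*} [Field k] [Field F] [Field Kbar] [Algebra k F] [Algebra F Kbar]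
  [Algebra k Kbar] [IsScalarTower k F Kbar] [IsAlgClosed Kbar]

theorem coe_resHom_apply (σ : Kbar ≃ₐ[F] Kbar) (a : algebraicClosure k Kbar) :
    (resHom k F Kbar σ a : Kbar) = σ a :=
  AlgEquiv.restrictNormalHom_apply (algebraicClosure k Kbar) (σ.restrictScalars k) a

/-- The action of the absolute Galois group of `k` on `Kbar` through a section. -/
@[reducible] def sectionAction
    (s : ((algebraicClosure k Kbar) ≃ₐ[k] (algebraicClosure k Kbar)) →* (Kbar ≃ₐ[F] Kbar)) :
    MulSemiringAction ((algebraicClosure k Kbar) ≃ₐ[k] (algebraicClosure k Kbar)) Kbar :=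
  MulSemiringAction.compHom Kbar s

theorem isSmoothAction_section [Algebra.IsAlgebraic F Kbar]
    (s : ((algebraicClosure k Kbar) ≃ₐ[k] (algebraicClosure k Kbar)) →* (Kbar ≃ₐ[F] Kbar))
    (hs_cont : Continuous s) (hs_sec : ∀ g, resHom k F Kbar (s g) = g) :
    letI := sectionAction s
    IsSmoothAction k (algebraicClosure k Kbar) Kbar := by
  let := sectionAction s
  refine ⟨fun g a => ?_, fun x => ?_⟩
  · change s g a = g a
    rw [← coe_resHom_apply (k := k) (s g), hs_sec]
  · have h1 := (stabilizer_isOpen_of_isIntegral (K := F) x).preimage hs_cont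
    have h2 := h1.mem_nhds (x := 1) (by
      rw [Set.mem_preimage, map_one]
      exact one_mem _)
    obtain ⟨E, hE, hEs⟩ := (krullTopology_mem_nhds_one_iff _ _ _).1 h2
    exact ⟨E, hE, fun g hg => hEs hg⟩

theorem existsUnique_valuationSubring_of_section (p : ℕ) [Fact p.Prime] [Algebra ℚ_[p] k]
    [FiniteDimensional ℚ_[p] k] [Algebra.IsAlgebraic F Kbar]
    (s : ((algebraicClosure k Kbar) ≃ₐ[k] (algebraicClosure k Kbar)) →* (Kbar ≃ₐ[F] Kbar))
    (hs_cont : Continuous s) (hs_sec : ∀ g, resHom k F Kbar (s g) = g) :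
    ∃! O : ValuationSubring Kbar, (∀ a : k, algebraMap k Kbar a ∈ O) ∧
      (∀ g, ∀ x : Kbar, x ∈ O ↔ s g x ∈ O) ∧
      ∀ x : F, algebraMap F Kbar x ∈ O →
        ∃ a : k, O.valuation (algebraMap F Kbar x - algebraMap k Kbar a) < 1 := by
  let := sectionAction s
  have hM : IsSmoothAction k (algebraicClosure k Kbar) Kbar :=
    isSmoothAction_section s hs_cont hs_sec
  let : Algebra ℚ_[p] (algebraicClosure k Kbar) :=
    ((algebraMap k (algebraicClosure k Kbar)).comp (algebraMap ℚ_[p] k)).toAlgebra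
  have : IsScalarTower ℚ_[p] k (algebraicClosure k Kbar) :=
    IsScalarTower.of_algebraMap_eq fun _ => rfl
  have : Algebra.IsAlgebraic ℚ_[p] (algebraicClosure k Kbar) := Algebra.IsAlgebraic.trans _ k _
  have : CharZero k := charZero_of_injective_algebraMap (algebraMap ℚ_[p] k).injective
  have : CharZero (algebraicClosure k Kbar) :=
    charZero_of_injective_algebraMap (algebraMap k (algebraicClosure k Kbar)).injective
  have : IsAlgClosed (algebraicClosure k Kbar) := IsAlgClosure.isAlgClosed k
  have : IsGalois k (algebraicClosure k Kbar) := {}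
  have hv := isLocalNorm_spectralValuation p k (algebraicClosure k Kbar)
  obtain ⟨O, hO, hA, hres⟩ := hM.exists_residue_valuationSubring hv Fact.out
  refine ⟨O, ⟨fun a => hA (algebraMap k _ a), fun g x => ⟨hO g x, fun h => ?_⟩, fun x hx => ?_⟩,
    ?_⟩
  · have h1 := hO g⁻¹ _ h
    rwa [show g⁻¹ • s g x = x from inv_smul_smul g x] at h1
  · exact hres _ (fun g _ => (s g).commutes x) hx
  · rintro O' ⟨hk', hO', hres'⟩
    have hA' := algebraMap_mem_of_isAlgebraic (A := algebraicClosure k Kbar) hk'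
    refine hM.eq_of_residue hv (fun g x hx => (hO' g x).1 hx) hA'
      (fun x hx => exists_sub_lt_one_of_isAlgebraic (K := F) hA' hres' hx) hO hA
      (fun x hx => exists_sub_lt_one_of_isAlgebraic (K := F) hA
        (fun y hy => hres _ (fun g _ => (s g).commutes y) hy) hx)

end PadicSection

/-- **Main Theorem.**  Let `k/ℚ_p` be finite and let `X` be an integral
scheme, proper, normal and of finite type over `k` (properness includes finite type),
with `k` relatively algebraically closed in `K = k(X)`.  Every birational Galois section
`s : Gal_k → Gal_K` has image in the decomposition subgroup of a *unique* valuation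
subring `Ō` of `Kbar` containing `k` such that `Ō ∩ K` has residue field `k`. -/
theorem birational_section_unique_valuation_of_proper_normal
    (p : ℕ) [Fact p.Prime]
    (k : Type) [Field k] [Algebra ℚ_[p] k] [FiniteDimensional ℚ_[p] k]
    (X : Scheme) [IsIntegral X]
    (f : X ⟶ Spec (CommRingCat.of k)) [IsProper f]
    (hnormal : ∀ x : X, IsIntegrallyClosed (X.presheaf.stalk x))
    [Algebra k X.functionField]
    -- the `k`-algebra structure on the function field `K = k(X)` is the one induced by `f`
    (halg : ∀ a : k, algebraMap k X.functionField a =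
      (@Scheme.germToFunctionField X _ ⊤ ⟨⟨Nonempty.some inferInstance, trivial⟩⟩)
        (f.appTop ((Scheme.ΓSpecIso (CommRingCat.of k)).inv a)))
    -- `k` is relatively algebraically closed in `K` (geometric irreducibility)
    (hrac : ∀ x : X.functionField, IsAlgebraic k x → x ∈ (algebraMap k X.functionField).range)
    (Kbar : Type) [Field Kbar] [Algebra X.functionField Kbar] [Algebra k Kbar]
    [IsScalarTower k X.functionField Kbar] [IsAlgClosed Kbar]
    [Algebra.IsAlgebraic X.functionField Kbar]
    -- a birational Galois section
    (s : ((algebraicClosure k Kbar) ≃ₐ[k] (algebraicClosure k Kbar)) →*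
      (Kbar ≃ₐ[X.functionField] Kbar))
    (hs_cont : Continuous s)
    (hs_sec : ∀ g, resHom k X.functionField Kbar (s g) = g) :
    ∃! Obar : ValuationSubring Kbar,
      ∃ hk : ∀ a : k, algebraMap k Kbar a ∈ Obar,
        (∀ g, ∀ x : Kbar, x ∈ Obar ↔ s g x ∈ Obar) ∧
        Function.Bijective (residueEmbed (Obar.comap (algebraMap X.functionField Kbar))
          (fun a => by
            rw [ValuationSubring.mem_comap,
              ← IsScalarTower.algebraMap_apply k X.functionField Kbar]
            exact hk a)) := by
  obtain ⟨O, ⟨hk, hO, hres⟩, huniq⟩ :=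
    PadicSection.existsUnique_valuationSubring_of_section p s hs_cont hs_sec
  refine ⟨O, ⟨hk, hO, ?_⟩, ?_⟩
  · rw [PadicSection.residueEmbed_bijective_iff]
    intro x hx
    obtain ⟨a, ha⟩ := hres x hx
    refine ⟨a, ?_⟩
    rwa [ValuationSubring.valuation_comap_lt_one_iff, map_sub,
      ← IsScalarTower.algebraMap_apply]
  · rintro O' ⟨hk', hO', hbij⟩
    rw [PadicSection.residueEmbed_bijective_iff] at hbij
    refine huniq O' ⟨hk', hO', fun x hx => ?_⟩
    obtain ⟨a, ha⟩ := hbij x hx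
    refine ⟨a, ?_⟩
    rwa [ValuationSubring.valuation_comap_lt_one_iff, map_sub,
      ← IsScalarTower.algebraMap_apply] at ha
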